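/- Let F ∈ S^♯♭(σ0,σ1) and let τ ∈ [σ1, 2σ0] be a real number such that 0 ∉ Z(F) and τ ∉ Z(F). Set z0 = 1 − 1/τ and define h(z) = (1−z)^{−2}·(ξ_F′/ξ_F)(1/(1−z)). Then h is analytic in a neighborhood of z0, and if h(z) = ∑_{m≥0} d_F(m, z0)·(z−z0)^m is its Taylor expansion at z0, then for every positive integer n, λ_F(n,τ) = τ^{−n}·d_F(n−1, z0). -/

import Mathlib

open Complex Filter MeasureTheory Finset

noncomputable section

/-- The order of vanishing of `f` at `ρ`. -/
noncomputable def zeroOrder (f : ℂ → ℂ) (ρ : ℂ) : ℕ :=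
  sInf {k : ℕ | iteratedDeriv k f ρ ≠ 0}

/-- The class `S^♯♭(σ₀,σ₁)` of `L`-functions. -/
structure SSF (σ0 σ1 : ℝ) : Type where
  hσ1pos : 0 < σ1
  hσ : σ1 ≤ σ0
  /-- The `L`-function itself (as a function, analytic away from the poles). -/
  F : ℂ → ℂ
  /-- Dirichlet series coefficients. -/
  a : ℕ → ℂ
  hDir : ∀ s : ℂ, σ0 < s.re →
    HasSum (fun n : ℕ => a (n + 1) * ((n + 1 : ℕ) : ℂ) ^ (-s)) (F s)
  hDirAbs : ∀ s : ℂ, σ0 < s.re →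
    Summable (fun n : ℕ => ‖a (n + 1) * ((n + 1 : ℕ) : ℂ) ^ (-s)‖)
  /-- The number of poles. -/
  N : ℕ
  /-- The poles `s₁, …, s_N`. -/
  pole : Fin N → ℂ
  /-- Their orders `m₁, …, m_N`. -/
  m : Fin N → ℕ
  hm : ∀ i, 0 < m i
  /-- Entire continuation of `∏ (s - sᵢ)^{mᵢ} · F s`, of finite order. -/
  G : ℂ → ℂ
  hGdiff : Differentiable ℂ G
  hGord : ∃ c B : ℝ, ∀ s : ℂ, ‖G s‖ ≤ c * Real.exp (‖s‖ ^ B)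
  hGF : ∀ s : ℂ, (∀ i, s ≠ pole i) → G s = (∏ i, (s - pole i) ^ m i) * F s
  Q : ℝ
  hQ : 0 < Q
  r : ℕ
  lam : Fin r → ℝ
  hlam : ∀ j, 0 < lam j
  mu : Fin r → ℂ
  ω : ℂ
  hω : ‖ω‖ = 1
  M : ℕ
  /-- `δ(σ₁) ∈ {0,1}`. -/
  dlt : ℕ
  hdlt : dlt ≤ 1
  hMN : 2 * M + dlt ≤ N
  hpair : ∀ (j : ℕ) (h1 : 2 * j < N) (h2 : 2 * j + 1 < N), j < M →
    pole ⟨2 * j, h1⟩ + (starRingEnd ℂ) (pole ⟨2 * j + 1, h2⟩) = (σ1 : ℂ)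
  hdelta : dlt = 1 ↔ ∃ i, pole i = (σ1 / 2 : ℂ)
  hdeltaPos : dlt = 1 → ∀ h2 : 2 * M < N, pole ⟨2 * M, h2⟩ = (σ1 / 2 : ℂ)
  /-- The completed function `ξ_F` (the analytic continuation of the completed product). -/
  xi : ℂ → ℂ
  hxiDiff : Differentiable ℂ xi
  hxiEq : ∀ s : ℂ, (∀ i, s ≠ pole i) →
    (∀ (j : Fin r) (k : ℕ), (lam j : ℂ) * s + mu j ≠ -(k : ℂ)) →
    xi s = F s * (Q : ℂ) ^ s * (∏ j, Complex.Gamma ((lam j : ℂ) * s + mu j)) *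
      (∏ i, (s - pole i) ^ m i) *
      ∏ i : Fin N, (if 2 * M + dlt ≤ (i : ℕ) then ((σ1 : ℂ) - s - (starRingEnd ℂ) (pole i)) ^ m i else 1)
  hFE : ∀ s : ℂ, xi s = ω * (starRingEnd ℂ) (xi ((σ1 : ℂ) - (starRingEnd ℂ) s))
  /-- The coefficients of the Dirichlet series of `-F'/F`. -/
  c : ℕ → ℂ
  hEuler : ∀ s : ℂ, σ0 < s.re →
    HasSum (fun n : ℕ => c (n + 2) * ((n + 2 : ℕ) : ℂ) ^ (-s)) (-(deriv F s / F s))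
  hEulerAbs : ∀ s : ℂ, σ0 < s.re →
    Summable (fun n : ℕ => ‖c (n + 2) * ((n + 2 : ℕ) : ℂ) ^ (-s)‖)

namespace SSF

variable {σ0 σ1 : ℝ}

/-- Truncated sum over the nontrivial zeros (zeros of `ξ_F`) with `|Im ρ| ≤ T`,
counted with multiplicity. -/
noncomputable def zsum (S : SSF σ0 σ1) (w : ℂ → ℂ) (T : ℝ) : ℂ :=
  ∑' ρ : {ρ : ℂ // S.xi ρ = 0 ∧ |ρ.im| ≤ T}, (zeroOrder S.xi ρ : ℂ) * w ρ

end SSF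

theorem exists_eq_prod_sub_pow_mul {f : ℂ → ℂ} (hf : Differentiable ℂ f)
    (hne : ∀ z, analyticOrderAt f z ≠ ⊤) (S : Finset ℂ) :
    ∃ h : ℂ → ℂ, Differentiable ℂ h ∧
      (∀ z, f z = (∏ ρ ∈ S, (z - ρ) ^ analyticOrderNatAt f ρ) * h z) ∧ ∀ ρ ∈ S, h ρ ≠ 0 := by
  induction S using Finset.induction_on with
  | empty => exact ⟨f, hf, by simp, by simp⟩
  | insert a S ha ih =>
    obtain ⟨h, hd, hfac, hnz⟩ := ih
    set P : ℂ → ℂ := fun z => ∏ ρ ∈ S, (z - ρ) ^ analyticOrderNatAt f ρ with hPdef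
    have hPd : Differentiable ℂ P := by
      rw [hPdef]; fun_prop
    have hPa : P a ≠ 0 := by
      refine Finset.prod_ne_zero_iff.2 fun ρ hρ => pow_ne_zero _ (sub_ne_zero.2 ?_)
      rintro rfl
      exact ha hρ
    have hfP : f = P * h := funext hfac
    have hord : analyticOrderAt h a = (analyticOrderNatAt f a : ℕ) := by
      rw [Nat.cast_analyticOrderNatAt (hne a)]
      conv_rhs => rw [hfP, analyticOrderAt_mul (hPd.analyticAt a) (hd.analyticAt a),
        (hPd.analyticAt a).analyticOrderAt_eq_zero.2 hPa, zero_add]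
    obtain ⟨g, hg, hga, hgeq⟩ := (hd.analyticAt a).analyticOrderAt_eq_natCast.1 hord
    set m := analyticOrderNatAt f a
    have hev : Function.update (fun z => h z / (z - a) ^ m) a (g a) =ᶠ[nhds a] g := by
      filter_upwards [hgeq] with z hz
      rcases eq_or_ne z a with rfl | hza
      · simp
      · rw [Function.update_of_ne hza, hz, smul_eq_mul,
          mul_div_cancel_left₀ _ (pow_ne_zero _ (sub_ne_zero.2 hza))]
    refine ⟨Function.update (fun z => h z / (z - a) ^ m) a (g a), fun z => ?_, fun z => ?_, ?_⟩
    · rcases eq_or_ne z a with rfl | hza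
      · exact hg.differentiableAt.congr_of_eventuallyEq hev
      · have : Function.update (fun z => h z / (z - a) ^ m) a (g a) =ᶠ[nhds z]
            fun z => h z / (z - a) ^ m := by
          filter_upwards [isOpen_ne.mem_nhds hza] with w hw
          rw [Function.update_of_ne hw]
        refine DifferentiableAt.congr_of_eventuallyEq ?_ this
        exact hd.differentiableAt.div (by fun_prop) (pow_ne_zero _ (sub_ne_zero.2 hza))
    · rw [Finset.prod_insert ha]
      rcases eq_or_ne z a with rfl | hza
      · have h1 := hgeq.self_of_nhds
        rw [hfac z, h1]
        simp [m]; ring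
      · rw [Function.update_of_ne hza, hfac z]
        have := pow_ne_zero m (sub_ne_zero.2 hza)
        field_simp
        rfl
    · intro ρ hρ
      rcases eq_or_ne ρ a with rfl | hne'
      · simpa using hga
      · rw [Function.update_of_ne hne']
        exact div_ne_zero (hnz ρ ((Finset.mem_insert.1 hρ).resolve_left hne'))
          (pow_ne_zero _ (sub_ne_zero.2 hne'))

theorem analyticOrderAt_ne_top_of_apply_ne_zero {f : ℂ → ℂ} (hf : Differentiable ℂ f) {c : ℂ}
    (hc : f c ≠ 0) (z : ℂ) : analyticOrderAt f z ≠ ⊤ := by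
  have h : AnalyticOnNhd ℂ f Set.univ := fun x _ => hf.analyticAt x
  refine h.analyticOrderAt_ne_top_of_isPreconnected (x := c) isPreconnected_univ trivial trivial ?_
  rw [((hf.analyticAt c).analyticOrderAt_eq_zero).2 hc]
  simp

theorem finite_zeros_inter_isCompact {f : ℂ → ℂ} (hf : Differentiable ℂ f) {c : ℂ}
    (hc : f c ≠ 0) {K : Set ℂ} (hK : IsCompact K) : {z | f z = 0 ∧ z ∈ K}.Finite := by
  by_contra hinf
  obtain ⟨x, -, hx⟩ := Set.Infinite.exists_accPt_of_subset_isCompact (K := K) hinf hK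
    (fun z hz => hz.2)
  have h1 : ∃ᶠ z in nhdsWithin x {x}ᶜ, f z = 0 := by
    rw [accPt_iff_frequently_nhdsNE] at hx
    exact hx.mono fun z hz => hz.1
  have h2 := (hf.analyticAt x).frequently_zero_iff_eventually_zero.1 h1
  exact analyticOrderAt_ne_top_of_apply_ne_zero hf hc x (analyticOrderAt_eq_top.2 h2)

theorem analyticOrderNatAt_eq_zero_of_apply_ne_zero {f : ℂ → ℂ} {z : ℂ} (hz : f z ≠ 0) :
    analyticOrderNatAt f z = 0 := by
  by_contra h
  exact hz (apply_eq_zero_of_analyticOrderNatAt_ne_zero h)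

/-- A zero-free holomorphic function bounded by `exp M` on a disc has slowly varying logarithmic
derivative near the centre. -/
theorem norm_logDeriv_sub_le_of_norm_le_exp {k : ℂ → ℂ} (hk : Differentiable ℂ k) {c : ℂ} {R M : ℝ}
    (hR : 0 < R) (hk0 : ∀ z, ‖z - c‖ < R → k z ≠ 0) (hM : 0 < M)
    (hb : ∀ z, ‖z - c‖ < R → ‖k z‖ ≤ ‖k c‖ * Real.exp M) {s : ℂ} (hs : ‖s - c‖ < R / 8) :
    ‖logDeriv k s - logDeriv k c‖ ≤ 64 * M / R ^ 2 * ‖s - c‖ := by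
  have hkc : k c ≠ 0 := hk0 c (by simpa using hR)
  have hLd : DifferentiableOn ℂ (logDeriv k) (Metric.ball c R) := by
    intro z hz
    rw [mem_ball_iff_norm] at hz
    have : DifferentiableAt ℂ (deriv k) z := (hk.analyticAt z).deriv.differentiableAt
    exact (this.div hk.differentiableAt (hk0 z hz)).differentiableWithinAt
  obtain ⟨H, hH0, hH⟩ := (hLd.isExactOn_ball).with_val_at c 0
  have hHd : DifferentiableOn ℂ H (Metric.ball c R) := fun z hz =>
    (hH z hz).differentiableAt.differentiableWithinAt
  have hexp : ∀ z ∈ Metric.ball c R, k z = k c * Complex.exp (H z) := by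
    intro z hz
    have hder : ∀ w ∈ Metric.ball c R,
        HasDerivAt (fun w => k w * Complex.exp (-H w)) 0 w := by
      intro w hw
      have h1 := (hk.differentiableAt (x := w)).hasDerivAt.mul ((hH w hw).neg.cexp)
      convert! h1 using 1
      have := hk0 w (mem_ball_iff_norm.1 hw)
      simp only [logDeriv_apply]
      field_simp
      ring
    have hconst := (Metric.isOpen_ball (x := c) (ε := R)).is_const_of_deriv_eq_zero
      (convex_ball c R).isPreconnected
      (fun w hw => (hder w hw).differentiableAt.differentiableWithinAt)
      (fun w hw => (hder w hw).deriv) hz (Metric.mem_ball_self hR)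
    simp only [hH0, neg_zero, Complex.exp_zero, mul_one] at hconst
    rw [← hconst, mul_assoc, ← Complex.exp_add]
    simp
  have hre : ∀ z ∈ Metric.ball c R, (H z).re ≤ M := by
    intro z hz
    have h1 := hb z (mem_ball_iff_norm.1 hz)
    rw [hexp z hz, norm_mul, Complex.norm_exp] at h1
    have := le_of_mul_le_mul_left h1 (norm_pos_iff.2 hkc)
    exact Real.exp_le_exp.1 this
  have hHb : ∀ z, ‖z - c‖ ≤ R / 2 → ‖H z‖ ≤ 2 * M := by
    intro z hz
    have hmap : ∀ w, w ∈ Metric.ball (0 : ℂ) R → w + c ∈ Metric.ball c R := by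
      intro w hw
      rw [mem_ball_iff_norm] at hw ⊢
      simpa using hw
    have h1 := Complex.borelCaratheodory_zero (f := fun w => H (w + c)) (z := z - c) hM
      (hHd.comp (by fun_prop) hmap) (fun w hw => hre _ (hmap w hw)) hR
      (by rw [mem_ball_iff_norm]; simp only [sub_zero]; linarith) (by simpa using hH0)
    simp only [sub_add_cancel] at h1
    refine h1.trans ?_
    rw [div_le_iff₀ (by linarith)]
    nlinarith
  have hH1 : ∀ z, ‖z - c‖ ≤ R / 4 → ‖deriv H z‖ ≤ 8 * M / R := by
    intro z hz
    have hsub : Metric.closedBall z (R / 4) ⊆ Metric.ball c R := by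
      intro w hw
      rw [mem_closedBall_iff_norm] at hw
      rw [mem_ball_iff_norm]
      have := norm_sub_le_norm_sub_add_norm_sub w z c
      linarith
    have := Complex.norm_deriv_le_of_forall_mem_sphere_norm_le (c := z) (f := H) (R := R / 4)
      (C := 2 * M) (by linarith)
      ((hHd.mono hsub).diffContOnCl_ball (U := Metric.closedBall z (R/4)) subset_rfl) (by
        intro w hw
        rw [mem_sphere_iff_norm] at hw
        refine hHb w ?_
        have := norm_sub_le_norm_sub_add_norm_sub w z c
        linarith)
    refine this.trans (le_of_eq ?_)
    field_simp
    ring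
  have hdH : ∀ z ∈ Metric.ball c R, deriv H z = logDeriv k z := fun z hz => (hH z hz).deriv
  have hdd : DifferentiableOn ℂ (deriv H) (Metric.ball c R) := hHd.deriv Metric.isOpen_ball
  have hH2 : ∀ z ∈ Metric.ball c (R / 8), ‖deriv (deriv H) z‖ ≤ 64 * M / R ^ 2 := by
    intro z hz
    rw [mem_ball_iff_norm] at hz
    have hsub : Metric.closedBall z (R / 8) ⊆ Metric.ball c R := by
      intro w hw
      rw [mem_closedBall_iff_norm] at hw
      rw [mem_ball_iff_norm]
      have := norm_sub_le_norm_sub_add_norm_sub w z c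
      linarith
    have := Complex.norm_deriv_le_of_forall_mem_sphere_norm_le (c := z) (f := deriv H) (R := R / 8)
      (C := 8 * M / R) (by linarith)
      ((hdd.mono hsub).diffContOnCl_ball (U := Metric.closedBall z (R/8)) subset_rfl) (by
        intro w hw
        rw [mem_sphere_iff_norm] at hw
        refine hH1 w ?_
        have := norm_sub_le_norm_sub_add_norm_sub w z c
        linarith)
    refine this.trans (le_of_eq ?_)
    field_simp
    ring
  have hsb : s ∈ Metric.ball c (R / 8) := mem_ball_iff_norm.2 hs
  have hcb : c ∈ Metric.ball c (R / 8) := Metric.mem_ball_self (by linarith)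
  have hss : Metric.ball c (R / 8) ⊆ Metric.ball c R := Metric.ball_subset_ball (by linarith)
  have := (convex_ball c (R / 8)).norm_image_sub_le_of_norm_deriv_le
    (fun z hz => (hdd.differentiableAt (Metric.isOpen_ball.mem_nhds (hss hz)))) hH2 hcb hsb
  rwa [hdH s (hss hsb), hdH c (hss hcb)] at this

/-- Dividing out the zeros in a disc of radius `R`, with control on the circle of radius `4R`. -/
theorem exists_zero_free_quotient {f : ℂ → ℂ} (hf : Differentiable ℂ f) {c : ℂ} (hc : f c ≠ 0)
    {R M : ℝ} (hR : 0 < R) (hb : ∀ z, ‖z - c‖ ≤ 4 * R → ‖f z‖ ≤ Real.exp M) (S : Finset ℂ)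
    (hS : ∀ ρ, ρ ∈ S ↔ f ρ = 0 ∧ ‖ρ - c‖ ≤ R) :
    ∃ k : ℂ → ℂ, Differentiable ℂ k ∧ k c = f c ∧
      (∀ z, f z = (∏ ρ ∈ S, ((z - ρ) / (c - ρ)) ^ analyticOrderNatAt f ρ) * k z) ∧
      (∀ z, ‖z - c‖ ≤ R → k z ≠ 0) ∧
      ∀ z, ‖z - c‖ ≤ 4 * R → ‖k z‖ * 3 ^ (∑ ρ ∈ S, analyticOrderNatAt f ρ) ≤ Real.exp M := by
  obtain ⟨h, hd, hfac, hnz⟩ := exists_eq_prod_sub_pow_mul hf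
    (analyticOrderAt_ne_top_of_apply_ne_zero hf hc) S
  have hcρ : ∀ ρ ∈ S, c - ρ ≠ 0 := by
    intro ρ hρ h0
    rw [← sub_eq_zero.1 h0] at hρ
    exact hc ((hS c).1 hρ).1
  set A : ℂ := ∏ ρ ∈ S, (c - ρ) ^ analyticOrderNatAt f ρ with hA
  have hA0 : A ≠ 0 := Finset.prod_ne_zero_iff.2 fun ρ hρ => pow_ne_zero _ (hcρ ρ hρ)
  have hfk : ∀ z, f z = (∏ ρ ∈ S, ((z - ρ) / (c - ρ)) ^ analyticOrderNatAt f ρ) * (h z * A) := by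
    intro z
    simp_rw [div_pow]
    rw [Finset.prod_div_distrib, hfac z, ← hA]
    field_simp
  have hkd : Differentiable ℂ (fun z => h z * A) := hd.mul_const A
  refine ⟨fun z => h z * A, hkd, ?_, hfk, ?_, ?_⟩
  · rw [hfk c]
    rw [Finset.prod_eq_one, one_mul]
    intro ρ hρ
    rw [div_self (hcρ ρ hρ), one_pow]
  · intro z hz h0
    have hfz : f z = 0 := by rw [hfk z]; simp only [h0, mul_zero]
    have := hnz z ((hS z).2 ⟨hfz, hz⟩)
    exact (mul_ne_zero this hA0) h0
  · intro z hz
    have hbd : ∀ w ∈ frontier (Metric.ball c (4 * R)),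
        ‖h w * A‖ ≤ Real.exp M / 3 ^ (∑ ρ ∈ S, analyticOrderNatAt f ρ) := by
      intro w hw
      rw [frontier_ball c (by positivity), mem_sphere_iff_norm] at hw
      rw [le_div_iff₀ (by positivity)]
      refine le_trans ?_ (hb w hw.le)
      rw [hfk w, norm_mul (∏ ρ ∈ S, ((w - ρ) / (c - ρ)) ^ analyticOrderNatAt f ρ) (h w * A),
        mul_comm ‖h w * A‖]
      refine mul_le_mul_of_nonneg_right ?_ (norm_nonneg _)
      rw [norm_prod, ← Finset.prod_pow_eq_pow_sum]
      refine Finset.prod_le_prod (fun _ _ => by positivity) fun ρ hρ => ?_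
      rw [norm_pow]
      refine pow_le_pow_left₀ (by norm_num) ?_ _
      rw [norm_div, le_div_iff₀ (norm_pos_iff.2 (hcρ ρ hρ))]
      have h1 := ((hS ρ).1 hρ).2
      have h2 := norm_sub_le_norm_sub_add_norm_sub w ρ c
      rw [norm_sub_rev c ρ]
      linarith
    have := Complex.norm_le_of_forall_mem_frontier_norm_le (U := Metric.ball c (4 * R))
      Metric.isBounded_ball (hkd.diffContOnCl) hbd (z := z) (by
        rw [closure_ball c (by positivity), mem_closedBall_iff_norm]; exact hz)
    rwa [le_div_iff₀ (by positivity)] at this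

theorem three_pow_sum_analyticOrderNatAt_le {f : ℂ → ℂ} (hf : Differentiable ℂ f) {c : ℂ}
    (hc : f c ≠ 0) {R M : ℝ} (hR : 0 < R) (hb : ∀ z, ‖z - c‖ ≤ 4 * R → ‖f z‖ ≤ Real.exp M)
    (S : Finset ℂ) (hS : ∀ ρ ∈ S, f ρ = 0 ∧ ‖ρ - c‖ ≤ R) :
    ‖f c‖ * 3 ^ (∑ ρ ∈ S, analyticOrderNatAt f ρ) ≤ Real.exp M := by
  have hfin : {z | f z = 0 ∧ z ∈ Metric.closedBall c R}.Finite :=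
    finite_zeros_inter_isCompact hf hc (isCompact_closedBall c R)
  have hST : S ⊆ hfin.toFinset := by
    intro ρ hρ
    simpa [dist_eq_norm] using hS ρ hρ
  obtain ⟨k, -, hkc, -, -, hk⟩ := exists_zero_free_quotient hf hc hR hb hfin.toFinset
    (by simp [dist_eq_norm])
  refine le_trans ?_ (hk c (by simp; positivity))
  rw [hkc]
  have := Finset.sum_le_sum_of_subset (f := fun ρ => analyticOrderNatAt f ρ) hST
  gcongr
  norm_num

theorem norm_logDeriv_sub_sum_le {f : ℂ → ℂ} (hf : Differentiable ℂ f) {c : ℂ}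
    (hc : f c ≠ 0) {R M : ℝ} (hR : 0 < R) (hb : ∀ z, ‖z - c‖ ≤ 4 * R → ‖f z‖ ≤ Real.exp M)
    (S : Finset ℂ) (hS : ∀ ρ, ρ ∈ S ↔ f ρ = 0 ∧ ‖ρ - c‖ ≤ R) {M' : ℝ} (hM' : 0 < M')
    (hMM : Real.exp M ≤ ‖f c‖ * Real.exp M') {s : ℂ} (hs : ‖s - c‖ < R / 8) (hfs : f s ≠ 0) :
    ‖logDeriv f s - logDeriv f c -
      ∑ ρ ∈ S, (analyticOrderNatAt f ρ : ℂ) * (1 / (s - ρ) + 1 / (ρ - c))‖ ≤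
      64 * M' / R ^ 2 * ‖s - c‖ := by
  obtain ⟨k, hkd, hkc, hfk, hk0, hk⟩ := exists_zero_free_quotient hf hc hR hb S hS
  have hkb : ∀ z, ‖z - c‖ < R → ‖k z‖ ≤ ‖k c‖ * Real.exp M' := by
    intro z hz
    rw [hkc]
    refine le_trans ?_ ((hk z (by linarith)).trans hMM)
    refine le_mul_of_one_le_right (norm_nonneg _) (one_le_pow₀ (by norm_num))
  refine le_trans (le_of_eq ?_) (norm_logDeriv_sub_le_of_norm_le_exp hkd hR
    (fun z hz => hk0 z hz.le) hM' hkb hs)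
  have hlog : ∀ z, f z ≠ 0 → logDeriv f z =
      ∑ ρ ∈ S, (analyticOrderNatAt f ρ : ℂ) * (1 / (z - ρ)) + logDeriv k z := by
    intro z hz
    have hρz : ∀ ρ ∈ S, z - ρ ≠ 0 := by
      intro ρ hρ h0
      rw [sub_eq_zero.1 h0] at hz
      exact hz ((hS ρ).1 hρ).1
    have hρc : ∀ ρ ∈ S, c - ρ ≠ 0 := by
      intro ρ hρ h0
      rw [← sub_eq_zero.1 h0] at hρ
      exact hc ((hS c).1 hρ).1
    have hne : ∀ ρ ∈ S, ((z - ρ) / (c - ρ)) ^ analyticOrderNatAt f ρ ≠ 0 := fun ρ hρ =>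
      pow_ne_zero _ (div_ne_zero (hρz ρ hρ) (hρc ρ hρ))
    have hd : ∀ ρ ∈ S, DifferentiableAt ℂ
        (fun z => ((z - ρ) / (c - ρ)) ^ analyticOrderNatAt f ρ) z := fun ρ hρ => by fun_prop
    have hkz : k z ≠ 0 := by
      intro h0
      rw [hfk z, h0, mul_zero] at hz
      exact hz rfl
    have e : f = fun z => (∏ ρ ∈ S, ((z - ρ) / (c - ρ)) ^ analyticOrderNatAt f ρ) * k z :=
      funext hfk
    conv_lhs => rw [e]
    rw [logDeriv_mul z (Finset.prod_ne_zero_iff.2 hne) hkz (by fun_prop) hkd.differentiableAt,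
      logDeriv_prod hne hd]
    congr 1
    refine Finset.sum_congr rfl fun ρ hρ => ?_
    rw [logDeriv_fun_pow (by fun_prop)]
    congr 1
    simp only [div_eq_mul_inv]
    rw [logDeriv_mul_const z _ (inv_ne_zero (hρc ρ hρ)), logDeriv_apply]
    simp
  rw [hlog s hfs, hlog c hc]
  congr 1
  simp_rw [mul_add]
  rw [Finset.sum_add_distrib]
  have : ∑ ρ ∈ S, (analyticOrderNatAt f ρ : ℂ) * (1 / (ρ - c)) =
      - ∑ ρ ∈ S, (analyticOrderNatAt f ρ : ℂ) * (1 / (c - ρ)) := by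
    rw [← Finset.sum_neg_distrib]
    refine Finset.sum_congr rfl fun ρ _ => ?_
    rw [← neg_sub c ρ, div_neg, mul_neg]
  rw [this]
  ring

/-- `f` has growth of order at most `5/4` around `c`. -/
def GrowthBound (f : ℂ → ℂ) (c : ℂ) : Prop :=
  ∃ C : ℝ, 0 < C ∧ ∀ R : ℝ, 1 ≤ R → ∀ z, ‖z - c‖ ≤ R → ‖f z‖ ≤ Real.exp (C * R ^ (5 / 4 : ℝ))

theorem exists_one_add_norm_sub_le {f : ℂ → ℂ} (hf : Continuous f) {s : ℂ} (hs : f s ≠ 0) (c : ℂ) :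
    ∃ W : ℝ, 0 < W ∧ ∀ ρ, f ρ = 0 → 1 + ‖ρ - c‖ ≤ W * ‖ρ - s‖ := by
  obtain ⟨ε, hε, h⟩ := Metric.eventually_nhds_iff.1 (hf.continuousAt.eventually_ne hs)
  refine ⟨1 + (1 + ‖s - c‖) / ε, by positivity, fun ρ hρ => ?_⟩
  have h1 : ε ≤ ‖ρ - s‖ := by
    by_contra! hlt
    exact h (by rwa [dist_eq_norm]) hρ
  have h2 := norm_sub_le_norm_sub_add_norm_sub ρ s c
  have h3 : 1 + ‖s - c‖ ≤ (1 + ‖s - c‖) / ε * ‖ρ - s‖ := by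
    rw [div_mul_eq_mul_div, le_div_iff₀ hε]
    gcongr
  linarith

theorem GrowthBound.sum_analyticOrderNatAt_le {f : ℂ → ℂ} {c : ℂ} (hg : GrowthBound f c)
    (hf : Differentiable ℂ f) (hc : f c ≠ 0) :
    ∃ K : ℝ, 0 < K ∧ ∀ R : ℝ, 1 ≤ R → ∀ S : Finset ℂ, (∀ ρ ∈ S, ‖ρ - c‖ ≤ R) →
      ∑ ρ ∈ S, (analyticOrderNatAt f ρ : ℝ) ≤ K * R ^ (5 / 4 : ℝ) := by
  obtain ⟨C, hC, hb⟩ := hg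
  refine ⟨C * 4 ^ (5 / 4 : ℝ) + |Real.log ‖f c‖|, by positivity, fun R hR S hS => ?_⟩
  classical
  have hfilt : ∑ ρ ∈ S, analyticOrderNatAt f ρ =
      ∑ ρ ∈ S.filter (fun ρ => f ρ = 0), analyticOrderNatAt f ρ := by
    rw [Finset.sum_filter]
    refine Finset.sum_congr rfl fun ρ _ => ?_
    split_ifs with h
    · rfl
    · exact analyticOrderNatAt_eq_zero_of_apply_ne_zero h
  have h1 := three_pow_sum_analyticOrderNatAt_le hf hc (R := R) (by linarith)
    (hb (4 * R) (by linarith)) (S.filter (fun ρ => f ρ = 0))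
    (by intro ρ hρ; rw [Finset.mem_filter] at hρ; exact ⟨hρ.2, hS ρ hρ.1⟩)
  rw [← hfilt] at h1
  have hpos : 0 < ‖f c‖ := norm_pos_iff.2 hc
  have h2 := Real.log_le_log (by positivity) h1
  rw [Real.log_exp, Real.log_mul hpos.ne' (by positivity), Real.log_pow,
    Real.mul_rpow (by norm_num) (by linarith)] at h2
  have h3 : (1 : ℝ) ≤ Real.log 3 := by
    rw [Real.le_log_iff_exp_le (by norm_num)]
    exact Real.exp_one_lt_three.le
  have h4 := neg_abs_le (Real.log ‖f c‖)
  have h5 : (1 : ℝ) ≤ R ^ (5 / 4 : ℝ) := Real.one_le_rpow hR (by norm_num)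
  have h6 : |Real.log ‖f c‖| ≤ |Real.log ‖f c‖| * R ^ (5 / 4 : ℝ) :=
    le_mul_of_one_le_right (abs_nonneg _) h5
  have h7 : ((∑ ρ ∈ S, analyticOrderNatAt f ρ : ℕ) : ℝ) ≤
      ((∑ ρ ∈ S, analyticOrderNatAt f ρ : ℕ) : ℝ) * Real.log 3 :=
    le_mul_of_one_le_right (by positivity) h3
  push_cast at h7 h2 ⊢
  rw [add_mul]
  linarith

theorem summable_mul_max_rpow_of_sum_le {ι : Type*} {m : ι → ℝ} {x : ι → ℝ} (hm : ∀ i, 0 ≤ m i)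
    {K : ℝ} (hK : 0 < K)
    (h : ∀ R : ℝ, 1 ≤ R → ∀ S : Finset ι, (∀ i ∈ S, x i ≤ R) → ∑ i ∈ S, m i ≤ K * R ^ (5 / 4 : ℝ)) :
    Summable fun i => m i * (max 1 (x i)) ^ (-(3 / 2) : ℝ) := by
  choose k hk1 hk2 using fun i => exists_nat_pow_near (le_max_left 1 (x i)) (one_lt_two (α := ℝ))
  set q : ℝ := 2 ^ (-(1 / 4) : ℝ) with hq
  have hq0 : 0 < q := by positivity
  have hq1 : q < 1 := Real.rpow_lt_one_of_one_lt_of_neg (by norm_num) (by norm_num)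
  have hpow : ∀ n : ℕ, ((2 : ℝ) ^ n) ^ (-(3 / 2) : ℝ) * (K * (2 ^ (n + 1)) ^ (5 / 4 : ℝ)) =
      K * 2 ^ (5 / 4 : ℝ) * q ^ n := by
    intro n
    rw [hq, ← Real.rpow_natCast, ← Real.rpow_natCast, ← Real.rpow_natCast, ← Real.rpow_mul,
      ← Real.rpow_mul, ← Real.rpow_mul, mul_left_comm, mul_assoc, ← Real.rpow_add, ← Real.rpow_add]
    · push_cast; congr 2; ring
    all_goals norm_num
  refine summable_of_sum_le (c := K * 2 ^ (5 / 4 : ℝ) * (1 - q)⁻¹)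
    (fun i => mul_nonneg (hm i) (by positivity)) fun S => ?_
  have h1 : ∀ i ∈ S, m i * (max 1 (x i)) ^ (-(3 / 2) : ℝ) ≤
      m i * ((2 : ℝ) ^ (k i)) ^ (-(3 / 2) : ℝ) := by
    intro i _
    refine mul_le_mul_of_nonneg_left ?_ (hm i)
    exact Real.rpow_le_rpow_of_nonpos (by positivity) (hk1 i) (by norm_num)
  refine (Finset.sum_le_sum h1).trans ?_
  set N := S.sup k + 1
  have hmaps : ∀ i ∈ S, k i ∈ Finset.range N := by
    intro i hi
    rw [Finset.mem_range]
    exact Nat.lt_succ_of_le (Finset.le_sup hi)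
  rw [← Finset.sum_fiberwise_of_maps_to hmaps]
  have h2 : ∀ n ∈ Finset.range N, ∑ i ∈ S with k i = n, m i * ((2 : ℝ) ^ (k i)) ^ (-(3 / 2) : ℝ) ≤
      K * 2 ^ (5 / 4 : ℝ) * q ^ n := by
    intro n _
    rw [← hpow n]
    have : ∑ i ∈ S with k i = n, m i * ((2 : ℝ) ^ (k i)) ^ (-(3 / 2) : ℝ) =
        ((2 : ℝ) ^ n) ^ (-(3 / 2) : ℝ) * ∑ i ∈ S with k i = n, m i := by
      rw [Finset.mul_sum]
      refine Finset.sum_congr rfl fun i hi => ?_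
      rw [(Finset.mem_filter.1 hi).2, mul_comm]
    rw [this]
    refine mul_le_mul_of_nonneg_left ?_ (by positivity)
    refine h _ (one_le_pow₀ (by norm_num)) _ fun i hi => ?_
    have := hk2 i
    rw [(Finset.mem_filter.1 hi).2] at this
    exact (le_max_right _ _).trans this.le
  refine (Finset.sum_le_sum h2).trans ?_
  rw [← Finset.mul_sum]
  refine mul_le_mul_of_nonneg_left ?_ (by positivity)
  have := (summable_geometric_of_lt_one hq0.le hq1).sum_le_tsum (Finset.range N)
    (fun i _ => by positivity)
  rwa [tsum_geometric_of_lt_one hq0.le hq1] at this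

theorem GrowthBound.summable_max {f : ℂ → ℂ} {c : ℂ} (hg : GrowthBound f c)
    (hf : Differentiable ℂ f) (hc : f c ≠ 0) :
    Summable fun ρ : ℂ => (analyticOrderNatAt f ρ : ℝ) * (max 1 ‖ρ - c‖) ^ (-(3 / 2) : ℝ) := by
  obtain ⟨K, hK, h⟩ := hg.sum_analyticOrderNatAt_le hf hc
  exact summable_mul_max_rpow_of_sum_le (fun _ => by positivity) hK h

theorem GrowthBound.summable_rpow {f : ℂ → ℂ} {c : ℂ} (hg : GrowthBound f c)
    (hf : Differentiable ℂ f) (hc : f c ≠ 0) :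
    Summable fun ρ : ℂ => (analyticOrderNatAt f ρ : ℝ) * ‖ρ - c‖ ^ (-(3 / 2) : ℝ) := by
  obtain ⟨W, hW, h⟩ := exists_one_add_norm_sub_le hf.continuous hc c
  refine Summable.of_nonneg_of_le (fun _ => by positivity) (fun ρ => ?_)
    ((hg.summable_max hf hc).mul_left (W ^ (3 / 2 : ℝ)))
  by_cases h0 : f ρ = 0
  · have h1 := h ρ h0
    have h2 : max 1 ‖ρ - c‖ ≤ W * ‖ρ - c‖ :=
      (max_le (by linarith [norm_nonneg (ρ - c)]) (by linarith)).trans h1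
    have h3 : 0 < ‖ρ - c‖ := by
      rw [norm_pos_iff, sub_ne_zero]
      rintro rfl
      exact hc h0
    have h4 := Real.rpow_le_rpow_of_nonpos (z := (-(3 / 2) : ℝ)) (by positivity) h2 (by norm_num)
    rw [Real.mul_rpow hW.le h3.le] at h4
    have h5 : ‖ρ - c‖ ^ (-(3 / 2) : ℝ) =
        W ^ (3 / 2 : ℝ) * (W ^ (-(3 / 2) : ℝ) * ‖ρ - c‖ ^ (-(3 / 2) : ℝ)) := by
      rw [← mul_assoc, ← Real.rpow_add hW]
      simp
    rw [h5, mul_left_comm]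
    gcongr
  · simp [analyticOrderNatAt_eq_zero_of_apply_ne_zero h0]

theorem GrowthBound.summable_inv_sq {f : ℂ → ℂ} {c : ℂ} (hg : GrowthBound f c)
    (hf : Differentiable ℂ f) (hc : f c ≠ 0) :
    Summable fun ρ : ℂ => (analyticOrderNatAt f ρ : ℝ) * (1 + ‖ρ - c‖ ^ 2)⁻¹ := by
  refine Summable.of_nonneg_of_le (fun _ => by positivity) (fun ρ => ?_)
    (hg.summable_max hf hc)
  refine mul_le_mul_of_nonneg_left ?_ (by positivity)
  have h1 : (max 1 ‖ρ - c‖) ^ 2 ≤ 1 + ‖ρ - c‖ ^ 2 := by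
    rcases max_cases 1 ‖ρ - c‖ with h | h <;> rw [h.1] <;> nlinarith [norm_nonneg (ρ - c)]
  have h0 : (1 : ℝ) ≤ max 1 ‖ρ - c‖ := le_max_left _ _
  calc (1 + ‖ρ - c‖ ^ 2)⁻¹ ≤ ((max 1 ‖ρ - c‖) ^ 2)⁻¹ := inv_anti₀ (by positivity) h1
    _ = (max 1 ‖ρ - c‖) ^ (-2 : ℝ) := by
        rw [Real.rpow_neg (by positivity)]; norm_cast
    _ ≤ _ := Real.rpow_le_rpow_of_exponent_le h0 (by norm_num)

/-- Sums of a summable family over growing discs. -/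
theorem tendsto_tsum_indicator_closedBall {E : Type*} [NormedAddCommGroup E] [CompleteSpace E]
    {t : ℂ → E} (ht : Summable fun ρ => ‖t ρ‖) (c : ℂ) :
    Tendsto (fun n : ℕ => ∑' ρ, (Metric.closedBall c n).indicator t ρ) atTop (nhds (∑' ρ, t ρ)) := by
  refine tendsto_tsum_of_dominated_convergence ht (fun ρ => ?_)
    (.of_forall fun n ρ => norm_indicator_le_norm_self _ _)
  refine tendsto_const_nhds.congr' ?_
  obtain ⟨N, hN⟩ := exists_nat_ge (dist ρ c)
  filter_upwards [eventually_ge_atTop N] with n hn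
  rw [Set.indicator_of_mem]
  exact hN.trans (by exact_mod_cast hn)

theorem GrowthBound.summable_norm_partialFraction {f : ℂ → ℂ} {c : ℂ} (hg : GrowthBound f c)
    (hf : Differentiable ℂ f) (hc : f c ≠ 0) {s : ℂ} (hs : f s ≠ 0) :
    Summable fun ρ : ℂ => ‖(analyticOrderNatAt f ρ : ℂ) * (1 / (s - ρ) + 1 / (ρ - c))‖ := by
  obtain ⟨W, hW, h⟩ := exists_one_add_norm_sub_le hf.continuous hs c
  obtain ⟨W', hW', h'⟩ := exists_one_add_norm_sub_le hf.continuous hc c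
  refine Summable.of_nonneg_of_le (fun _ => by positivity) (fun ρ => ?_)
    ((hg.summable_inv_sq hf hc).mul_left (‖s - c‖ * (W * W')))
  by_cases h0 : f ρ = 0
  · have h1 : s - ρ ≠ 0 := by
      rw [sub_ne_zero]; rintro rfl; exact hs h0
    have h2 : ρ - c ≠ 0 := by
      rw [sub_ne_zero]; rintro rfl; exact hc h0
    have h3 : (1 / (s - ρ) + 1 / (ρ - c)) = (s - c) / ((s - ρ) * (ρ - c)) := by
      field_simp; ring
    rw [h3, norm_mul, norm_div, norm_mul, mul_left_comm, Complex.norm_natCast]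
    refine mul_le_mul_of_nonneg_left ?_ (by positivity)
    rw [div_eq_mul_inv, mul_assoc]
    refine mul_le_mul_of_nonneg_left ?_ (norm_nonneg _)
    have h4 := h ρ h0
    have h5 := h' ρ h0
    rw [norm_sub_rev s ρ]
    have h6 : 0 < ‖ρ - s‖ := by rw [norm_sub_rev]; exact norm_pos_iff.2 h1
    have h7 : 0 < ‖ρ - c‖ := norm_pos_iff.2 h2
    rw [← div_eq_mul_inv, inv_eq_one_div, div_le_div_iff₀ (by positivity) (by positivity)]
    have := mul_le_mul h4 h5 (by positivity) (by positivity)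
    nlinarith
  · simp [analyticOrderNatAt_eq_zero_of_apply_ne_zero h0]

/-- Partial fraction expansion of the logarithmic derivative. -/
theorem GrowthBound.hasSum_logDeriv {f : ℂ → ℂ} {c : ℂ} (hg : GrowthBound f c)
    (hf : Differentiable ℂ f) (hc : f c ≠ 0) {s : ℂ} (hs : f s ≠ 0) :
    HasSum (fun ρ : ℂ => (analyticOrderNatAt f ρ : ℂ) * (1 / (s - ρ) + 1 / (ρ - c)))
      (logDeriv f s - logDeriv f c) := by
  have hsum := hg.summable_norm_partialFraction hf hc hs
  set t := fun ρ : ℂ => (analyticOrderNatAt f ρ : ℂ) * (1 / (s - ρ) + 1 / (ρ - c)) with ht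
  rw [hsum.of_norm.hasSum_iff]
  refine tendsto_nhds_unique (tendsto_tsum_indicator_closedBall hsum c) ?_
  obtain ⟨C, hC, hb⟩ := hg
  have hfin : ∀ n : ℕ, {z | f z = 0 ∧ z ∈ Metric.closedBall c n}.Finite := fun n =>
    finite_zeros_inter_isCompact hf hc (isCompact_closedBall c n)
  have hts : ∀ n : ℕ, ∑' ρ, (Metric.closedBall c n).indicator t ρ = ∑ ρ ∈ (hfin n).toFinset, t ρ := by
    intro n
    rw [tsum_eq_sum (s := (hfin n).toFinset)]
    · refine Finset.sum_congr rfl fun ρ hρ => ?_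
      rw [Set.Finite.mem_toFinset] at hρ
      exact Set.indicator_of_mem hρ.2 _
    · intro ρ hρ
      rw [Set.Finite.mem_toFinset] at hρ
      by_cases h1 : ρ ∈ Metric.closedBall c n
      · have h2 : f ρ ≠ 0 := fun h => hρ ⟨h, h1⟩
        rw [Set.indicator_of_mem h1, ht]
        simp [analyticOrderNatAt_eq_zero_of_apply_ne_zero h2]
      · exact Set.indicator_of_notMem h1 _
  set L := |Real.log ‖f c‖| + 1
  have hlim : Tendsto (fun n : ℕ => 64 * (C * 4 ^ (5 / 4 : ℝ) * (n : ℝ) ^ (5 / 4 : ℝ) + L) /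
      (n : ℝ) ^ 2 * ‖s - c‖) atTop (nhds 0) := by
    have h1 : Tendsto (fun x : ℝ => x ^ (-(3 / 4) : ℝ)) atTop (nhds 0) :=
      tendsto_rpow_neg_atTop (by norm_num)
    have h2 : Tendsto (fun x : ℝ => x ^ (-2 : ℝ)) atTop (nhds 0) :=
      tendsto_rpow_neg_atTop (by norm_num)
    have h3 := (((h1.const_mul (64 * C * 4 ^ (5 / 4 : ℝ))).add (h2.const_mul (64 * L))).mul_const
      ‖s - c‖).comp tendsto_natCast_atTop_atTop
    simp only [mul_zero, add_zero, zero_mul] at h3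
    refine h3.congr' ?_
    filter_upwards [eventually_ge_atTop 1] with n hn
    have hn' : (0 : ℝ) < n := by exact_mod_cast hn
    simp only [Function.comp]
    congr 1
    have e1 : (n : ℝ) ^ (-(3 / 4) : ℝ) = (n : ℝ) ^ (5 / 4 : ℝ) / (n : ℝ) ^ 2 := by
      rw [← Real.rpow_natCast, ← Real.rpow_sub hn']; norm_num
    have e2 : (n : ℝ) ^ (-2 : ℝ) = 1 / (n : ℝ) ^ 2 := by
      rw [Real.rpow_neg hn'.le, one_div]; norm_cast
    rw [e1, e2]
    ring
  rw [tendsto_iff_norm_sub_tendsto_zero]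
  refine squeeze_zero' (.of_forall fun _ => norm_nonneg _) ?_ hlim
  have hev : ∀ᶠ n : ℕ in atTop, 1 ≤ (n : ℝ) ∧ 8 * ‖s - c‖ < n := by
    exact (tendsto_natCast_atTop_atTop.eventually_ge_atTop 1).and
      (tendsto_natCast_atTop_atTop.eventually_gt_atTop _)
  filter_upwards [hev] with n hn
  have hpos : 0 < ‖f c‖ := norm_pos_iff.2 hc
  rw [hts n, norm_sub_rev]
  refine norm_logDeriv_sub_sum_le hf hc (R := n) (M := C * (4 * n) ^ (5 / 4 : ℝ)) (by linarith)
    (hb _ (by linarith)) _ (by simp [dist_eq_norm]) (by positivity) ?_ (by linarith) hs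
  rw [Real.mul_rpow (by norm_num) (by linarith), Real.exp_add, mul_assoc C,
    mul_left_comm ‖f c‖]
  refine le_mul_of_one_le_right (Real.exp_pos _).le ?_
  have : Real.exp (-Real.log ‖f c‖) ≤ Real.exp L := by
    refine Real.exp_le_exp.2 ?_
    have := neg_le_abs (Real.log ‖f c‖)
    simp only [L]; linarith
  rw [Real.exp_neg, Real.exp_log hpos] at this
  calc 1 = ‖f c‖ * ‖f c‖⁻¹ := (mul_inv_cancel₀ hpos.ne').symm
    _ ≤ _ := by gcongr

theorem tendsto_deriv_of_tendsto_of_norm_le {f : ℕ → ℂ → ℂ} {g : ℂ → ℂ} {z : ℂ} {r B : ℝ}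
    (hr : 0 < r) {U : Set ℂ} (hU : IsOpen U) (hzU : Metric.closedBall z r ⊆ U)
    (hf : ∀ᶠ n in atTop, DifferentiableOn ℂ (f n) U) (hg : DifferentiableOn ℂ g U)
    (hb : ∀ᶠ n in atTop, ∀ w ∈ Metric.sphere z r, ‖f n w‖ ≤ B)
    (hlim : ∀ w ∈ Metric.sphere z r, Tendsto (fun n => f n w) atTop (nhds (g w))) :
    Tendsto (fun n => deriv (f n) z) atTop (nhds (deriv g z)) := by
  have hz : z ∈ Metric.ball z r := Metric.mem_ball_self hr
  rw [← two_pi_I_inv_smul_circleIntegral_sub_sq_inv_smul_of_differentiable hU hzU hg hz]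
  have hev : ∀ᶠ n in atTop, (2 * Real.pi * I : ℂ)⁻¹ • (∮ w in C(z, r), ((w - z) ^ 2)⁻¹ • f n w) =
      deriv (f n) z := hf.mono fun n hn =>
    two_pi_I_inv_smul_circleIntegral_sub_sq_inv_smul_of_differentiable hU hzU hn hz
  refine Tendsto.congr' hev (Tendsto.const_smul ?_ _)
  have hsph : ∀ θ, circleMap z r θ ∈ Metric.sphere z r := circleMap_mem_sphere z hr.le
  have hne : ∀ θ, circleMap z r θ - z ≠ 0 := by
    intro θ; simp [circleMap, hr.ne']
  have hcont : ∀ g : ℂ → ℂ, DifferentiableOn ℂ g U → Continuous fun θ : ℝ =>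
      deriv (circleMap z r) θ • (((circleMap z r θ - z) ^ 2)⁻¹ • g (circleMap z r θ)) := by
    intro g hg
    have h1 : Continuous fun θ : ℝ => g (circleMap z r θ) :=
      hg.continuousOn.comp_continuous (continuous_circleMap z r)
        fun θ => hzU (Metric.sphere_subset_closedBall (hsph θ))
    have h2 : Continuous fun θ : ℝ => ((circleMap z r θ - z) ^ 2)⁻¹ := by
      refine Continuous.inv₀ ?_ fun θ => pow_ne_zero _ (hne θ)
      have := continuous_circleMap z r
      fun_prop
    have h3 : Continuous fun θ : ℝ => deriv (circleMap z r) θ := by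
      simp only [deriv_circleMap]
      have := continuous_circleMap 0 r
      fun_prop
    exact h3.smul (h2.smul h1)
  simp only [circleIntegral]
  refine intervalIntegral.tendsto_integral_filter_of_dominated_convergence
    (fun _ => r * ((r ^ 2)⁻¹ * B)) ?_ ?_ ?_ ?_
  · exact hf.mono fun n hn => (hcont _ hn).aestronglyMeasurable
  · filter_upwards [hb] with n hn
    refine .of_forall fun θ _ => ?_
    rw [norm_smul, norm_smul, norm_inv, norm_pow, deriv_circleMap, norm_mul]
    have h1 : ‖circleMap z r θ - z‖ = r := by simp [circleMap, abs_of_pos hr]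
    have h2 : ‖circleMap 0 r θ‖ = r := by simp [circleMap, abs_of_pos hr]
    rw [h1, h2, Complex.norm_I, mul_one]
    gcongr
    exact hn _ (hsph θ)
  · exact intervalIntegrable_const
  · exact .of_forall fun θ _ => ((hlim _ (hsph θ)).const_smul _).const_smul _

theorem norm_GammaSeq_le {s : ℂ} (hs : 0 < s.re) {n : ℕ} (hn : n ≠ 0) :
    ‖Complex.GammaSeq s n‖ ≤ Real.Gamma s.re := by
  rw [Complex.GammaSeq_eq_approx_Gamma_integral hs hn, Real.Gamma_eq_integral hs,
    intervalIntegral.integral_of_le (by positivity)]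
  have hint := Real.GammaIntegral_convergent hs
  refine (norm_integral_le_of_norm_le (hint.mono_set Set.Ioc_subset_Ioi_self)
    (ae_restrict_of_forall_mem measurableSet_Ioc fun x hx => ?_)).trans ?_
  · rw [norm_mul, norm_cpow_eq_rpow_re_of_pos hx.1, Complex.norm_of_nonneg
      (pow_nonneg (sub_nonneg.2 (div_le_one_of_le₀ hx.2 (by positivity))) _)]
    rw [sub_re, one_re]
    have := hx.1
    gcongr
    exact Real.one_sub_div_pow_le_exp_neg hx.2
  · refine setIntegral_mono_set hint ?_ (Set.Ioc_subset_Ioi_self.eventuallyLE)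
    exact ae_restrict_of_forall_mem measurableSet_Ioi fun x hx => by
      have : 0 < x := hx
      simp only [Pi.zero_apply]; positivity

theorem add_natCast_ne_zero {s : ℂ} (hs : 0 < s.re) (j : ℕ) : s + j ≠ 0 := by
  intro h
  have := congrArg Complex.re h
  simp at this
  have : (0 : ℝ) ≤ j := by positivity
  linarith

theorem hasDerivAt_GammaSeq {s : ℂ} (hs : 0 < s.re) {n : ℕ} (hn : n ≠ 0) :
    HasDerivAt (fun s => Complex.GammaSeq s n)
      (Complex.GammaSeq s n * (Real.log n - ∑ j ∈ Finset.range (n + 1), 1 / (s + j))) s := by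
  have hP0 : ∏ j ∈ Finset.range (n + 1), (s + j) ≠ 0 :=
    Finset.prod_ne_zero_iff.2 fun j _ => add_natCast_ne_zero hs j
  have hPd : DifferentiableAt ℂ (fun s : ℂ => ∏ j ∈ Finset.range (n + 1), (s + (j : ℂ))) s := by
    fun_prop
  have hn0 : (n : ℂ) ≠ 0 := by exact_mod_cast hn
  have hlog : logDeriv (fun s : ℂ => ∏ j ∈ Finset.range (n + 1), (s + (j : ℂ))) s =
      ∑ j ∈ Finset.range (n + 1), 1 / (s + j) := by
    rw [logDeriv_prod (fun j _ => add_natCast_ne_zero hs j) (fun j _ => by fun_prop)]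
    refine Finset.sum_congr rfl fun j _ => ?_
    simp [logDeriv_apply]
  have hnum : HasDerivAt (fun s : ℂ => (n : ℂ) ^ s * (n.factorial : ℂ))
      ((n : ℂ) ^ s * Complex.log n * (n.factorial : ℂ)) s := by
    have := (hasDerivAt_id s).const_cpow (c := (n : ℂ)) (Or.inl hn0)
    simpa using this.mul_const (n.factorial : ℂ)
  have h := hnum.div hPd.hasDerivAt hP0
  rw [logDeriv_apply, div_eq_iff hP0] at hlog
  rw [hlog] at h
  change HasDerivAt (fun s => Complex.GammaSeq s n) _ s at h
  refine h.congr_deriv ?_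
  unfold Complex.GammaSeq
  rw [← Complex.natCast_log]
  field_simp

theorem tendsto_digamma {s : ℂ} (hs : 0 < s.re) :
    Tendsto (fun n : ℕ => (Real.log n : ℂ) - ∑ j ∈ Finset.range (n + 1), 1 / (s + j)) atTop
      (nhds (Complex.digamma s)) := by
  have hU : IsOpen {z : ℂ | 0 < z.re} := isOpen_lt continuous_const Complex.continuous_re
  have hball : Metric.closedBall s (s.re / 2) ⊆ {z : ℂ | 0 < z.re} := by
    intro z hz
    rw [mem_closedBall_iff_norm] at hz
    have := (abs_le.1 (Complex.abs_re_le_norm (z - s))).1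
    simp at this ⊢
    linarith
  have hne : ∀ z : ℂ, 0 < z.re → ∀ m : ℕ, z ≠ -m := by
    intro z hz m h
    exact add_natCast_ne_zero hz m (by rw [h]; ring)
  obtain ⟨B, hB⟩ := (isCompact_closedBall s (s.re / 2)).exists_bound_of_continuousOn
    (f := fun z : ℂ => Real.Gamma z.re) (by
      intro z hz
      have hz' : 0 < z.re := hball hz
      have h1 : ContinuousAt Real.Gamma z.re :=
        (Real.differentiableAt_Gamma fun m => by
          have : (0 : ℝ) ≤ m := by positivity
          linarith).continuousAt
      exact (ContinuousAt.comp (f := Complex.re) h1 Complex.continuous_re.continuousAt).continuousWithinAt)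
  have h := tendsto_deriv_of_tendsto_of_norm_le (f := fun n s => Complex.GammaSeq s n)
    (g := Complex.Gamma) (z := s) (r := s.re / 2) (B := B) (by linarith) hU hball
    ((eventually_ne_atTop 0).mono fun n hn z hz =>
      (hasDerivAt_GammaSeq hz hn).differentiableAt.differentiableWithinAt)
    (fun z hz => (Complex.differentiableAt_Gamma z (hne z hz)).differentiableWithinAt)
    ((eventually_ne_atTop 0).mono fun n hn z hz =>
      (norm_GammaSeq_le (hball (Metric.sphere_subset_closedBall hz)) hn).trans
        ((le_abs_self _).trans (hB z (Metric.sphere_subset_closedBall hz))))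
    (fun z _ => Complex.GammaSeq_tendsto_Gamma z)
  have h2 := h.div (Complex.GammaSeq_tendsto_Gamma s) (Complex.Gamma_ne_zero (hne s hs))
  refine h2.congr' ?_
  filter_upwards [eventually_ne_atTop 0,
    (Complex.GammaSeq_tendsto_Gamma s).eventually_ne (Complex.Gamma_ne_zero (hne s hs))]
    with n hn h0
  simp only [Pi.div_apply]
  rw [(hasDerivAt_GammaSeq hs hn).deriv]
  field_simp

theorem norm_add_natCast_ge {z : ℂ} (hz : 1 ≤ z.re) (j : ℕ) {p : ℝ} (hp : 0 ≤ p) (hp1 : p ≤ 1) :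
    ((j : ℝ) + 1) ^ p * ‖z‖ ^ (1 - p) ≤ ‖z + j‖ := by
  have hj : (0 : ℝ) ≤ j := by positivity
  have h1 : (j : ℝ) + 1 ≤ ‖z + j‖ := by
    have := Complex.re_le_norm (z + j)
    simp at this
    linarith
  have h2 : ‖z‖ ≤ ‖z + j‖ := by
    rw [Complex.norm_eq_sqrt_sq_add_sq, Complex.norm_eq_sqrt_sq_add_sq]
    refine Real.sqrt_le_sqrt ?_
    simp
    nlinarith
  have h0 : 0 < ‖z + j‖ := by linarith
  calc ((j : ℝ) + 1) ^ p * ‖z‖ ^ (1 - p) ≤ ‖z + j‖ ^ p * ‖z + j‖ ^ (1 - p) := by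
        gcongr
    _ = ‖z + j‖ := by rw [← Real.rpow_add h0]; simp

theorem summable_natCast_add_one_rpow : Summable fun j : ℕ => ((j : ℝ) + 1) ^ (-(5 / 4) : ℝ) := by
  have := (summable_nat_add_iff 1).2 (Real.summable_nat_rpow.2 (by norm_num : (-(5 / 4) : ℝ) < -1))
  simpa using this

theorem norm_digamma_sub_le {p q : ℝ} (hp : 0 ≤ p) (hp1 : p ≤ 1) (hq : 0 ≤ q) (hq1 : q ≤ 1)
    (hpq : p + q = 5 / 4) {z w : ℂ} (hz : 1 ≤ z.re) (hw : 1 ≤ w.re) :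
    ‖Complex.digamma z - Complex.digamma w‖ ≤
      (∑' j : ℕ, ((j : ℝ) + 1) ^ (-(5 / 4) : ℝ)) *
        (‖z - w‖ / (‖z‖ ^ (1 - p) * ‖w‖ ^ (1 - q))) := by
  have hz0 : 0 < ‖z‖ := lt_of_lt_of_le (by linarith) (Complex.re_le_norm z)
  have hw0 : 0 < ‖w‖ := lt_of_lt_of_le (by linarith) (Complex.re_le_norm w)
  have hlim := (tendsto_digamma (s := z) (by linarith)).sub (tendsto_digamma (s := w) (by linarith))
  refine le_of_tendsto hlim.norm (.of_forall fun n => ?_)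
  rw [sub_sub_sub_cancel_left, ← Finset.sum_sub_distrib]
  refine (norm_sum_le _ _).trans ?_
  have hterm : ∀ j ∈ Finset.range (n + 1), ‖1 / (w + (j : ℂ)) - 1 / (z + j)‖ ≤
      ((j : ℝ) + 1) ^ (-(5 / 4) : ℝ) * (‖z - w‖ / (‖z‖ ^ (1 - p) * ‖w‖ ^ (1 - q))) := by
    intro j _
    have h1 := norm_add_natCast_ge hz j hp hp1
    have h2 := norm_add_natCast_ge hw j hq hq1
    have hz1 := add_natCast_ne_zero (s := z) (by linarith) j
    have hw1 := add_natCast_ne_zero (s := w) (by linarith) j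
    have e : 1 / (w + (j : ℂ)) - 1 / (z + j) = (z - w) / ((z + j) * (w + j)) := by
      field_simp; ring
    have e2 : ((j : ℝ) + 1) ^ (-(5 / 4) : ℝ) = 1 / (((j : ℝ) + 1) ^ p * ((j : ℝ) + 1) ^ q) := by
      rw [← Real.rpow_add (by positivity), hpq, Real.rpow_neg (by positivity), one_div]
    rw [e, e2, norm_div, norm_mul, div_mul_div_comm, one_mul]
    refine div_le_div_of_nonneg_left (norm_nonneg _) (by positivity) ?_
    calc _ = (((j : ℝ) + 1) ^ p * ‖z‖ ^ (1 - p)) * (((j : ℝ) + 1) ^ q * ‖w‖ ^ (1 - q)) := by ring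
      _ ≤ _ := by gcongr
  refine (Finset.sum_le_sum hterm).trans ?_
  rw [← Finset.sum_mul]
  gcongr
  exact summable_natCast_add_one_rpow.sum_le_tsum _ fun _ _ => by positivity

theorem exists_norm_digamma_le : ∃ C : ℝ, 0 < C ∧ ∀ z : ℂ, 1 ≤ z.re →
    ‖Complex.digamma z‖ ≤ C * ‖z‖ ^ (1 / 4 : ℝ) := by
  set D := ∑' j : ℕ, ((j : ℝ) + 1) ^ (-(5 / 4) : ℝ)
  have hD : 0 ≤ D := tsum_nonneg fun _ => by positivity
  refine ⟨2 * D + ‖Complex.digamma 1‖ + 1, by positivity, fun z hz => ?_⟩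
  have hz0 : 1 ≤ ‖z‖ := hz.trans (Complex.re_le_norm z)
  have h := norm_digamma_sub_le (p := 1 / 4) (q := 1) (by norm_num) (by norm_num) (by norm_num)
    (by norm_num) (by norm_num) hz (w := 1) (by simp)
  have h1 : ‖z - 1‖ ≤ 2 * ‖z‖ := by
    have := norm_sub_le z 1
    simp at this; linarith
  have h2 : ‖z - 1‖ / (‖z‖ ^ (1 - 1 / 4 : ℝ) * ‖(1 : ℂ)‖ ^ (1 - 1 : ℝ)) ≤ 2 * ‖z‖ ^ (1 / 4 : ℝ) := by
    rw [norm_one, Real.one_rpow, mul_one, div_le_iff₀ (by positivity), mul_assoc,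
      ← Real.rpow_add (by linarith)]
    norm_num
    exact h1
  have h3 : (1 : ℝ) ≤ ‖z‖ ^ (1 / 4 : ℝ) := Real.one_le_rpow hz0 (by norm_num)
  have h4 : ‖Complex.digamma z‖ ≤ ‖Complex.digamma z - Complex.digamma 1‖ + ‖Complex.digamma 1‖ := by
    have := norm_add_le (Complex.digamma z - Complex.digamma 1) (Complex.digamma 1)
    simpa using this
  have h5 : ‖Complex.digamma 1‖ ≤ ‖Complex.digamma 1‖ * ‖z‖ ^ (1 / 4 : ℝ) :=
    le_mul_of_one_le_right (norm_nonneg _) h3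
  have h6 := mul_le_mul_of_nonneg_left h2 hD
  nlinarith

theorem norm_Gamma_le {s : ℂ} (hs : 0 < s.re) : ‖Complex.Gamma s‖ ≤ Real.Gamma s.re :=
  le_of_tendsto (Complex.GammaSeq_tendsto_Gamma s).norm
    ((eventually_ne_atTop 0).mono fun _ hn => norm_GammaSeq_le hs hn)

theorem Real.Gamma_le_Gamma {x y : ℝ} (hx : 2 ≤ x) (hxy : x ≤ y) : Real.Gamma x ≤ Real.Gamma y :=
  Real.Gamma_strictMonoOn_Ici.monotoneOn hx (hx.trans hxy) hxy

theorem Real.Gamma_le_exp_rpow {x : ℝ} (hx : 2 ≤ x) :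
    Real.Gamma x ≤ Real.exp (4 * (2 * x) ^ (5 / 4 : ℝ)) := by
  set n := ⌈x⌉₊
  have h1 : x ≤ n + 1 := (Nat.le_ceil x).trans (by linarith)
  have h2 : (n : ℝ) ≤ 2 * x := by
    have := (Nat.ceil_lt_add_one (by linarith : 0 ≤ x)).le
    linarith
  have h0 : 0 < 2 * x := by linarith
  calc Real.Gamma x ≤ Real.Gamma (n + 1) := Real.Gamma_le_Gamma hx h1
    _ = n.factorial := Real.Gamma_nat_eq_factorial n
    _ ≤ (n : ℝ) ^ n := by exact_mod_cast Nat.factorial_le_pow n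
    _ ≤ (2 * x) ^ n := by gcongr
    _ = Real.exp (n * Real.log (2 * x)) := by
        rw [mul_comm (n : ℝ), Real.exp_mul, Real.exp_log h0, Real.rpow_natCast]
    _ ≤ Real.exp (4 * (2 * x) ^ (5 / 4 : ℝ)) := by
        refine Real.exp_le_exp.2 ?_
        have h3 := Real.log_le_rpow_div h0.le (by norm_num : (0 : ℝ) < 1 / 4)
        have h4 : 0 ≤ Real.log (2 * x) := Real.log_nonneg (by linarith)
        have h5 : (2 * x) ^ (5 / 4 : ℝ) = 2 * x * (2 * x) ^ (1 / 4 : ℝ) := by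
          conv_rhs => rw [← Real.rpow_one (2 * x), ← Real.rpow_mul h0.le, ← Real.rpow_add h0]
          norm_num
        rw [h5]
        have h6 : (n : ℝ) * Real.log (2 * x) ≤ 2 * x * ((2 * x) ^ (1 / 4 : ℝ) / (1 / 4)) := by gcongr
        linarith

/-- `f` is `O(exp (C * (1 + ‖z‖) ^ p))` on `D`. -/
def GrowthOn (p : ℝ) (D : Set ℂ) (f : ℂ → ℂ) : Prop :=
  ∃ C : ℝ, 0 < C ∧ ∀ z ∈ D, ‖f z‖ ≤ Real.exp (C * (1 + ‖z‖) ^ p)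

namespace GrowthOn

variable {p : ℝ} {D : Set ℂ} {f g : ℂ → ℂ}

theorem mul (hf : GrowthOn p D f) (hg : GrowthOn p D g) : GrowthOn p D fun z => f z * g z := by
  obtain ⟨C, hC, hf⟩ := hf
  obtain ⟨C', hC', hg⟩ := hg
  refine ⟨C + C', by positivity, fun z hz => ?_⟩
  rw [norm_mul, add_mul, Real.exp_add]
  exact mul_le_mul (hf z hz) (hg z hz) (norm_nonneg _) (Real.exp_pos _).le

theorem of_norm_le_exp {C : ℝ} (hC : 0 ≤ C) (h : ∀ z ∈ D, ‖f z‖ ≤ Real.exp (C * (1 + ‖z‖) ^ p)) :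
    GrowthOn p D f := by
  refine ⟨C + 1, by positivity, fun z hz => (h z hz).trans (Real.exp_le_exp.2 ?_)⟩
  have : 0 ≤ (1 + ‖z‖) ^ p := by positivity
  linarith

theorem one_le_base (hp : 0 ≤ p) (z : ℂ) : 1 ≤ (1 + ‖z‖) ^ p :=
  Real.one_le_rpow (by linarith [norm_nonneg z]) hp

theorem base_le (hp : 1 ≤ p) (z : ℂ) : 1 + ‖z‖ ≤ (1 + ‖z‖) ^ p :=
  Real.self_le_rpow_of_one_le (by linarith [norm_nonneg z]) hp

theorem of_norm_le {C : ℝ} (hp : 0 ≤ p) (h : ∀ z ∈ D, ‖f z‖ ≤ C) : GrowthOn p D f := by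
  refine of_norm_le_exp (abs_nonneg C) fun z hz => (h z hz).trans ?_
  have h1 := Real.add_one_le_exp (|C| * (1 + ‖z‖) ^ p)
  have h2 := le_mul_of_one_le_right (abs_nonneg C) (one_le_base hp z)
  linarith [le_abs_self C]

theorem of_norm_le_affine {C : ℝ} (hp : 1 ≤ p) (h : ∀ z ∈ D, ‖f z‖ ≤ C * (1 + ‖z‖)) :
    GrowthOn p D f := by
  refine of_norm_le_exp (abs_nonneg C) fun z hz => (h z hz).trans ?_
  have h1 := Real.add_one_le_exp (|C| * (1 + ‖z‖) ^ p)
  have h2 := mul_le_mul_of_nonneg_left (base_le hp z) (abs_nonneg C)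
  have h3 := mul_le_mul_of_nonneg_right (le_abs_self C) (by positivity : 0 ≤ 1 + ‖z‖)
  linarith

theorem pow (hp : 0 ≤ p) (hf : GrowthOn p D f) (n : ℕ) : GrowthOn p D fun z => f z ^ n := by
  induction n with
  | zero => exact of_norm_le (C := 1) hp (by simp)
  | succ n ih => simpa only [pow_succ] using ih.mul hf

theorem prod {ι : Type*} (s : Finset ι) {f : ι → ℂ → ℂ} (hp : 0 ≤ p)
    (hf : ∀ i ∈ s, GrowthOn p D (f i)) : GrowthOn p D fun z => ∏ i ∈ s, f i z := by
  classical
  induction s using Finset.induction_on with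
  | empty => exact of_norm_le (C := 1) hp (by simp)
  | insert a s ha ih =>
    simp only [Finset.prod_insert ha]
    exact (hf a (Finset.mem_insert_self _ _)).mul
      (ih fun i hi => hf i (Finset.mem_insert_of_mem hi))

theorem congr (hf : GrowthOn p D f) (h : ∀ z ∈ D, g z = f z) : GrowthOn p D g := by
  obtain ⟨C, hC, hf⟩ := hf
  exact ⟨C, hC, fun z hz => by rw [h z hz]; exact hf z hz⟩

theorem union {D' : Set ℂ} (hf : GrowthOn p D f) (hf' : GrowthOn p D' f) :
    GrowthOn p (D ∪ D') f := by
  obtain ⟨C, hC, hf⟩ := hf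
  obtain ⟨C', hC', hf'⟩ := hf'
  refine ⟨C + C', by positivity, fun z hz => ?_⟩
  have h0 : 0 ≤ (1 + ‖z‖) ^ p := by positivity
  rcases hz with hz | hz
  · exact (hf z hz).trans (Real.exp_le_exp.2 (by nlinarith))
  · exact (hf' z hz).trans (Real.exp_le_exp.2 (by nlinarith))

theorem mono {D' : Set ℂ} (hf : GrowthOn p D f) (h : D' ⊆ D) : GrowthOn p D' f := by
  obtain ⟨C, hC, hf⟩ := hf
  exact ⟨C, hC, fun z hz => hf z (h hz)⟩

theorem of_norm_le_pow {C : ℝ} {w : ℂ} {k : ℕ} (hp : 1 ≤ p)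
    (h : ∀ z ∈ D, ‖f z‖ ≤ C * ‖z - w‖ ^ k) : GrowthOn p D f := by
  have h1 : GrowthOn p D fun z => ‖z - w‖ := of_norm_le_affine (C := 1 + ‖w‖) hp fun z _ => by
    rw [Complex.norm_real, norm_norm]
    have := norm_sub_le z w
    nlinarith [norm_nonneg z, norm_nonneg w]
  have h2 : GrowthOn p D fun _ => (C : ℂ) := of_norm_le (C := |C|) (by linarith) fun z _ => by simp
  obtain ⟨C', hC', h3⟩ := h2.mul (h1.pow (by linarith) k)
  refine ⟨C', hC', fun z hz => (h z hz).trans (le_trans ?_ (h3 z hz))⟩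
  simp only [norm_mul, norm_pow, Complex.norm_real, Real.norm_eq_abs, abs_norm]
  gcongr
  exact le_abs_self C

theorem comp {φ : ℂ → ℂ} {D' : Set ℂ} {L : ℝ} (hp : 0 ≤ p) (hf : GrowthOn p D f)
    (hφ : ∀ z ∈ D', φ z ∈ D) (hL : ∀ z ∈ D', 1 + ‖φ z‖ ≤ L * (1 + ‖z‖)) :
    GrowthOn p D' fun z => f (φ z) := by
  obtain ⟨C, hC, hf⟩ := hf
  refine of_norm_le_exp (C := C * |L| ^ p) (by positivity) fun z hz =>
    (hf _ (hφ z hz)).trans (Real.exp_le_exp.2 ?_)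
  rw [mul_assoc, ← Real.mul_rpow (abs_nonneg _) (by positivity)]
  have h1 := hL z hz
  have h2 : 1 + ‖φ z‖ ≤ |L| * (1 + ‖z‖) :=
    h1.trans (mul_le_mul_of_nonneg_right (le_abs_self L) (by positivity))
  gcongr

theorem growthBound (hf : GrowthOn (5 / 4) Set.univ f) (c : ℂ) : GrowthBound f c := by
  obtain ⟨C, hC, hf⟩ := hf
  refine ⟨C * (2 + ‖c‖) ^ (5 / 4 : ℝ), by positivity, fun R hR z hz =>
    (hf z trivial).trans (Real.exp_le_exp.2 ?_)⟩
  rw [mul_assoc, ← Real.mul_rpow (by positivity) (by linarith)]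
  have h1 : 1 + ‖z‖ ≤ (2 + ‖c‖) * R := by
    have := norm_add_le (z - c) c
    rw [sub_add_cancel] at this
    nlinarith [norm_nonneg c]
  gcongr

end GrowthOn

theorem growthOn_Gamma : GrowthOn (5 / 4) {z | 2 ≤ z.re} Complex.Gamma := by
  refine GrowthOn.of_norm_le_exp (C := 4 * 2 ^ (5 / 4 : ℝ)) (by positivity) fun z hz => ?_
  have hz : 2 ≤ z.re := hz
  refine (norm_Gamma_le (by linarith)).trans ((Real.Gamma_le_exp_rpow hz).trans ?_)
  refine Real.exp_le_exp.2 ?_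
  rw [mul_assoc, ← Real.mul_rpow (by positivity) (by positivity)]
  have := Complex.re_le_norm z
  have h2 : 2 * z.re ≤ 2 * (1 + ‖z‖) := by linarith
  have h3 : 0 ≤ 2 * z.re := by linarith
  gcongr

/-- The Gamma function is bounded on vertical strips away from the real axis. -/
theorem exists_norm_Gamma_le_of_one_le_abs_im (a b : ℝ) :
    ∃ C : ℝ, ∀ z : ℂ, a ≤ z.re → z.re ≤ b → 1 ≤ |z.im| → ‖Complex.Gamma z‖ ≤ C := by
  obtain ⟨K, hK⟩ := exists_nat_ge (2 - a)
  refine ⟨Real.Gamma (b + K), fun z ha hb hi => ?_⟩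
  have key : ∀ n : ℕ, ‖Complex.Gamma z‖ ≤ ‖Complex.Gamma (z + n)‖ := by
    intro n
    induction n with
    | zero => simp
    | succ n ih =>
      have h1 : 1 ≤ ‖z + n‖ := by
        have := Complex.abs_im_le_norm (z + n)
        simp at this
        linarith
      have h2 : z + n ≠ 0 := by
        intro h; rw [h, norm_zero] at h1; linarith
      push_cast
      rw [← add_assoc, Complex.Gamma_add_one _ h2, norm_mul]
      exact ih.trans (le_mul_of_one_le_left (norm_nonneg _) h1)
  have hre : (z + K).re = z.re + K := by simp
  refine (key K).trans ((norm_Gamma_le (by rw [hre]; linarith)).trans ?_)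
  rw [hre]
  exact Real.Gamma_le_Gamma (by linarith) (by linarith)

/-- Polynomial bounds propagate from the edges of a vertical strip to its interior. -/
theorem norm_le_mul_pow_of_vertical_strip {f : ℂ → ℂ} (hf : Differentiable ℂ f) {a b c K p T : ℝ}
    {k : ℕ} (hab : a < b) (hc : c + 1 ≤ a) (hp : 0 ≤ p)
    (hfa : ∀ z : ℂ, z.re = a → ‖f z‖ ≤ K * ‖z - c‖ ^ k)
    (hfb : ∀ z : ℂ, z.re = b → ‖f z‖ ≤ K * ‖z - c‖ ^ k)
    (hg : GrowthOn p {z | a ≤ z.re ∧ z.re ≤ b ∧ T ≤ |z.im|} f) {z : ℂ} (hza : a ≤ z.re)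
    (hzb : z.re ≤ b) : ‖f z‖ ≤ K * ‖z - c‖ ^ k := by
  have hone : ∀ z : ℂ, a ≤ z.re → 1 ≤ ‖z - c‖ := by
    intro z hz
    have := Complex.re_le_norm (z - c)
    simp at this
    linarith
  have hpow : ∀ z : ℂ, a ≤ z.re → (0 : ℝ) < ‖z - c‖ ^ k := fun z hz =>
    pow_pos (by linarith [hone z hz]) _
  have hne : ∀ z : ℂ, a ≤ z.re → (z - c) ^ k ≠ 0 := fun z hz h => by
    have := hpow z hz
    rw [← norm_pow, h, norm_zero] at this
    exact lt_irrefl _ this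
  have key : ‖f z / (z - c) ^ k‖ ≤ K := by
    refine PhragmenLindelof.vertical_strip (a := a) (b := b) (f := fun z => f z / (z - c) ^ k)
      ?_ ?_ (fun z hz => ?_) (fun z hz => ?_) hza hzb
    · refine DifferentiableOn.diffContOnCl fun z hz => ?_
      have hz' : a ≤ z.re := by
        have h1 : closure (re ⁻¹' Set.Ioo a b) ⊆ {z : ℂ | a ≤ z.re} := by
          refine closure_minimal (fun w hw => hw.1.le) ?_
          exact isClosed_le continuous_const Complex.continuous_re
        exact h1 hz
      exact (hf.differentiableAt.div ((differentiableAt_id.sub_const (c : ℂ)).pow k) (hne z hz')).differentiableWithinAt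
    · refine ⟨Real.pi / (b - a) / 2, half_lt_self (by have := Real.pi_pos; have : 0 < b - a := by linarith
                                                      positivity), ?_⟩
      set q := Real.pi / (b - a) / 2
      have hq : 0 < q := by
        have := Real.pi_pos
        have : 0 < b - a := by linarith
        positivity
      obtain ⟨C, hC, hg⟩ := hg
      refine ⟨C * 2 ^ p, ?_⟩
      refine Asymptotics.IsBigO.of_bound 1 ?_
      have h1 : ∀ᶠ t : ℝ in atTop, t ^ p ≤ Real.exp (q * t) := by
        have := (isLittleO_rpow_exp_pos_mul_atTop p hq).bound zero_lt_one
        filter_upwards [this, eventually_ge_atTop 0] with t ht h0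
        rw [Real.norm_of_nonneg (by positivity), Real.norm_of_nonneg (by positivity), one_mul] at ht
        exact ht
      have h2 : ∀ᶠ t : ℝ in atTop, t ^ p ≤ Real.exp (q * t) ∧ T ≤ t ∧ 1 + |a| + |b| ≤ t :=
        h1.and ((eventually_ge_atTop _).and (eventually_ge_atTop _))
      rw [Filter.eventually_inf_principal]
      refine (h2.comap (_root_.abs ∘ im)).mono fun w hw hws => ?_
      simp only [Function.comp] at hw
      have hwa : a ≤ w.re := hws.1.le
      rw [one_mul, Real.norm_of_nonneg (Real.exp_pos _).le, norm_div, norm_pow]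
      refine (div_le_self (norm_nonneg _) (one_le_pow₀ (hone w hwa))).trans ?_
      refine (hg w ⟨hwa, hws.2.le, hw.2.1⟩).trans (Real.exp_le_exp.2 ?_)
      rw [mul_assoc]
      refine mul_le_mul_of_nonneg_left ?_ hC.le
      have h3 : 1 + ‖w‖ ≤ 2 * |w.im| := by
        have h4 := Complex.norm_le_abs_re_add_abs_im w
        have h5 : |w.re| ≤ |a| + |b| := by
          rw [abs_le]
          have := hws.1
          have := hws.2
          constructor <;> linarith [neg_abs_le a, le_abs_self b, abs_nonneg a, abs_nonneg b]
        linarith [hw.2.2]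
      calc (1 + ‖w‖) ^ p ≤ (2 * |w.im|) ^ p := by gcongr
        _ = 2 ^ p * |w.im| ^ p := Real.mul_rpow (by norm_num) (abs_nonneg _)
        _ ≤ _ := by gcongr; exact hw.1
    · rw [norm_div, norm_pow, div_le_iff₀ (hpow z hz.ge)]
      exact hfa z hz
    · rw [norm_div, norm_pow, div_le_iff₀ (hpow z (by linarith))]
      exact hfb z hz
  rwa [norm_div, norm_pow, div_le_iff₀ (hpow z hza)] at key

namespace SSF

variable {σ0 σ1 : ℝ} (S : SSF σ0 σ1)

/-- `A` is an abscissa far to the right of all the data of `S`. -/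
structure IsFar (A : ℝ) : Prop where
  hσ0 : σ0 + 1 ≤ A
  two_le : 2 ≤ A
  hσ1 : 2 * σ1 + 1 ≤ A
  pole : ∀ i, 2 * (‖S.pole i‖ + σ1) + 2 ≤ A
  gamma : ∀ j, 2 + 2 * ‖S.mu j‖ ≤ S.lam j * A

theorem exists_isFar (x : ℝ) : ∃ A, x ≤ A ∧ S.IsFar A := by
  have h1 := S.hσ1pos
  have h2 := S.hσ
  have hp : ∀ i, 2 * ‖S.pole i‖ ≤ ∑ i, 2 * ‖S.pole i‖ := fun i =>
    Finset.single_le_sum (f := fun i => 2 * ‖S.pole i‖) (fun _ _ => by positivity)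
      (Finset.mem_univ i)
  have hg : ∀ j, (2 + 2 * ‖S.mu j‖) / S.lam j ≤ ∑ j, (2 + 2 * ‖S.mu j‖) / S.lam j := fun j =>
    Finset.single_le_sum (f := fun j => (2 + 2 * ‖S.mu j‖) / S.lam j)
      (fun j _ => by have := S.hlam j; positivity) (Finset.mem_univ j)
  have hp0 : 0 ≤ ∑ i, 2 * ‖S.pole i‖ := Finset.sum_nonneg fun _ _ => by positivity
  have hg0 : 0 ≤ ∑ j, (2 + 2 * ‖S.mu j‖) / S.lam j :=
    Finset.sum_nonneg fun j _ => by have := S.hlam j; positivity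
  have hx := abs_nonneg x
  have hx' := le_abs_self x
  refine ⟨|x| + 2 + σ0 + 2 * σ1 + (∑ i, 2 * ‖S.pole i‖) + ∑ j, (2 + 2 * ‖S.mu j‖) / S.lam j,
    by linarith, by linarith, by linarith, by linarith, fun i => by linarith [hp i], fun j => ?_⟩
  have := S.hlam j
  rw [mul_comm (S.lam j), ← div_le_iff₀ this]
  linarith [hg j]

variable {S} {A : ℝ}

namespace IsFar

variable (hA : S.IsFar A) {s : ℂ}
include hA

theorem two_le_re (hs : A ≤ s.re) (j : Fin S.r) : 2 ≤ ((S.lam j : ℂ) * s + S.mu j).re := by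
  have h1 := hA.gamma j
  have h2 := mul_le_mul_of_nonneg_left hs (S.hlam j).le
  have h3 := (abs_le.1 (Complex.abs_re_le_norm (S.mu j))).1
  simp
  linarith [norm_nonneg (S.mu j)]

omit hA in
theorem le_norm (hs : A ≤ s.re) : A ≤ ‖s‖ := hs.trans (Complex.re_le_norm s)

theorem norm_pos (hs : A ≤ s.re) : 0 < ‖s‖ := by linarith [IsFar.le_norm hs, hA.two_le]

theorem le_norm_sub_pole (hs : A ≤ s.re) (i : Fin S.N) : ‖s‖ / 2 ≤ ‖s - S.pole i‖ := by
  have h1 := hA.pole i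
  have h2 := IsFar.le_norm hs
  have h3 := norm_sub_norm_le s (S.pole i)
  linarith [S.hσ1pos]

theorem le_norm_sub_conj_pole (hs : A ≤ s.re) (i : Fin S.N) :
    ‖s‖ / 2 ≤ ‖(σ1 : ℂ) - s - (starRingEnd ℂ) (S.pole i)‖ := by
  have h1 := hA.pole i
  have h2 := IsFar.le_norm hs
  have h3 := norm_sub_norm_le s ((σ1 : ℂ) - (starRingEnd ℂ) (S.pole i))
  have h4 := norm_sub_le (σ1 : ℂ) ((starRingEnd ℂ) (S.pole i))
  rw [RCLike.norm_conj, Complex.norm_of_nonneg S.hσ1pos.le] at h4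
  have e : (σ1 : ℂ) - s - (starRingEnd ℂ) (S.pole i) =
    -(s - ((σ1 : ℂ) - (starRingEnd ℂ) (S.pole i))) := by ring
  rw [e, norm_neg]
  linarith [S.hσ1pos]

theorem sub_pole_ne_zero (hs : A ≤ s.re) (i : Fin S.N) : s - S.pole i ≠ 0 := by
  rw [← norm_pos_iff]
  linarith [hA.le_norm_sub_pole hs i, hA.norm_pos hs]

theorem sub_conj_pole_ne_zero (hs : A ≤ s.re) (i : Fin S.N) :
    (σ1 : ℂ) - s - (starRingEnd ℂ) (S.pole i) ≠ 0 := by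
  rw [← norm_pos_iff]
  linarith [hA.le_norm_sub_conj_pole hs i, hA.norm_pos hs]

theorem xi_eq (hs : A ≤ s.re) :
    S.xi s = S.F s * (S.Q : ℂ) ^ s * (∏ j, Complex.Gamma ((S.lam j : ℂ) * s + S.mu j)) *
      (∏ i, (s - S.pole i) ^ S.m i) * ∏ i : Fin S.N, (if 2 * S.M + S.dlt ≤ (i : ℕ) then
        ((σ1 : ℂ) - s - (starRingEnd ℂ) (S.pole i)) ^ S.m i else 1) := by
  refine S.hxiEq s (fun i => sub_ne_zero.1 (hA.sub_pole_ne_zero hs i)) fun j k h => ?_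
  have h1 := hA.two_le_re hs j
  rw [h] at h1
  simp at h1
  have : (0 : ℝ) ≤ k := by positivity
  linarith

theorem analyticAt_F (hs : A ≤ s.re) : AnalyticAt ℂ S.F s := by
  have hP : (∏ i, (s - S.pole i) ^ S.m i) ≠ 0 :=
    Finset.prod_ne_zero_iff.2 fun i _ => pow_ne_zero _ (hA.sub_pole_ne_zero hs i)
  have h1 : AnalyticAt ℂ (fun s => ∏ i, (s - S.pole i) ^ S.m i) s := by
    have : Differentiable ℂ fun s => ∏ i, (s - S.pole i) ^ S.m i := by fun_prop
    exact this.analyticAt s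
  refine ((S.hGdiff.analyticAt s).div h1 hP).congr ?_
  filter_upwards [h1.continuousAt.eventually_ne hP] with z hz
  have hz' := Finset.prod_ne_zero_iff.1 hz
  have hne : ∀ i, z ≠ S.pole i := by
    intro i hi
    refine hz' i (Finset.mem_univ i) ?_
    rw [hi, sub_self, zero_pow (S.hm i).ne']
  simp only [Pi.div_apply]
  rw [S.hGF z hne, mul_div_cancel_left₀ _ hz]

end IsFar

theorem norm_natCast_cpow_neg (n : ℕ) (hn : 0 < n) (s : ℂ) :
    ‖(n : ℂ) ^ (-s)‖ = (n : ℝ) ^ (-s.re) := by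
  rw [Complex.norm_natCast_cpow_of_pos hn]; simp

theorem exists_norm_F_le (S : SSF σ0 σ1) : ∃ K : ℝ, ∀ s : ℂ, σ0 + 1 ≤ s.re → ‖S.F s‖ ≤ K := by
  have h0 := S.hDirAbs ((σ0 + 1 : ℝ) : ℂ) (by simp)
  refine ⟨∑' n : ℕ, ‖S.a (n + 1) * ((n + 1 : ℕ) : ℂ) ^ (-((σ0 + 1 : ℝ) : ℂ))‖, fun s hs => ?_⟩
  refine (S.hDir s (by linarith)).tsum_eq ▸ tsum_of_norm_bounded h0.hasSum fun n => ?_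
  rw [norm_mul, norm_mul]
  rw [norm_natCast_cpow_neg _ n.succ_pos, norm_natCast_cpow_neg _ n.succ_pos, ofReal_re]
  refine mul_le_mul_of_nonneg_left ?_ (norm_nonneg _)
  refine Real.rpow_le_rpow_of_exponent_le ?_ (by linarith)
  push_cast
  linarith [(Nat.cast_nonneg n : (0 : ℝ) ≤ n)]

theorem exists_norm_logDeriv_F_le (S : SSF σ0 σ1) : ∃ K : ℝ, 0 < K ∧ ∀ s : ℂ, σ0 + 1 ≤ s.re →
    ‖logDeriv S.F s‖ ≤ K * (2 : ℝ) ^ (-s.re) := by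
  have h0 := S.hEulerAbs ((σ0 + 1 : ℝ) : ℂ) (by simp)
  set B := ∑' n : ℕ, ‖S.c (n + 2) * ((n + 2 : ℕ) : ℂ) ^ (-((σ0 + 1 : ℝ) : ℂ))‖
  have hB : 0 ≤ B := tsum_nonneg fun _ => norm_nonneg _
  refine ⟨B * 2 ^ (σ0 + 1) + 1, by positivity, fun s hs => ?_⟩
  have h1 := S.hEuler s (by linarith)
  have h2 : ‖logDeriv S.F s‖ ≤ B * 2 ^ (σ0 + 1 - s.re) := by
    rw [← norm_neg, logDeriv_apply]
    refine h1.tsum_eq ▸ tsum_of_norm_bounded (h0.hasSum.mul_right _) fun n => ?_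
    rw [norm_mul, norm_mul]
    rw [norm_natCast_cpow_neg _ (by omega), norm_natCast_cpow_neg _ (by omega), ofReal_re, mul_assoc]
    refine mul_le_mul_of_nonneg_left ?_ (norm_nonneg _)
    have hn2 : (2 : ℝ) ≤ ((n + 2 : ℕ) : ℝ) := by
      push_cast
      linarith [(Nat.cast_nonneg n : (0 : ℝ) ≤ n)]
    calc ((n + 2 : ℕ) : ℝ) ^ (-s.re)
        = ((n + 2 : ℕ) : ℝ) ^ (-(σ0 + 1)) * ((n + 2 : ℕ) : ℝ) ^ (σ0 + 1 - s.re) := by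
          rw [← Real.rpow_add (by linarith)]; ring_nf
      _ ≤ _ := by
          refine mul_le_mul_of_nonneg_left ?_ (by positivity)
          exact Real.rpow_le_rpow_of_nonpos (by norm_num) hn2 (by linarith)
  refine h2.trans ?_
  have h3 : (0 : ℝ) < 2 ^ (-s.re) := by positivity
  rw [sub_eq_add_neg, Real.rpow_add (by norm_num)]
  nlinarith

namespace IsFar

variable (hA : S.IsFar A) {s : ℂ}
include hA

theorem F_ne_zero {c : ℂ} (hc : S.xi c ≠ 0) (hs : A < s.re) : S.F s ≠ 0 := by
  intro h0
  have han := hA.analyticAt_F hs.le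
  have hnhd : ∀ᶠ z in nhds s, A < z.re :=
    (isOpen_lt continuous_const Complex.continuous_re).mem_nhds hs
  have htop : analyticOrderAt S.F s ≠ ⊤ := by
    intro h
    refine analyticOrderAt_ne_top_of_apply_ne_zero S.hxiDiff hc s (analyticOrderAt_eq_top.2 ?_)
    filter_upwards [analyticOrderAt_eq_top.1 h, hnhd] with z hz hz'
    rw [hA.xi_eq hz'.le, hz]
    simp
  have hord : analyticOrderAt S.F s ≠ 0 := fun h => (han.analyticOrderAt_eq_zero.1 h) h0
  obtain ⟨K, hK, hb⟩ := S.exists_norm_logDeriv_F_le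
  have hm := han.meromorphicAt
  have hme := han.meromorphicOrderAt_eq
  have hlog : meromorphicOrderAt (logDeriv S.F) s = -1 := by
    refine meromorphicOrderAt_logDeriv_eq_neg_one hm ?_ ?_ <;> rw [hme]
    · lift analyticOrderAt S.F s to ℕ using htop with n
      simpa using hord
    · lift analyticOrderAt S.F s to ℕ using htop with n
      simp
  have hcob := tendsto_norm_cobounded_atTop.comp
    (tendsto_cobounded_of_meromorphicOrderAt_neg (f := logDeriv S.F) (x := s)
      (by
        rw [hlog]
        change ((-1 : ℤ) : WithTop ℤ) < ((0 : ℤ) : WithTop ℤ)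
        exact WithTop.coe_lt_coe.2 (by norm_num)))
  have h1 : ∀ᶠ z in nhdsWithin s {s}ᶜ, K + 1 ≤ ‖logDeriv S.F z‖ := hcob.eventually_ge_atTop _
  obtain ⟨z, hz1, hz2⟩ := (h1.and (hnhd.filter_mono nhdsWithin_le_nhds)).exists
  have h2 := hb z (by linarith [hA.hσ0])
  have h3 : (2 : ℝ) ^ (-z.re) ≤ 1 :=
    Real.rpow_le_one_of_one_le_of_nonpos (by norm_num) (by linarith [hA.two_le])
  nlinarith

theorem Gamma_ne_zero (hs : A ≤ s.re) (j : Fin S.r) :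
    Complex.Gamma ((S.lam j : ℂ) * s + S.mu j) ≠ 0 :=
  Complex.Gamma_ne_zero_of_re_pos (by linarith [hA.two_le_re hs j])

theorem xi_ne_zero {c : ℂ} (hc : S.xi c ≠ 0) (hs : A < s.re) : S.xi s ≠ 0 := by
  rw [hA.xi_eq hs.le]
  refine mul_ne_zero (mul_ne_zero (mul_ne_zero (mul_ne_zero (hA.F_ne_zero hc hs) ?_) ?_) ?_) ?_
  · rw [Complex.cpow_def_of_ne_zero (by exact_mod_cast S.hQ.ne')]
    exact Complex.exp_ne_zero _
  · exact Finset.prod_ne_zero_iff.2 fun j _ => hA.Gamma_ne_zero hs.le j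
  · exact Finset.prod_ne_zero_iff.2 fun i _ => pow_ne_zero _ (hA.sub_pole_ne_zero hs.le i)
  · refine Finset.prod_ne_zero_iff.2 fun i _ => ?_
    split_ifs
    · exact pow_ne_zero _ (hA.sub_conj_pole_ne_zero hs.le i)
    · exact one_ne_zero

theorem re_mem_of_xi_eq_zero {c : ℂ} (hc : S.xi c ≠ 0) (hs : S.xi s = 0) :
    σ1 - A ≤ s.re ∧ s.re ≤ A := by
  constructor
  · by_contra! h
    have h1 := S.hFE s
    rw [hs] at h1
    have h2 := hA.xi_ne_zero (s := (σ1 : ℂ) - (starRingEnd ℂ) s) hc (by simp; linarith)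
    have h3 : S.ω ≠ 0 := by
      intro h; have := S.hω; rw [h, norm_zero] at this; norm_num at this
    refine (mul_ne_zero h3 ?_) h1.symm
    simpa using h2
  · by_contra! h
    exact hA.xi_ne_zero hc h hs

end IsFar

/-- Contribution of the polynomial factors to the logarithmic derivative of `ξ`. -/
def polePart (S : SSF σ0 σ1) (s : ℂ) : ℂ :=
  ∑ i, (S.m i : ℂ) / (s - S.pole i) + ∑ i : Fin S.N, (if 2 * S.M + S.dlt ≤ (i : ℕ) then
    -(S.m i : ℂ) / ((σ1 : ℂ) - s - (starRingEnd ℂ) (S.pole i)) else 0)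

namespace IsFar

variable (hA : S.IsFar A) {s : ℂ}
include hA

theorem norm_polePart_le (hs : A ≤ s.re) :
    ‖S.polePart s‖ ≤ (4 * ∑ i, (S.m i : ℝ)) * ‖s‖⁻¹ := by
  have h0 := hA.norm_pos hs
  have hb : ∀ i (w : ℂ), ‖s‖ / 2 ≤ ‖w‖ → ‖(S.m i : ℂ) / w‖ ≤ 2 * S.m i * ‖s‖⁻¹ := by
    intro i w hw
    rw [norm_div, Complex.norm_natCast]
    calc (S.m i : ℝ) / ‖w‖ ≤ S.m i / (‖s‖ / 2) := by gcongr
      _ = _ := by field_simp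
  have h1 : ‖∑ i, (S.m i : ℂ) / (s - S.pole i)‖ ≤ ∑ i, 2 * (S.m i : ℝ) * ‖s‖⁻¹ :=
    norm_sum_le_of_le _ fun i _ => hb i _ (hA.le_norm_sub_pole hs i)
  have h2 : ‖∑ i : Fin S.N, (if 2 * S.M + S.dlt ≤ (i : ℕ) then
      -(S.m i : ℂ) / ((σ1 : ℂ) - s - (starRingEnd ℂ) (S.pole i)) else 0)‖ ≤
      ∑ i, 2 * (S.m i : ℝ) * ‖s‖⁻¹ := by
    refine norm_sum_le_of_le _ fun i _ => ?_
    split_ifs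
    · rw [neg_div, norm_neg]
      exact hb i _ (hA.le_norm_sub_conj_pole hs i)
    · rw [norm_zero]; positivity
  refine (norm_add_le _ _).trans ((add_le_add h1 h2).trans (le_of_eq ?_))
  rw [← Finset.sum_mul, ← Finset.mul_sum]
  ring

theorem logDeriv_xi {c : ℂ} (hc : S.xi c ≠ 0) (hs : A < s.re) :
    logDeriv S.xi s = logDeriv S.F s + Real.log S.Q +
      ∑ j, (S.lam j : ℂ) * Complex.digamma ((S.lam j : ℂ) * s + S.mu j) + S.polePart s := by
  have hnhd : ∀ᶠ z in nhds s, A < z.re :=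
    (isOpen_lt continuous_const Complex.continuous_re).mem_nhds hs
  have hQ0 : (S.Q : ℂ) ≠ 0 := by exact_mod_cast S.hQ.ne'
  set fQ : ℂ → ℂ := fun s => (S.Q : ℂ) ^ s
  set fG : ℂ → ℂ := fun s => ∏ j, Complex.Gamma ((S.lam j : ℂ) * s + S.mu j) with hfG
  set fP : ℂ → ℂ := fun s => ∏ i, (s - S.pole i) ^ S.m i with hfP
  set fR : ℂ → ℂ := fun s => ∏ i : Fin S.N, (if 2 * S.M + S.dlt ≤ (i : ℕ) then
        ((σ1 : ℂ) - s - (starRingEnd ℂ) (S.pole i)) ^ S.m i else 1) with hfR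
  have hFd : DifferentiableAt ℂ S.F s := (hA.analyticAt_F hs.le).differentiableAt
  have hQd : HasDerivAt fQ (fQ s * Complex.log S.Q) s := by
    simpa using (hasDerivAt_id s).const_cpow (c := (S.Q : ℂ)) (Or.inl hQ0)
  have hQd' : DifferentiableAt ℂ fQ s := hQd.differentiableAt
  have hF0 := hA.F_ne_zero hc hs
  have hQs : fQ s ≠ 0 := by
    simp only [fQ]
    rw [Complex.cpow_def_of_ne_zero hQ0]
    exact Complex.exp_ne_zero _
  have hΓd : ∀ j, DifferentiableAt ℂ Complex.Gamma ((S.lam j : ℂ) * s + S.mu j) := fun j =>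
    Complex.differentiableAt_Gamma _ fun m h => by
      have := hA.two_le_re hs.le j
      rw [h] at this
      simp at this
      linarith [(Nat.cast_nonneg m : (0 : ℝ) ≤ m)]
  have hΓd' : ∀ j, DifferentiableAt ℂ
      (fun s => Complex.Gamma ((S.lam j : ℂ) * s + S.mu j)) s := fun j =>
    (hΓd j).comp s (by fun_prop)
  have hG0 : fG s ≠ 0 := Finset.prod_ne_zero_iff.2 fun j _ => hA.Gamma_ne_zero hs.le j
  have hP0i : ∀ i, (s - S.pole i) ^ S.m i ≠ 0 := fun i =>
    pow_ne_zero _ (hA.sub_pole_ne_zero hs.le i)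
  have hP0 : fP s ≠ 0 := Finset.prod_ne_zero_iff.2 fun i _ => hP0i i
  have hR0i : ∀ i : Fin S.N, (if 2 * S.M + S.dlt ≤ (i : ℕ) then
        ((σ1 : ℂ) - s - (starRingEnd ℂ) (S.pole i)) ^ S.m i else 1) ≠ 0 := by
    intro i
    split_ifs
    · exact pow_ne_zero _ (hA.sub_conj_pole_ne_zero hs.le i)
    · exact one_ne_zero
  have hR0 : fR s ≠ 0 := Finset.prod_ne_zero_iff.2 fun i _ => hR0i i
  have hGd : DifferentiableAt ℂ fG s := by
    rw [hfG]; exact DifferentiableAt.fun_finsetProd fun j _ => hΓd' j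
  have hPd : DifferentiableAt ℂ fP s := by
    rw [hfP]; fun_prop
  have hRdi : ∀ i : Fin S.N, DifferentiableAt ℂ (fun s => (if 2 * S.M + S.dlt ≤ (i : ℕ) then
        ((σ1 : ℂ) - s - (starRingEnd ℂ) (S.pole i)) ^ S.m i else 1)) s := by
    intro i
    split_ifs <;> fun_prop
  have hRd : DifferentiableAt ℂ fR s := by
    rw [hfR]; exact DifferentiableAt.fun_finsetProd fun j _ => hRdi j
  have heq : S.xi =ᶠ[nhds s] fun z => S.F z * fQ z * fG z * fP z * fR z := by
    filter_upwards [hnhd] with z hz using hA.xi_eq hz.le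
  have h1 : logDeriv S.xi s = logDeriv (fun z => S.F z * fQ z * fG z * fP z * fR z) s := by
    rw [logDeriv_apply, logDeriv_apply, heq.deriv_eq, heq.eq_of_nhds]
  have hd2 : DifferentiableAt ℂ (fun z => S.F z * fQ z) s := hFd.mul hQd'
  have hd3 : DifferentiableAt ℂ (fun z => S.F z * fQ z * fG z) s := hd2.mul hGd
  have hd4 : DifferentiableAt ℂ (fun z => S.F z * fQ z * fG z * fP z) s := hd3.mul hPd
  have hn2 : S.F s * fQ s ≠ 0 := mul_ne_zero hF0 hQs
  have hn3 : S.F s * fQ s * fG s ≠ 0 := mul_ne_zero hn2 hG0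
  have hn4 : S.F s * fQ s * fG s * fP s ≠ 0 := mul_ne_zero hn3 hP0
  rw [h1, logDeriv_mul s hn4 hR0 hd4 hRd, logDeriv_mul s hn3 hP0 hd3 hPd,
    logDeriv_mul s hn2 hG0 hd2 hGd, logDeriv_mul s hF0 hQs hFd hQd']
  have e1 : logDeriv fQ s = Real.log S.Q := by
    rw [logDeriv_apply, hQd.deriv, mul_div_cancel_left₀ _ hQs, Complex.ofReal_log S.hQ.le]
  have e2 : logDeriv fG s =
      ∑ j, (S.lam j : ℂ) * Complex.digamma ((S.lam j : ℂ) * s + S.mu j) := by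
    rw [hfG, logDeriv_prod (fun j _ => hA.Gamma_ne_zero hs.le j) (fun j _ => hΓd' j)]
    refine Finset.sum_congr rfl fun j _ => ?_
    have := logDeriv_comp (f := Complex.Gamma) (g := fun s => (S.lam j : ℂ) * s + S.mu j) (x := s)
      (hΓd j) (by fun_prop)
    rw [Complex.digamma_def]
    refine Eq.trans this ?_
    have hd : HasDerivAt (fun s => (S.lam j : ℂ) * s + S.mu j) (S.lam j : ℂ) s := by
      simpa using ((hasDerivAt_id s).const_mul (S.lam j : ℂ)).add_const (S.mu j)
    rw [hd.deriv, mul_comm]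
  have e3 : logDeriv fP s = ∑ i, (S.m i : ℂ) / (s - S.pole i) := by
    rw [hfP, logDeriv_prod (fun i _ => hP0i i) (fun i _ => by fun_prop)]
    refine Finset.sum_congr rfl fun i _ => ?_
    rw [logDeriv_fun_pow (by fun_prop), logDeriv_apply]
    simp [div_eq_mul_inv]
  have e4 : logDeriv fR s = ∑ i : Fin S.N, (if 2 * S.M + S.dlt ≤ (i : ℕ) then
      -(S.m i : ℂ) / ((σ1 : ℂ) - s - (starRingEnd ℂ) (S.pole i)) else 0) := by
    rw [hfR, logDeriv_prod (f := fun (i : Fin S.N) s => if 2 * S.M + S.dlt ≤ (i : ℕ) then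
      ((σ1 : ℂ) - s - (starRingEnd ℂ) (S.pole i)) ^ S.m i else 1) (fun i _ => hR0i i) (fun i _ => hRdi i)]
    refine Finset.sum_congr rfl fun i _ => ?_
    split_ifs
    · rw [logDeriv_fun_pow (by fun_prop), logDeriv_apply]
      have hd : HasDerivAt (fun s => (σ1 : ℂ) - s - (starRingEnd ℂ) (S.pole i)) (-1) s := by
        simpa using ((hasDerivAt_id s).const_sub (σ1 : ℂ)).sub_const ((starRingEnd ℂ) (S.pole i))
      rw [hd.deriv]
      ring
    · simp [logDeriv_apply]
  rw [e1, e2, e3, e4, polePart]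
  ring

end IsFar

end SSF

/-- `f` is `O(‖z - c‖ ^ k)` on `D` for some `k`. -/
def PolyGrowthOn (c : ℂ) (D : Set ℂ) (f : ℂ → ℂ) : Prop :=
  ∃ (K : ℝ) (k : ℕ), 0 ≤ K ∧ ∀ z ∈ D, ‖f z‖ ≤ K * ‖z - c‖ ^ k

namespace PolyGrowthOn

variable {c : ℂ} {D : Set ℂ} {f g : ℂ → ℂ}

theorem mul (hf : PolyGrowthOn c D f) (hg : PolyGrowthOn c D g) :
    PolyGrowthOn c D fun z => f z * g z := by
  obtain ⟨K, k, hK, hf⟩ := hf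
  obtain ⟨K', k', hK', hg⟩ := hg
  refine ⟨K * K', k + k', by positivity, fun z hz => ?_⟩
  rw [norm_mul, pow_add]
  calc ‖f z‖ * ‖g z‖ ≤ (K * ‖z - c‖ ^ k) * (K' * ‖z - c‖ ^ k') :=
        mul_le_mul (hf z hz) (hg z hz) (norm_nonneg _) (by positivity)
    _ = _ := by ring

theorem of_norm_le {C : ℝ} (h : ∀ z ∈ D, ‖f z‖ ≤ C) : PolyGrowthOn c D f :=
  ⟨|C|, 0, abs_nonneg C, fun z hz => by simpa using (h z hz).trans (le_abs_self C)⟩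

theorem pow (hf : PolyGrowthOn c D f) (n : ℕ) : PolyGrowthOn c D fun z => f z ^ n := by
  induction n with
  | zero => exact of_norm_le (C := 1) (by simp)
  | succ n ih => simpa only [pow_succ] using ih.mul hf

theorem prod {ι : Type*} (s : Finset ι) {f : ι → ℂ → ℂ}
    (hf : ∀ i ∈ s, PolyGrowthOn c D (f i)) : PolyGrowthOn c D fun z => ∏ i ∈ s, f i z := by
  classical
  induction s using Finset.induction_on with
  | empty => exact of_norm_le (C := 1) (by simp)
  | insert a s ha ih =>
    simp only [Finset.prod_insert ha]
    exact (hf a (Finset.mem_insert_self _ _)).mul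
      (ih fun i hi => hf i (Finset.mem_insert_of_mem hi))

theorem sub_const (hD : ∀ z ∈ D, 1 ≤ ‖z - c‖) (w : ℂ) : PolyGrowthOn c D fun z => z - w := by
  refine ⟨1 + ‖c - w‖, 1, by positivity, fun z hz => ?_⟩
  have h1 := norm_add_le (z - c) (c - w)
  rw [sub_add_sub_cancel] at h1
  have := hD z hz
  nlinarith [norm_nonneg (c - w)]

end PolyGrowthOn

namespace SSF

variable {σ0 σ1 : ℝ} {S : SSF σ0 σ1} {A : ℝ}

theorem norm_xi_reflect (S : SSF σ0 σ1) (s : ℂ) :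
    ‖S.xi ((σ1 : ℂ) - (starRingEnd ℂ) s)‖ = ‖S.xi s‖ := by
  rw [S.hFE s, norm_mul, S.hω, one_mul, RCLike.norm_conj]

theorem norm_Q_cpow (S : SSF σ0 σ1) (s : ℂ) : ‖(S.Q : ℂ) ^ s‖ = S.Q ^ s.re :=
  Complex.norm_cpow_eq_rpow_re_of_pos S.hQ s

theorem growthOn_Q_cpow (S : SSF σ0 σ1) {p : ℝ} (hp : 1 ≤ p) (D : Set ℂ) :
    GrowthOn p D fun s => (S.Q : ℂ) ^ s := by
  refine GrowthOn.of_norm_le_exp (abs_nonneg (Real.log S.Q)) fun s _ => ?_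
  rw [S.norm_Q_cpow, Real.rpow_def_of_pos S.hQ]
  refine Real.exp_le_exp.2 ((le_abs_self _).trans ?_)
  rw [abs_mul]
  refine mul_le_mul_of_nonneg_left ?_ (abs_nonneg _)
  have := GrowthOn.base_le hp s
  have := Complex.abs_re_le_norm s
  linarith

theorem growthOn_sub_const {p : ℝ} (hp : 1 ≤ p) (D : Set ℂ) (w : ℂ) :
    GrowthOn p D fun z => z - w :=
  GrowthOn.of_norm_le_pow (C := 1) (w := w) (k := 1) hp fun z _ => by simp

theorem growthOn_reflected_factor (S : SSF σ0 σ1) {p : ℝ} (hp : 1 ≤ p) (D : Set ℂ) :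
    GrowthOn p D fun s => ∏ i : Fin S.N, (if 2 * S.M + S.dlt ≤ (i : ℕ) then
        ((σ1 : ℂ) - s - (starRingEnd ℂ) (S.pole i)) ^ S.m i else 1) := by
  refine GrowthOn.prod _ (by linarith) fun i _ => ?_
  split_ifs
  · refine GrowthOn.pow (by linarith) ?_ _
    refine GrowthOn.of_norm_le_pow (C := 1) (k := 1)
      (w := (σ1 : ℂ) - (starRingEnd ℂ) (S.pole i)) hp fun z _ => ?_
    rw [one_mul, pow_one, ← norm_neg]
    exact le_of_eq (congrArg _ (by ring))
  · exact GrowthOn.of_norm_le (C := 1) (by linarith) (by simp)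

namespace IsFar

variable (hA : S.IsFar A)
include hA

theorem growthOn_right : GrowthOn (5 / 4) {s | A ≤ s.re} S.xi := by
  obtain ⟨K, hK⟩ := S.exists_norm_F_le
  refine GrowthOn.congr ?_ fun s hs => hA.xi_eq hs
  refine GrowthOn.mul (GrowthOn.mul (GrowthOn.mul (GrowthOn.mul ?_ ?_) ?_) ?_) ?_
  · refine GrowthOn.of_norm_le (C := K) (by norm_num) fun s hs => hK s ?_
    have : A ≤ s.re := hs
    linarith [hA.hσ0]
  · exact S.growthOn_Q_cpow (by norm_num) _
  · refine GrowthOn.prod _ (by norm_num) fun j _ => ?_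
    refine growthOn_Gamma.comp (L := 1 + S.lam j + ‖S.mu j‖) (by norm_num)
      (fun s hs => hA.two_le_re hs j) fun s _ => ?_
    have h1 := norm_add_le ((S.lam j : ℂ) * s) (S.mu j)
    rw [norm_mul, Complex.norm_of_nonneg (S.hlam j).le] at h1
    nlinarith [norm_nonneg s, norm_nonneg (S.mu j), S.hlam j]
  · exact GrowthOn.prod _ (by norm_num) fun i _ =>
      GrowthOn.pow (by norm_num) (growthOn_sub_const (by norm_num) _ _) _
  · exact S.growthOn_reflected_factor (by norm_num) _

theorem growthOn_left : GrowthOn (5 / 4) {s | s.re ≤ σ1 - A} S.xi := by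
  have h := hA.growthOn_right.comp (φ := fun s => (σ1 : ℂ) - (starRingEnd ℂ) s)
    (D' := {s | s.re ≤ σ1 - A}) (L := 1 + σ1) (by norm_num) (fun s hs => by
      have : s.re ≤ σ1 - A := hs
      simp; linarith) fun s _ => by
      have h1 := norm_sub_le (σ1 : ℂ) ((starRingEnd ℂ) s)
      rw [RCLike.norm_conj, Complex.norm_of_nonneg S.hσ1pos.le] at h1
      nlinarith [norm_nonneg s, S.hσ1pos]
  obtain ⟨C, hC, h⟩ := h
  exact ⟨C, hC, fun s hs => by
    rw [← S.norm_xi_reflect]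
    exact h s hs⟩

theorem exists_growthOn_strip :
    ∃ p : ℝ, 0 ≤ p ∧ GrowthOn p {s | σ1 - A ≤ s.re ∧ s.re ≤ A ∧ A ≤ |s.im|} S.xi := by
  obtain ⟨c, B, hG⟩ := S.hGord
  set p := max B (5 / 4)
  have hp : 5 / 4 ≤ p := le_max_right _ _
  refine ⟨p, by linarith, ?_⟩
  have him : ∀ s ∈ {s : ℂ | σ1 - A ≤ s.re ∧ s.re ≤ A ∧ A ≤ |s.im|}, ∀ j,
      1 ≤ |((S.lam j : ℂ) * s + S.mu j).im| := by
    rintro s ⟨-, -, hs⟩ j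
    have h1 := hA.gamma j
    have h2 := mul_le_mul_of_nonneg_left hs (S.hlam j).le
    have h3 := Complex.abs_im_le_norm (S.mu j)
    have h4 := abs_sub_abs_le_abs_sub (S.lam j * s.im) (-(S.mu j).im)
    rw [abs_mul, abs_of_pos (S.hlam j), abs_neg, sub_neg_eq_add] at h4
    simp
    linarith [norm_nonneg (S.mu j)]
  have hpole : ∀ s ∈ {s : ℂ | σ1 - A ≤ s.re ∧ s.re ≤ A ∧ A ≤ |s.im|}, ∀ i, s ≠ S.pole i := by
    rintro s ⟨-, -, hs⟩ i rfl
    have h1 := hA.pole i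
    have h2 := Complex.abs_im_le_norm (S.pole i)
    linarith [S.hσ1pos, norm_nonneg (S.pole i)]
  have hcongr : ∀ s ∈ {s : ℂ | σ1 - A ≤ s.re ∧ s.re ≤ A ∧ A ≤ |s.im|}, S.xi s =
      S.G s * (S.Q : ℂ) ^ s * (∏ j, Complex.Gamma ((S.lam j : ℂ) * s + S.mu j)) *
      ∏ i : Fin S.N, (if 2 * S.M + S.dlt ≤ (i : ℕ) then
        ((σ1 : ℂ) - s - (starRingEnd ℂ) (S.pole i)) ^ S.m i else 1) := by
    intro s hs
    rw [S.hxiEq s (hpole s hs), S.hGF s (hpole s hs)]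
    · ring
    · intro j k h
      have := him s hs j
      rw [h] at this
      simp at this
      linarith
  refine GrowthOn.congr ?_ hcongr
  refine GrowthOn.mul (GrowthOn.mul (GrowthOn.mul ?_ ?_) ?_) ?_
  · have h1 : GrowthOn p {s : ℂ | σ1 - A ≤ s.re ∧ s.re ≤ A ∧ A ≤ |s.im|} fun _ => (c : ℂ) :=
      GrowthOn.of_norm_le (C := |c|) (by linarith) fun z _ => by simp
    have h2 : GrowthOn p {s : ℂ | σ1 - A ≤ s.re ∧ s.re ≤ A ∧ A ≤ |s.im|}
        fun s => ((Real.exp (‖s‖ ^ B) : ℝ) : ℂ) := by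
      refine GrowthOn.of_norm_le_exp zero_le_one ?_
      rintro s ⟨-, -, hs⟩
      rw [Complex.norm_of_nonneg (Real.exp_pos _).le, one_mul]
      refine Real.exp_le_exp.2 ?_
      have h3 := Complex.abs_im_le_norm s
      have h4 : 1 ≤ ‖s‖ := by linarith [hA.two_le]
      exact (Real.rpow_le_rpow_of_exponent_le h4 (le_max_left _ _)).trans
        (Real.rpow_le_rpow (by positivity) (by linarith) (by linarith))
    obtain ⟨C, hC, h⟩ := h1.mul h2
    refine ⟨C, hC, fun s hs => (hG s).trans (le_trans ?_ (h s hs))⟩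
    simp only [norm_mul, Complex.norm_real, Real.norm_eq_abs, Real.abs_exp]
    exact mul_le_mul_of_nonneg_right (le_abs_self c) (Real.exp_pos _).le
  · exact S.growthOn_Q_cpow (by linarith) _
  · refine GrowthOn.prod _ (by linarith) fun j _ => ?_
    obtain ⟨C, hC⟩ := exists_norm_Gamma_le_of_one_le_abs_im
      (S.lam j * (σ1 - A) - ‖S.mu j‖) (S.lam j * A + ‖S.mu j‖)
    refine GrowthOn.of_norm_le (C := C) (by linarith) fun s hs => hC _ ?_ ?_ (him s hs j)
    all_goals
      have h1 := abs_le.1 (Complex.abs_re_le_norm (S.mu j))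
      have h2 := mul_le_mul_of_nonneg_left hs.1 (S.hlam j).le
      have h3 := mul_le_mul_of_nonneg_left hs.2.1 (S.hlam j).le
      simp
      linarith
  · exact S.growthOn_reflected_factor (by linarith) _

theorem polyGrowthOn_edge :
    PolyGrowthOn ((σ1 - A - 1 : ℝ) : ℂ) {s | s.re = A} S.xi := by
  obtain ⟨K, hK⟩ := S.exists_norm_F_le
  have hone : ∀ s ∈ {s : ℂ | s.re = A}, 1 ≤ ‖s - ((σ1 - A - 1 : ℝ) : ℂ)‖ := by
    intro s hs
    have hs : s.re = A := hs
    have := Complex.re_le_norm (s - ((σ1 - A - 1 : ℝ) : ℂ))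
    rw [sub_re, ofReal_re, hs] at this
    linarith [hA.two_le, hA.hσ1, S.hσ1pos]
  have hAs : ∀ s ∈ {s : ℂ | s.re = A}, A ≤ s.re := fun s hs => le_of_eq (Eq.symm hs)
  obtain ⟨K', k, hK', h⟩ : PolyGrowthOn ((σ1 - A - 1 : ℝ) : ℂ) {s | s.re = A} fun s =>
      S.F s * (S.Q : ℂ) ^ s * (∏ j, Complex.Gamma ((S.lam j : ℂ) * s + S.mu j)) *
      (∏ i, (s - S.pole i) ^ S.m i) * ∏ i : Fin S.N, (if 2 * S.M + S.dlt ≤ (i : ℕ) then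
        ((σ1 : ℂ) - s - (starRingEnd ℂ) (S.pole i)) ^ S.m i else 1) := by
    refine PolyGrowthOn.mul (PolyGrowthOn.mul (PolyGrowthOn.mul (PolyGrowthOn.mul ?_ ?_) ?_) ?_) ?_
    · exact PolyGrowthOn.of_norm_le fun s hs => hK s (by linarith [hA.hσ0, hAs s hs])
    · refine PolyGrowthOn.of_norm_le (C := S.Q ^ A) fun s hs => ?_
      have hs' : s.re = A := hs
      rw [S.norm_Q_cpow, hs']
    · refine PolyGrowthOn.prod _ fun j _ => ?_
      refine PolyGrowthOn.of_norm_le (C := Real.Gamma (S.lam j * A + (S.mu j).re)) fun s hs => ?_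
      have hs' : s.re = A := hs
      refine (norm_Gamma_le (by linarith [hA.two_le_re (hAs s hs) j])).trans (le_of_eq ?_)
      simp [hs']
    · exact PolyGrowthOn.prod _ fun i _ => (PolyGrowthOn.sub_const hone _).pow _
    · refine PolyGrowthOn.prod _ fun i _ => ?_
      split_ifs
      · refine PolyGrowthOn.pow ?_ _
        obtain ⟨C, k, hC, h⟩ := PolyGrowthOn.sub_const hone ((σ1 : ℂ) - (starRingEnd ℂ) (S.pole i))
        refine ⟨C, k, hC, fun s hs => ?_⟩
        rw [← norm_neg]
        refine le_trans (le_of_eq (congrArg _ ?_)) (h s hs)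
        ring
      · exact PolyGrowthOn.of_norm_le (C := 1) (by simp)
  exact ⟨K', k, hK', fun s hs => by rw [hA.xi_eq (hAs s hs)]; exact h s hs⟩

theorem growthBound_xi (c : ℂ) : GrowthBound S.xi c := by
  obtain ⟨K, k, hK, hedge⟩ := hA.polyGrowthOn_edge
  obtain ⟨p, hp, hstrip⟩ := hA.exists_growthOn_strip
  set c0 : ℝ := σ1 - A - 1 with hc0
  have hσ1 := S.hσ1pos
  have hA1 := hA.hσ1
  set L : ℝ := 2 * A + 2 - σ1 with hL
  have hL1 : 1 ≤ L := by linarith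
  have hedge' : ∀ s : ℂ, s.re = A → ‖S.xi s‖ ≤ K * L ^ k * ‖s - c0‖ ^ k := fun s hs =>
    (hedge s hs).trans (mul_le_mul_of_nonneg_right
      (le_mul_of_one_le_right hK (one_le_pow₀ hL1)) (by positivity))
  have hedgeL : ∀ s : ℂ, s.re = σ1 - A → ‖S.xi s‖ ≤ K * L ^ k * ‖s - c0‖ ^ k := by
    intro s hs
    rw [← S.norm_xi_reflect]
    refine (hedge _ (by simp [hs])).trans ?_
    rw [mul_assoc, ← mul_pow]
    have h1 : 1 ≤ ‖s - c0‖ := by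
      have := Complex.re_le_norm (s - c0)
      rw [sub_re, ofReal_re, hs] at this
      linarith
    have h2 : (σ1 : ℂ) - (starRingEnd ℂ) s - (c0 : ℂ) = (s - c0) + ((2 * A - σ1 : ℝ) : ℂ) := by
      apply Complex.ext
      · simp [hs]; ring
      · simp
    have h3 : ‖(σ1 : ℂ) - (starRingEnd ℂ) s - (c0 : ℂ)‖ ≤ L * ‖s - c0‖ := by
      rw [h2]
      refine (norm_add_le _ _).trans ?_
      rw [Complex.norm_of_nonneg (by linarith)]
      nlinarith
    gcongr
  have h1 : GrowthOn (5 / 4) {s | σ1 - A ≤ s.re ∧ s.re ≤ A} S.xi :=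
    GrowthOn.of_norm_le_pow (C := K * L ^ k) (w := (c0 : ℂ)) (k := k) (by norm_num) fun s hs =>
      norm_le_mul_pow_of_vertical_strip S.hxiDiff (a := σ1 - A) (b := A) (c := c0) (by linarith)
        (by linarith) hp hedgeL hedge' hstrip hs.1 hs.2
  refine (((hA.growthOn_right.union hA.growthOn_left).union h1).mono ?_).growthBound c
  intro s _
  rcases le_total A s.re with h | h
  · exact Or.inl (Or.inl h)
  · rcases le_total s.re (σ1 - A) with h' | h'
    · exact Or.inl (Or.inr h')
    · exact Or.inr ⟨h', h⟩

end IsFar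

end SSF

theorem Complex.digamma_conj (w : ℂ) :
    Complex.digamma ((starRingEnd ℂ) w) = (starRingEnd ℂ) (Complex.digamma w) := by
  have h : (starRingEnd ℂ) ∘ Complex.Gamma ∘ (starRingEnd ℂ) = Complex.Gamma := by
    ext s
    simp [Complex.Gamma_conj]
  have h1 : deriv Complex.Gamma ((starRingEnd ℂ) w) = (starRingEnd ℂ) (deriv Complex.Gamma w) := by
    have := congrFun (deriv_conj_conj (𝕜 := ℂ) (f := Complex.Gamma)) ((starRingEnd ℂ) w)
    rw [h] at this
    simpa using this
  rw [Complex.digamma_def, logDeriv_apply, logDeriv_apply, Complex.Gamma_conj, map_div₀, h1]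

namespace SSF

variable {σ0 σ1 : ℝ} {S : SSF σ0 σ1} {A : ℝ}

namespace IsFar

variable (hA : S.IsFar A)
include hA

theorem le_norm_gammaArg {s : ℂ} (hs : A ≤ s.re) (j : Fin S.r) :
    S.lam j * ‖s‖ / 2 ≤ ‖(S.lam j : ℂ) * s + S.mu j‖ ∧
      ‖(S.lam j : ℂ) * s + S.mu j‖ ≤ 2 * S.lam j * ‖s‖ := by
  have h1 := hA.gamma j
  have h2 := mul_le_mul_of_nonneg_left (IsFar.le_norm hs) (S.hlam j).le
  have h3 := norm_add_le ((S.lam j : ℂ) * s) (S.mu j)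
  have h4 := norm_sub_norm_le ((S.lam j : ℂ) * s) (-S.mu j)
  rw [norm_neg, sub_neg_eq_add] at h4
  rw [norm_mul, Complex.norm_of_nonneg (S.hlam j).le] at h3 h4
  constructor <;> linarith [norm_nonneg (S.mu j)]

theorem exists_norm_logDeriv_xi_le {c : ℂ} (hc : S.xi c ≠ 0) :
    ∃ C : ℝ, 0 < C ∧ ∀ s : ℂ, A < s.re → ‖logDeriv S.xi s‖ ≤ C * ‖s‖ ^ (1 / 4 : ℝ) := by
  obtain ⟨K, hK, hF⟩ := S.exists_norm_logDeriv_F_le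
  obtain ⟨D, hD, hψ⟩ := exists_norm_digamma_le
  have hlam := S.hlam
  refine ⟨K + |Real.log S.Q| + (∑ j, S.lam j * (D * (2 * S.lam j) ^ (1 / 4 : ℝ))) +
    4 * ∑ i, (S.m i : ℝ), ?_, fun s hs => ?_⟩
  · have h1 : 0 ≤ ∑ j, S.lam j * (D * (2 * S.lam j) ^ (1 / 4 : ℝ)) :=
      Finset.sum_nonneg fun j _ => by have := hlam j; positivity
    positivity
  have hn : 1 ≤ ‖s‖ := by linarith [IsFar.le_norm hs.le, hA.two_le]
  have hn4 : 1 ≤ ‖s‖ ^ (1 / 4 : ℝ) := Real.one_le_rpow hn (by norm_num)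
  have h1 : ‖logDeriv S.F s‖ ≤ K * ‖s‖ ^ (1 / 4 : ℝ) := by
    refine (hF s (by linarith [hA.hσ0])).trans (mul_le_mul_of_nonneg_left (le_trans ?_ hn4) hK.le)
    exact Real.rpow_le_one_of_one_le_of_nonpos (by norm_num) (by linarith [hA.two_le])
  have h2 : ‖((Real.log S.Q : ℝ) : ℂ)‖ ≤ |Real.log S.Q| * ‖s‖ ^ (1 / 4 : ℝ) := by
    rw [Complex.norm_real, Real.norm_eq_abs]
    exact le_mul_of_one_le_right (abs_nonneg _) hn4
  have h3 : ‖∑ j, (S.lam j : ℂ) * Complex.digamma ((S.lam j : ℂ) * s + S.mu j)‖ ≤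
      (∑ j, S.lam j * (D * (2 * S.lam j) ^ (1 / 4 : ℝ))) * ‖s‖ ^ (1 / 4 : ℝ) := by
    rw [Finset.sum_mul]
    refine norm_sum_le_of_le _ fun j _ => ?_
    rw [norm_mul, Complex.norm_of_nonneg (hlam j).le, mul_assoc (S.lam j), mul_assoc D]
    refine mul_le_mul_of_nonneg_left ?_ (hlam j).le
    have hl := hlam j
    refine (hψ _ (by linarith [hA.two_le_re hs.le j])).trans (mul_le_mul_of_nonneg_left ?_ hD.le)
    rw [← Real.mul_rpow (by positivity) (by positivity)]
    exact Real.rpow_le_rpow (by positivity) (hA.le_norm_gammaArg hs.le j).2 (by norm_num)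
  have h4 : ‖S.polePart s‖ ≤ (4 * ∑ i, (S.m i : ℝ)) * ‖s‖ ^ (1 / 4 : ℝ) := by
    refine (hA.norm_polePart_le hs.le).trans (mul_le_mul_of_nonneg_left ?_ (by positivity))
    exact (inv_le_one_of_one_le₀ hn).trans hn4
  rw [hA.logDeriv_xi hc hs]
  refine (norm_add₃_le.trans (add_le_add (add_le_add (norm_add_le _ _) le_rfl) le_rfl)).trans ?_
  linarith

theorem exists_norm_logDeriv_xi_sub_conj_le {c : ℂ} (hc : S.xi c ≠ 0) :
    ∃ C : ℝ, 0 < C ∧ ∀ s : ℂ, A < s.re →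
      ‖logDeriv S.xi s - (starRingEnd ℂ) (logDeriv S.xi ((starRingEnd ℂ) s))‖ ≤
        C * (‖s‖ ^ (-(3 / 4) : ℝ) + 2 ^ (-s.re)) := by
  obtain ⟨K, hK, hF⟩ := S.exists_norm_logDeriv_F_le
  have hlam := S.hlam
  set D := ∑' j : ℕ, ((j : ℝ) + 1) ^ (-(5 / 4) : ℝ)
  have hD : 0 ≤ D := tsum_nonneg fun _ => by positivity
  set E : Fin S.r → ℝ := fun j =>
    S.lam j * (D * ((2 * ‖S.mu j‖) * (S.lam j / 2) ^ (-(3 / 4) : ℝ)))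
  have hE : ∀ j, 0 ≤ E j := fun j => by have := hlam j; positivity
  have hEs : 0 ≤ ∑ j, E j := Finset.sum_nonneg fun j _ => hE j
  refine ⟨2 * K + (∑ j, E j) + 8 * ∑ i, (S.m i : ℝ), by positivity, fun s hs => ?_⟩
  have hs' : A < ((starRingEnd ℂ) s).re := by simpa using hs
  have hn : 1 ≤ ‖s‖ := by linarith [IsFar.le_norm hs.le, hA.two_le]
  have hn34 : ‖s‖⁻¹ ≤ ‖s‖ ^ (-(3 / 4) : ℝ) := by
    rw [← Real.rpow_neg_one]
    exact Real.rpow_le_rpow_of_exponent_le hn (by norm_num)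
  have h1 : ‖logDeriv S.F s - (starRingEnd ℂ) (logDeriv S.F ((starRingEnd ℂ) s))‖ ≤
      2 * K * 2 ^ (-s.re) := by
    refine (norm_sub_le _ _).trans ?_
    have e1 := hF s (by linarith [hA.hσ0])
    have e2 := hF ((starRingEnd ℂ) s) (by linarith [hA.hσ0])
    rw [RCLike.norm_conj]
    rw [Complex.conj_re] at e2
    linarith
  have h3 : ‖∑ j, ((S.lam j : ℂ) * Complex.digamma ((S.lam j : ℂ) * s + S.mu j) -
      (S.lam j : ℂ) * Complex.digamma ((S.lam j : ℂ) * s + (starRingEnd ℂ) (S.mu j)))‖ ≤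
      (∑ j, E j) * ‖s‖ ^ (-(3 / 4) : ℝ) := by
    rw [Finset.sum_mul]
    refine norm_sum_le_of_le _ fun j _ => ?_
    have hl := hlam j
    rw [← mul_sub, norm_mul, Complex.norm_of_nonneg hl.le, mul_assoc (S.lam j), mul_assoc D]
    refine mul_le_mul_of_nonneg_left ?_ hl.le
    have hw : (S.lam j : ℂ) * s + (starRingEnd ℂ) (S.mu j) =
        (starRingEnd ℂ) ((S.lam j : ℂ) * (starRingEnd ℂ) s + S.mu j) := by simp
    have hz := (hA.le_norm_gammaArg hs.le j).1
    have hw' := (hA.le_norm_gammaArg hs'.le j).1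
    have e3 := hA.two_le_re hs'.le j
    rw [RCLike.norm_conj s] at hw'
    rw [← RCLike.norm_conj ((S.lam j : ℂ) * (starRingEnd ℂ) s + S.mu j), ← hw] at hw'
    rw [← Complex.conj_re ((S.lam j : ℂ) * (starRingEnd ℂ) s + S.mu j), ← hw] at e3
    refine (norm_digamma_sub_le (p := 5 / 8) (q := 5 / 8) (by norm_num) (by norm_num) (by norm_num)
      (by norm_num) (by norm_num) (by linarith [hA.two_le_re hs.le j]) (by linarith)).trans ?_
    refine mul_le_mul_of_nonneg_left ?_ hD
    rw [mul_assoc (2 * ‖S.mu j‖), ← Real.mul_rpow (x := S.lam j / 2) (by positivity) (by positivity),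
      Real.rpow_neg (by positivity), ← div_eq_mul_inv]
    have e4 : ‖(S.lam j : ℂ) * s + S.mu j - ((S.lam j : ℂ) * s + (starRingEnd ℂ) (S.mu j))‖ ≤
        2 * ‖S.mu j‖ := by
      rw [add_sub_add_left_eq_sub]
      refine (norm_sub_le _ _).trans ?_
      rw [RCLike.norm_conj]
      linarith
    have e5 : S.lam j / 2 * ‖s‖ = S.lam j * ‖s‖ / 2 := by ring
    have e6 : (S.lam j / 2 * ‖s‖) ^ (3 / 4 : ℝ) =
        (S.lam j * ‖s‖ / 2) ^ (1 - 5 / 8 : ℝ) * (S.lam j * ‖s‖ / 2) ^ (1 - 5 / 8 : ℝ) := by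
      rw [e5, ← Real.rpow_add (by positivity)]
      norm_num
    rw [e6]
    have hpos : 0 < S.lam j * ‖s‖ / 2 := by positivity
    gcongr
  have h4 : ‖S.polePart s - (starRingEnd ℂ) (S.polePart ((starRingEnd ℂ) s))‖ ≤
      (8 * ∑ i, (S.m i : ℝ)) * ‖s‖ ^ (-(3 / 4) : ℝ) := by
    refine (norm_sub_le _ _).trans ?_
    have e1 := hA.norm_polePart_le hs.le
    have e2 := hA.norm_polePart_le hs'.le
    rw [RCLike.norm_conj] at e2 ⊢
    have e3 : 0 ≤ 4 * ∑ i, (S.m i : ℝ) := by positivity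
    nlinarith
  have key : logDeriv S.xi s - (starRingEnd ℂ) (logDeriv S.xi ((starRingEnd ℂ) s)) =
      (logDeriv S.F s - (starRingEnd ℂ) (logDeriv S.F ((starRingEnd ℂ) s))) +
      (∑ j, ((S.lam j : ℂ) * Complex.digamma ((S.lam j : ℂ) * s + S.mu j) -
      (S.lam j : ℂ) * Complex.digamma ((S.lam j : ℂ) * s + (starRingEnd ℂ) (S.mu j)))) +
      (S.polePart s - (starRingEnd ℂ) (S.polePart ((starRingEnd ℂ) s))) := by
    rw [hA.logDeriv_xi hc hs, hA.logDeriv_xi hc hs', Finset.sum_sub_distrib]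
    simp only [map_add, map_sum, map_mul, Complex.conj_ofReal, ← Complex.digamma_conj,
      Complex.conj_conj]
    ring
  rw [key]
  refine (norm_add₃_le.trans (add_le_add (add_le_add h1 h3) h4)).trans ?_
  have p1 : (0 : ℝ) < 2 ^ (-s.re) := by positivity
  have p2 : 0 ≤ ‖s‖ ^ (-(3 / 4) : ℝ) := by positivity
  have p3 : 0 ≤ ∑ i, (S.m i : ℝ) := by positivity
  have q1 := mul_nonneg hEs p1.le
  have q2 := mul_nonneg p3 p1.le
  have q3 := mul_nonneg hK.le p2
  linarith

theorem differentiableAt_logDeriv_xi {c s : ℂ} (hc : S.xi c ≠ 0) (hs : A < s.re) :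
    DifferentiableAt ℂ (logDeriv S.xi) s :=
  ((S.hxiDiff.analyticAt s).deriv.div (S.hxiDiff.analyticAt s)
    (hA.xi_ne_zero hc hs)).differentiableAt

end IsFar

end SSF

theorem GrowthBound.summable_norm_inv_sq {f : ℂ → ℂ} {c : ℂ} (hg : GrowthBound f c)
    (hf : Differentiable ℂ f) (hc : f c ≠ 0) :
    Summable fun ρ : ℂ => (analyticOrderNatAt f ρ : ℝ) * (‖ρ - c‖ ^ 2)⁻¹ := by
  obtain ⟨W, hW, h⟩ := exists_one_add_norm_sub_le hf.continuous hc c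
  refine Summable.of_nonneg_of_le (fun _ => by positivity) (fun ρ => ?_)
    ((hg.summable_inv_sq hf hc).mul_left (W ^ 2))
  by_cases h0 : f ρ = 0
  · rw [mul_left_comm]
    refine mul_le_mul_of_nonneg_left ?_ (by positivity)
    have h1 := h ρ h0
    have h2 : 0 < ‖ρ - c‖ := by
      by_contra! h3
      have : ‖ρ - c‖ = 0 := le_antisymm h3 (norm_nonneg _)
      rw [this] at h1
      linarith
    rw [← div_eq_mul_inv, inv_eq_one_div, div_le_div_iff₀ (by positivity) (by positivity)]
    nlinarith
  · rw [analyticOrderNatAt_eq_zero_of_apply_ne_zero h0]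
    simp

theorem tendsto_integral_vertical_of_norm_le {g : ℂ → ℂ} {a τ C : ℝ} (ha : 1 ≤ a) (hτ : τ < a)
    (hg : ∀ s : ℂ, a ≤ s.re → DifferentiableAt ℂ g s)
    (hb : ∀ s : ℂ, a ≤ s.re → ‖g s‖ ≤ C * (‖s‖ ^ (-(3 / 4) : ℝ) + 2 ^ (-s.re))) :
    Tendsto (fun T : ℝ => ∫ t in -T..T, g (a + t * I) / (a + t * I - τ)) atTop (nhds 0) := by
  have hC : 0 ≤ C := by
    by_contra! h
    have h1 := (norm_nonneg _).trans (hb (a : ℂ) (by simp))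
    have h2 : 0 < ‖(a : ℂ)‖ ^ (-(3 / 4) : ℝ) + 2 ^ (-(a : ℂ).re) := by positivity
    nlinarith
  have hlim : Tendsto (fun T : ℝ => 4 * C * T ^ (-(1 / 5) : ℝ) + 4 * C * T ^ (-(2 / 5) : ℝ))
      atTop (nhds 0) := by
    simpa using ((tendsto_rpow_neg_atTop (by norm_num : (0 : ℝ) < 1 / 5)).const_mul (4 * C)).add
      ((tendsto_rpow_neg_atTop (by norm_num : (0 : ℝ) < 2 / 5)).const_mul (4 * C))
  refine squeeze_zero_norm' ?_ hlim
  filter_upwards [eventually_ge_atTop 1] with T hT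
  set k : ℂ → ℂ := fun s => g s / (s - τ) with hk
  set X : ℝ := T ^ (4 / 5 : ℝ) with hX
  have hX1 : 1 ≤ X := Real.one_le_rpow hT (by norm_num)
  have hne : ∀ s : ℂ, a ≤ s.re → s - τ ≠ 0 := by
    intro s hs h
    have : (s - τ).re = 0 := by rw [h]; simp
    simp at this
    linarith
  have hrect := Complex.integral_boundary_rect_eq_zero_of_differentiableOn k (a - T * I)
    ((a + X : ℝ) + T * I) (by
      intro s hs
      rw [mem_reProdIm] at hs
      have h1 : a ≤ s.re := by
        have := hs.1
        simp at this
        rw [Set.uIcc_of_le (by linarith)] at this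
        exact this.1
      exact ((hg s h1).div (by fun_prop) (hne s h1)).differentiableWithinAt)
  simp only [sub_re, ofReal_re, mul_re, I_re, mul_zero, ofReal_im, I_im, mul_one, sub_self, sub_zero,
    add_re, add_zero, sub_im, mul_im, zero_add, zero_sub, add_im, ofReal_neg] at hrect
  have hb' : ∀ s : ℂ, a ≤ s.re → ‖g s‖ ≤ 2 * C := by
    intro s hs
    refine (hb s hs).trans ?_
    have h1 : 1 ≤ ‖s‖ := by linarith [Complex.re_le_norm s]
    have h2 : ‖s‖ ^ (-(3 / 4) : ℝ) ≤ 1 := Real.rpow_le_one_of_one_le_of_nonpos h1 (by norm_num)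
    have h3 : (2 : ℝ) ^ (-s.re) ≤ 1 :=
      Real.rpow_le_one_of_one_le_of_nonpos (by norm_num) (by linarith)
    nlinarith
  have hhor : ∀ y : ℝ, |y| = T → ‖∫ x : ℝ in a..a + X, k (x + y * I)‖ ≤ 2 * C * T ^ (-(1 / 5) : ℝ) := by
    intro y hy
    have h1 := intervalIntegral.norm_integral_le_of_norm_le_const (a := a) (b := a + X)
      (f := fun x : ℝ => k (x + y * I)) (C := 2 * C / T) fun x hx => by
        rw [Set.uIoc_of_le (by linarith)] at hx
        rw [hk, norm_div]
        refine div_le_div₀ (by positivity) (hb' _ (by simpa using hx.1.le)) (by linarith) ?_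
        have := Complex.abs_im_le_norm ((x : ℂ) + y * I - τ)
        simp only [sub_im, add_im, ofReal_im, mul_im, ofReal_re, I_im, mul_one, I_re, mul_zero,
          add_zero, zero_add, sub_zero] at this
        rwa [hy] at this
    refine h1.trans (le_of_eq ?_)
    rw [add_sub_cancel_left, abs_of_pos (by linarith), hX, div_mul_eq_mul_div, mul_div_assoc]
    congr 1
    rw [div_eq_mul_inv, ← Real.rpow_neg_one T, ← Real.rpow_add (by linarith)]
    norm_num
  have hver : ‖∫ y : ℝ in -T..T, k ((a + X : ℝ) + y * I)‖ ≤ 4 * C * T ^ (-(2 / 5) : ℝ) := by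
    have h1 := intervalIntegral.norm_integral_le_of_norm_le_const (a := -T) (b := T)
      (f := fun y : ℝ => k ((a + X : ℝ) + y * I)) (C := 2 * C * X ^ (-(7 / 4) : ℝ)) fun y hy => by
        have hre : ((a + X : ℝ) + y * I : ℂ).re = a + X := by simp
        have e1 := hb ((a + X : ℝ) + y * I) (by rw [hre]; linarith)
        have e2 : X ≤ ‖((a + X : ℝ) + y * I : ℂ)‖ := by
          have := Complex.re_le_norm ((a + X : ℝ) + y * I : ℂ)
          rw [hre] at this
          linarith
        have e3 : X ≤ ‖((a + X : ℝ) + y * I - τ : ℂ)‖ := by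
          have := Complex.re_le_norm ((a + X : ℝ) + y * I - τ : ℂ)
          rw [sub_re, hre, ofReal_re] at this
          linarith
        have e4 : ‖((a + X : ℝ) + y * I : ℂ)‖ ^ (-(3 / 4) : ℝ) ≤ X ^ (-(3 / 4) : ℝ) :=
          Real.rpow_le_rpow_of_nonpos (by linarith) e2 (by norm_num)
        have e5 : (2 : ℝ) ^ (-(a + X)) ≤ X ^ (-(3 / 4) : ℝ) := by
          have f1 : X ≤ 2 ^ (a + X) := by
            have := one_add_mul_self_le_rpow_one_add (s := 1) (by norm_num) (p := a + X) (by linarith)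
            norm_num at this
            linarith
          rw [Real.rpow_neg (by norm_num)]
          refine (inv_anti₀ (by linarith) f1).trans ?_
          rw [← Real.rpow_neg_one]
          exact Real.rpow_le_rpow_of_exponent_le hX1 (by norm_num)
        rw [hre] at e1
        have e6 : ‖g ((a + X : ℝ) + y * I)‖ ≤ 2 * C * X ^ (-(3 / 4) : ℝ) := by nlinarith
        rw [hk, norm_div]
        refine (div_le_div₀ (by positivity) e6 (by linarith) e3).trans (le_of_eq ?_)
        rw [mul_div_assoc]
        congr 1
        rw [div_eq_mul_inv, ← Real.rpow_neg_one X, ← Real.rpow_add (by linarith)]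
        norm_num
    refine h1.trans (le_of_eq ?_)
    rw [sub_neg_eq_add, abs_of_pos (by linarith), hX, ← Real.rpow_mul (by linarith)]
    have : T * T ^ (4 / 5 * -(7 / 4) : ℝ) = T ^ (-(2 / 5) : ℝ) := by
      nth_rewrite 1 [← Real.rpow_one T]
      rw [← Real.rpow_add (by linarith)]
      norm_num
    rw [← this]
    ring
  have h1 := hhor (-T) (by rw [abs_neg, abs_of_pos (by linarith)])
  have h2 := hhor T (abs_of_pos (by linarith))
  simp only [smul_eq_mul, ofReal_neg] at hrect h1
  have h3 : ‖I * ∫ y : ℝ in -T..T, k (a + y * I)‖ = ‖∫ y : ℝ in -T..T, k (a + y * I)‖ := by simp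
  have h4 : ‖I * ∫ y : ℝ in -T..T, k ((a + X : ℝ) + y * I)‖ =
      ‖∫ y : ℝ in -T..T, k ((a + X : ℝ) + y * I)‖ := by simp
  have h5 : I * ∫ y : ℝ in -T..T, k (a + y * I) = ((∫ x : ℝ in a..a + X, k (x + -T * I)) -
      ∫ x : ℝ in a..a + X, k (x + T * I)) + I * ∫ y : ℝ in -T..T, k ((a + X : ℝ) + y * I) := by
    linear_combination -hrect
  change ‖∫ y : ℝ in -T..T, k (a + y * I)‖ ≤ _
  rw [← h3, h5]
  refine (norm_add_le _ _).trans ?_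
  rw [h4]
  linarith [norm_sub_le (∫ x : ℝ in a..a + X, k (x + -T * I)) (∫ x : ℝ in a..a + X, k (x + T * I))]

namespace SSF

variable {σ0 σ1 : ℝ} {S : SSF σ0 σ1} {A τ : ℝ}

theorem re_inv_sub (ρ : ℂ) (τ : ℝ) : (1 / (ρ - τ)).re = (ρ.re - τ) * (‖ρ - τ‖ ^ 2)⁻¹ := by
  rw [one_div, Complex.inv_re, Complex.normSq_eq_norm_sq, div_eq_mul_inv]
  simp

namespace IsFar

variable (hA : S.IsFar A)
include hA

theorem abs_re_inv_sub_le {c : ℂ} (hc : S.xi c ≠ 0) {ρ : ℂ} (hρ : S.xi ρ = 0) :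
    |(1 / (ρ - τ)).re| ≤ (A + |τ|) * (‖ρ - τ‖ ^ 2)⁻¹ := by
  have h := hA.re_mem_of_xi_eq_zero hc hρ
  rw [re_inv_sub, abs_mul, abs_of_nonneg (a := (‖ρ - τ‖ ^ 2)⁻¹) (by positivity)]
  refine mul_le_mul_of_nonneg_right ?_ (by positivity)
  have : |ρ.re| ≤ A := abs_le.2 ⟨by linarith [S.hσ1pos], h.2⟩
  exact (abs_sub _ _).trans (by linarith)

theorem summable_abs_re_inv_sub (hτ : S.xi τ ≠ 0) :
    Summable fun ρ : ℂ => (analyticOrderNatAt S.xi ρ : ℝ) * |(1 / (ρ - τ)).re| := by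
  refine Summable.of_nonneg_of_le (fun _ => by positivity) (fun ρ => ?_)
    (((hA.growthBound_xi τ).summable_norm_inv_sq S.hxiDiff hτ).mul_left (A + |τ|))
  by_cases h0 : S.xi ρ = 0
  · rw [mul_left_comm]
    exact mul_le_mul_of_nonneg_left (hA.abs_re_inv_sub_le hτ h0) (by positivity)
  · rw [analyticOrderNatAt_eq_zero_of_apply_ne_zero h0]
    simp

theorem exists_tsum_local_le (hτ : S.xi τ ≠ 0) : ∃ C : ℝ, 0 < C ∧ ∀ T : ℝ,
    Summable (fun ρ : ℂ => (analyticOrderNatAt S.xi ρ : ℝ) * (1 + (T - ρ.im) ^ 2)⁻¹) ∧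
    ∑' ρ : ℂ, (analyticOrderNatAt S.xi ρ : ℝ) * (1 + (T - ρ.im) ^ 2)⁻¹ ≤
      C * (1 + |T|) ^ (1 / 4 : ℝ) := by
  obtain ⟨C, hC, hb⟩ := hA.exists_norm_logDeriv_xi_le hτ
  have hA2 := hA.two_le
  have hA1 := hA.hσ1
  have hσ1 := S.hσ1pos
  set H : ℝ := 2 * A + 1 - σ1 with hH
  have hH1 : 1 ≤ H := by linarith
  have hR := hA.summable_abs_re_inv_sub hτ
  set R := ∑' ρ : ℂ, (analyticOrderNatAt S.xi ρ : ℝ) * |(1 / (ρ - τ)).re|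
  have hR0 : 0 ≤ R := tsum_nonneg fun _ => by positivity
  set b := logDeriv S.xi τ
  refine ⟨H ^ 2 * (C * (A + 1) ^ (1 / 4 : ℝ) + ‖b‖ + R), by positivity, fun T => ?_⟩
  set s : ℂ := (A + 1 : ℝ) + T * I with hs
  have hsre : s.re = A + 1 := by simp [hs]
  have hsim : s.im = T := by simp [hs]
  have hsne := hA.xi_ne_zero hτ (s := s) (by linarith)
  have h1 := Complex.hasSum_re ((hA.growthBound_xi τ).hasSum_logDeriv S.hxiDiff hτ hsne)
  have h1' : HasSum (fun ρ : ℂ => (analyticOrderNatAt S.xi ρ : ℝ) * ((1 / (s - ρ)).re +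
      (1 / (ρ - τ)).re)) (logDeriv S.xi s - b).re := by
    refine h1.congr_fun fun ρ => ?_
    rw [← Complex.ofReal_natCast, Complex.re_ofReal_mul, add_re]
  have h2 : Summable fun ρ : ℂ => (analyticOrderNatAt S.xi ρ : ℝ) * (1 / (ρ - τ)).re := by
    refine hR.of_norm_bounded fun ρ => ?_
    rw [norm_mul, Real.norm_natCast, Real.norm_eq_abs]
  have h3 := h1'.sub h2.hasSum
  have h4 : ∀ ρ : ℂ, H⁻¹ ^ 2 * ((analyticOrderNatAt S.xi ρ : ℝ) * (1 + (T - ρ.im) ^ 2)⁻¹) ≤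
      (analyticOrderNatAt S.xi ρ : ℝ) * ((1 / (s - ρ)).re + (1 / (ρ - τ)).re) -
      (analyticOrderNatAt S.xi ρ : ℝ) * (1 / (ρ - τ)).re := by
    intro ρ
    by_cases h0 : S.xi ρ = 0
    · have hre := hA.re_mem_of_xi_eq_zero hτ h0
      rw [← mul_sub, add_sub_cancel_right, mul_left_comm]
      refine mul_le_mul_of_nonneg_left ?_ (by positivity)
      rw [one_div, Complex.inv_re, Complex.normSq_apply, sub_re, sub_im, hsre, hsim]
      have e1 : 1 ≤ A + 1 - ρ.re := by linarith
      have e2 : A + 1 - ρ.re ≤ H := by linarith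
      rw [inv_pow, ← mul_inv, inv_eq_one_div, div_le_div_iff₀ (by positivity) (by nlinarith)]
      have e3 : (A + 1 - ρ.re) ^ 2 ≤ H ^ 2 := by gcongr
      have e4 : 1 * (T - ρ.im) ^ 2 ≤ H ^ 2 * (T - ρ.im) ^ 2 := by gcongr; nlinarith
      have e5 : 0 ≤ (A + 1 - ρ.re - 1) * (H ^ 2 * (1 + (T - ρ.im) ^ 2)) :=
        mul_nonneg (by linarith) (by positivity)
      nlinarith
    · rw [analyticOrderNatAt_eq_zero_of_apply_ne_zero h0]
      simp
  have h5 : Summable fun ρ : ℂ =>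
      H⁻¹ ^ 2 * ((analyticOrderNatAt S.xi ρ : ℝ) * (1 + (T - ρ.im) ^ 2)⁻¹) :=
    h3.summable.of_nonneg_of_le (fun _ => by positivity) h4
  have hHne : H⁻¹ ^ 2 ≠ 0 := by positivity
  have h6 : Summable fun ρ : ℂ => (analyticOrderNatAt S.xi ρ : ℝ) * (1 + (T - ρ.im) ^ 2)⁻¹ :=
    (summable_mul_left_iff hHne).1 h5
  refine ⟨h6, ?_⟩
  have h7 := h5.tsum_le_tsum h4 h3.summable
  rw [h3.tsum_eq, tsum_mul_left] at h7
  have h8 : -(∑' ρ : ℂ, (analyticOrderNatAt S.xi ρ : ℝ) * (1 / (ρ - τ)).re) ≤ R := by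
    rw [← tsum_neg]
    refine h2.neg.tsum_le_tsum (fun ρ => ?_) hR
    rw [← mul_neg]
    exact mul_le_mul_of_nonneg_left (neg_le_abs _) (by positivity)
  have h9 : (logDeriv S.xi s - b).re ≤ C * (A + 1) ^ (1 / 4 : ℝ) * (1 + |T|) ^ (1 / 4 : ℝ) + ‖b‖ := by
    refine (Complex.re_le_norm _).trans ((norm_sub_le _ _).trans (add_le_add_left ?_ _))
    refine (hb s (by linarith)).trans ?_
    rw [mul_assoc, ← Real.mul_rpow (by linarith) (by positivity)]
    have e1 : ‖s‖ ≤ (A + 1) * (1 + |T|) := by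
      refine (norm_add_le _ _).trans ?_
      rw [Complex.norm_of_nonneg (by linarith), norm_mul, Complex.norm_real, Complex.norm_I,
        Real.norm_eq_abs]
      nlinarith [abs_nonneg T]
    gcongr
  have h10 : 1 ≤ (1 + |T|) ^ (1 / 4 : ℝ) := Real.one_le_rpow (by linarith [abs_nonneg T]) (by norm_num)
  set Y := ∑' ρ : ℂ, (analyticOrderNatAt S.xi ρ : ℝ) * (1 + (T - ρ.im) ^ 2)⁻¹
  have h11 : H⁻¹ ^ 2 * Y ≤ (C * (A + 1) ^ (1 / 4 : ℝ) + ‖b‖ + R) * (1 + |T|) ^ (1 / 4 : ℝ) := by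
    nlinarith [norm_nonneg b]
  have h12 : Y = H ^ 2 * (H⁻¹ ^ 2 * Y) := by field_simp
  rw [h12, mul_assoc]
  exact mul_le_mul_of_nonneg_left h11 (by positivity)

end IsFar

end SSF

theorem add_mul_I_sub_re (a t : ℝ) (ρ : ℂ) : ((a : ℂ) + t * I - ρ).re = a - ρ.re := by simp

theorem add_mul_I_sub_im (a t : ℝ) (ρ : ℂ) : ((a : ℂ) + t * I - ρ).im = t - ρ.im := by simp

theorem integral_inv_vertical {a : ℝ} {ρ : ℂ} (h : ρ.re < a) (T : ℝ) :
    ∫ t in -T..T, ((a : ℂ) + t * I - ρ)⁻¹ =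
      -I * (Complex.log ((a : ℂ) + T * I - ρ) - Complex.log ((a : ℂ) + (-T : ℝ) * I - ρ)) := by
  have hslit : ∀ t : ℝ, (a : ℂ) + t * I - ρ ∈ slitPlane := fun t =>
    Or.inl (by rw [add_mul_I_sub_re]; linarith)
  have hd : ∀ t : ℝ, HasDerivAt (fun t : ℝ => -I * Complex.log ((a : ℂ) + t * I - ρ))
      ((a : ℂ) + t * I - ρ)⁻¹ t := by
    intro t
    have h1 : HasDerivAt (fun t : ℝ => (a : ℂ) + t * I - ρ) I t := by
      simpa using (((Complex.ofRealCLM.hasDerivAt (x := t)).mul_const I).const_add (a : ℂ)).sub_const ρ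
    refine ((h1.clog_real (hslit t)).const_mul (-I)).congr_deriv ?_
    rw [← mul_div_assoc, neg_mul, I_mul_I, neg_neg, one_div]
  have hc : Continuous fun t : ℝ => ((a : ℂ) + t * I - ρ)⁻¹ :=
    Continuous.inv₀ (by fun_prop) fun t => slitPlane_ne_zero (hslit t)
  rw [intervalIntegral.integral_eq_sub_of_hasDerivAt (fun t _ => hd t)
    (hc.intervalIntegrable _ _)]
  ring

theorem Complex.abs_pi_div_two_sub_abs_arg_le {z : ℂ} (hz : 0 < z.re) :
    |Real.pi / 2 - (|z.arg|)| ≤ Real.pi / 2 * (z.re / ‖z‖) := by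
  have h1 : |z.arg| ≤ Real.pi / 2 := abs_arg_le_pi_div_two_iff.2 hz.le
  have hz0 : z ≠ 0 := fun h => by simp [h] at hz
  rw [abs_of_nonneg (by linarith), ← Complex.cos_arg hz0, ← Real.cos_abs, ← Real.sin_pi_div_two_sub]
  have h2 := Real.mul_le_sin (x := Real.pi / 2 - |z.arg|) (by linarith)
    (by linarith [abs_nonneg z.arg])
  have hpi := Real.pi_pos
  calc Real.pi / 2 - |z.arg| = Real.pi / 2 * (2 / Real.pi * (Real.pi / 2 - |z.arg|)) := by
        field_simp
    _ ≤ _ := mul_le_mul_of_nonneg_left h2 (by positivity)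

theorem Real.abs_log_sub_log_le {x y e M : ℝ} (hM : 0 < M) (hx : M ≤ x) (hy : M ≤ y)
    (h : |x - y| ≤ e) : |Real.log x - Real.log y| ≤ Real.log (1 + e / M) := by
  have key : ∀ x y : ℝ, M ≤ x → M ≤ y → |x - y| ≤ e →
      Real.log x - Real.log y ≤ Real.log (1 + e / M) := by
    intro x y hx hy h
    rw [← Real.log_div (by linarith) (by linarith)]
    refine Real.log_le_log (div_pos (by linarith) (by linarith)) ?_
    have h1 : x = y + (x - y) := by ring
    have h2 : (x - y) / y ≤ e / M :=
      div_le_div₀ ((abs_nonneg _).trans h) ((le_abs_self _).trans h) hM hy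
    calc x / y = 1 + (x - y) / y := by
          have : y ≠ 0 := by linarith
          field_simp; ring
      _ ≤ _ := by linarith
  rw [abs_le]
  constructor
  · linarith [key y x hy hx (by rwa [abs_sub_comm])]
  · exact key x y hx hy h

theorem Real.log_one_add_le_two_mul_sqrt {x : ℝ} (hx : 0 ≤ x) : Real.log (1 + x) ≤ 2 * √x := by
  have h0 : 0 ≤ √x := Real.sqrt_nonneg x
  have h1 : 1 + x ≤ (1 + √x) ^ 2 := by nlinarith [Real.sq_sqrt hx]
  calc Real.log (1 + x) ≤ Real.log ((1 + √x) ^ 2) := Real.log_le_log (by linarith) h1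
    _ = 2 * Real.log (1 + √x) := by rw [Real.log_pow]; norm_num
    _ ≤ 2 * √x := by linarith [Real.log_le_sub_one_of_pos (x := 1 + √x) (by linarith)]

namespace SSF

variable {σ0 σ1 : ℝ} {S : SSF σ0 σ1} {A τ : ℝ}

theorem analyticOrderNatAt_xi_reflect {c : ℂ} (hc : S.xi c ≠ 0) (ρ : ℂ) :
    analyticOrderNatAt S.xi ((σ1 : ℂ) - (starRingEnd ℂ) ρ) = analyticOrderNatAt S.xi ρ := by
  have htop := analyticOrderAt_ne_top_of_apply_ne_zero S.hxiDiff hc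
  rw [(S.hxiDiff.analyticAt _).analyticOrderNatAt_eq_iff (htop _)]
  obtain ⟨g, hg, hg0, hgeq⟩ :=
    ((S.hxiDiff.analyticAt ρ).analyticOrderNatAt_eq_iff (htop ρ)).1 rfl
  set n := analyticOrderNatAt S.xi ρ
  set φ : ℂ → ℂ := fun z => (σ1 : ℂ) - (starRingEnd ℂ) z with hφ
  have hφφ : ∀ z, φ (φ z) = z := fun z => by simp [hφ]
  have hφc : Continuous φ := continuous_const.sub Complex.continuous_conj
  have hlim : Tendsto φ (nhds (φ ρ)) (nhds ρ) := by
    have := hφc.tendsto (φ ρ)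
    rwa [hφφ] at this
  have hω : S.ω ≠ 0 := by
    intro h; have := S.hω; rw [h, norm_zero] at this; norm_num at this
  refine ⟨fun z => S.ω * ((-1) ^ n * (starRingEnd ℂ) (g (φ z))), ?_, ?_, ?_⟩
  · rw [Complex.analyticAt_iff_eventually_differentiableAt]
    filter_upwards [hlim.eventually (Complex.analyticAt_iff_eventually_differentiableAt.1 hg)]
      with z hz
    refine (DifferentiableAt.const_mul ?_ _).const_mul _
    have h1 : DifferentiableAt ℂ (fun w => g (σ1 - w)) ((starRingEnd ℂ) z) :=
      DifferentiableAt.comp (𝕜 := ℂ) ((starRingEnd ℂ) z) (g := g) (f := fun w => (σ1 : ℂ) - w) hz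
        (by fun_prop)
    have := h1.conj_conj
    rwa [Complex.conj_conj] at this
  · refine mul_ne_zero hω (mul_ne_zero (pow_ne_zero _ (by norm_num)) ?_)
    change (starRingEnd ℂ) (g (φ (φ ρ))) ≠ 0
    rw [hφφ]
    simpa using hg0
  · filter_upwards [hlim.eventually hgeq] with z hz
    rw [S.hFE z]
    change S.ω * (starRingEnd ℂ) (S.xi (φ z)) = _
    rw [hz]
    simp only [smul_eq_mul, map_mul, map_pow, map_sub, hφ, Complex.conj_conj, Complex.conj_ofReal]
    have : (σ1 : ℂ) - z - (starRingEnd ℂ) ρ = -1 * (z - (σ1 - (starRingEnd ℂ) ρ)) := by ring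
    rw [this, mul_pow]
    ring

theorem logDeriv_xi_reflect (S : SSF σ0 σ1) (s : ℂ) :
    logDeriv S.xi ((σ1 : ℂ) - (starRingEnd ℂ) s) = -(starRingEnd ℂ) (logDeriv S.xi s) := by
  have hω : S.ω ≠ 0 := by
    intro h; have := S.hω; rw [h, norm_zero] at this; norm_num at this
  set w : ℂ := (σ1 : ℂ) - (starRingEnd ℂ) s with hw
  have hws : (starRingEnd ℂ) ((σ1 : ℂ) - w) = s := by simp [hw]
  have hd : HasDerivAt S.xi (S.ω * (-(starRingEnd ℂ) (deriv S.xi s))) w := by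
    have h1 : HasDerivAt (fun v => S.xi (σ1 - v)) (-deriv S.xi s) ((starRingEnd ℂ) w) := by
      have e : (σ1 : ℂ) - (starRingEnd ℂ) w = s := by simp [hw]
      have := (S.hxiDiff.differentiableAt (x := (σ1 : ℂ) - (starRingEnd ℂ) w)).hasDerivAt.comp
        ((starRingEnd ℂ) w) ((hasDerivAt_id ((starRingEnd ℂ) w)).const_sub (σ1 : ℂ))
      rw [e] at this
      exact this.congr_deriv (by ring)
    have h2 := h1.conj_conj.const_mul S.ω
    rw [Complex.conj_conj, map_neg] at h2
    refine h2.congr_of_eventuallyEq (.of_forall fun z => ?_)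
    exact S.hFE z
  rw [logDeriv_apply, logDeriv_apply, hd.deriv, S.hFE w, map_div₀, ← neg_div]
  have e : (σ1 : ℂ) - (starRingEnd ℂ) w = s := by simp [hw]
  rw [e, mul_div_mul_left _ _ hω]

namespace IsFar

variable (hA : S.IsFar A)
include hA

theorem tendsto_im_integral (hτA : τ ≤ A) {c : ℂ} (hc : S.xi c ≠ 0) :
    Tendsto (fun T : ℝ => (∫ t in -T..T, logDeriv S.xi ((A + 1 : ℝ) + t * I) /
      ((A + 1 : ℝ) + t * I - τ)).im) atTop (nhds 0) := by
  obtain ⟨C, hC, hb⟩ := hA.exists_norm_logDeriv_xi_sub_conj_le hc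
  set f := logDeriv S.xi with hf
  set a : ℝ := A + 1 with ha
  have hre : ∀ t : ℝ, ((a : ℂ) + t * I).re = a := by simp
  have hdiff : ∀ s : ℂ, a ≤ s.re → DifferentiableAt ℂ f s := fun s hs =>
    hA.differentiableAt_logDeriv_xi hc (by linarith)
  have h1 := tendsto_integral_vertical_of_norm_le (a := a) (τ := τ) (C := C)
    (g := fun s => f s - (starRingEnd ℂ) (f ((starRingEnd ℂ) s))) (by linarith [hA.two_le])
    (by linarith) (fun s hs => by
      refine (hdiff s hs).sub ?_
      have := (hdiff ((starRingEnd ℂ) s) (by simpa using hs)).conj_conj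
      rwa [Complex.conj_conj] at this) (fun s hs => hb s (by linarith))
  have hne : ∀ t : ℝ, (a : ℂ) + t * I - τ ≠ 0 := fun t h => by
    have := congrArg Complex.re h
    rw [add_mul_I_sub_re] at this
    simp at this
    linarith
  have hcf : Continuous fun t : ℝ => f (a + t * I) := by
    rw [continuous_iff_continuousAt]
    intro t
    exact ContinuousAt.comp (g := f) (f := fun t : ℝ => (a : ℂ) + t * I)
      (hdiff _ (by rw [hre])).continuousAt (by fun_prop)
  have hck : Continuous fun t : ℝ => f (a + t * I) / (a + t * I - τ) :=
    hcf.div (by fun_prop) hne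
  have hck' : Continuous fun t : ℝ => (starRingEnd ℂ) (f (a + (-t : ℝ) * I) / (a + (-t : ℝ) * I - τ)) :=
    Complex.continuous_conj.comp (hck.comp continuous_neg)
  have h2 : ∀ T : ℝ, ∫ t in -T..T, (f (a + t * I) -
      (starRingEnd ℂ) (f ((starRingEnd ℂ) (a + t * I)))) / (a + t * I - τ) =
      2 * I * ((∫ t in -T..T, f (a + t * I) / (a + t * I - τ)).im : ℝ) := by
    intro T
    set J := ∫ t in -T..T, f (a + t * I) / (a + t * I - τ) with hJ
    have e1 : (starRingEnd ℂ) J = ∫ t in -T..T,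
        (starRingEnd ℂ) (f (a + (-t : ℝ) * I) / (a + (-t : ℝ) * I - τ)) := by
      rw [intervalIntegral.integral_comp_neg
        (fun t : ℝ => (starRingEnd ℂ) (f (a + t * I) / (a + t * I - τ))), neg_neg, hJ]
      simp only [intervalIntegral, map_sub, integral_conj]
    have e2 : (2 * I * (J.im : ℝ) : ℂ) = J - (starRingEnd ℂ) J := by
      rw [Complex.sub_conj]; push_cast; ring
    rw [e2, e1, hJ, ← intervalIntegral.integral_sub (hck.intervalIntegrable _ _)
      (hck'.intervalIntegrable _ _)]
    refine intervalIntegral.integral_congr fun t _ => ?_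
    simp only [map_div₀, map_sub, map_add, map_mul, Complex.conj_ofReal, Complex.conj_I, sub_div]
    simp
  have h3 := (Complex.continuous_im.tendsto _).comp (h1.congr h2)
  have h4 := h3.const_mul (1 / 2 : ℝ)
  simp only [Complex.zero_im, mul_zero] at h4
  refine h4.congr fun T => ?_
  simp [Complex.mul_im]

theorem hasSum_re_inv_sub (hτ : S.xi τ ≠ 0) :
    HasSum (fun ρ : ℂ => (analyticOrderNatAt S.xi ρ : ℝ) * (1 / (ρ - τ)).re)
      (-(logDeriv S.xi τ).re) := by
  have hR : Summable fun ρ : ℂ => (analyticOrderNatAt S.xi ρ : ℝ) * (1 / (ρ - τ)).re := by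
    refine (hA.summable_abs_re_inv_sub hτ).of_norm_bounded fun ρ => ?_
    rw [norm_mul, Real.norm_natCast, Real.norm_eq_abs]
  set s : ℂ := (σ1 : ℂ) - (starRingEnd ℂ) (τ : ℂ) with hs
  have hsne : S.xi s ≠ 0 := by
    rw [← norm_pos_iff, hs, S.norm_xi_reflect]
    exact norm_pos_iff.2 hτ
  have h1 := Complex.hasSum_re ((hA.growthBound_xi τ).hasSum_logDeriv S.hxiDiff hτ hsne)
  rw [hs, S.logDeriv_xi_reflect, ← hs] at h1
  have h2 : HasSum (fun ρ : ℂ => (analyticOrderNatAt S.xi ρ : ℝ) * ((1 / (s - ρ)).re +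
      (1 / (ρ - τ)).re)) (-2 * (logDeriv S.xi τ).re) := by
    have h3 : HasSum (fun ρ : ℂ => (analyticOrderNatAt S.xi ρ : ℝ) * ((1 / (s - ρ)).re +
      (1 / (ρ - τ)).re)) (-(starRingEnd ℂ) (logDeriv S.xi τ) - logDeriv S.xi τ).re := by
      refine h1.congr_fun fun ρ => ?_
      rw [← Complex.ofReal_natCast, Complex.re_ofReal_mul, add_re]
    convert! h3 using 1
    simp; ring
  have h3 := h2.sub hR.hasSum
  set φ : ℂ ≃ ℂ := Function.Involutive.toPerm (fun z => (σ1 : ℂ) - (starRingEnd ℂ) z)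
    (fun z => by simp) with hφ
  have h4 : HasSum (fun ρ : ℂ => (analyticOrderNatAt S.xi ρ : ℝ) * (1 / (ρ - τ)).re)
      (-2 * (logDeriv S.xi τ).re -
        ∑' ρ : ℂ, (analyticOrderNatAt S.xi ρ : ℝ) * (1 / (ρ - τ)).re) := by
    have h5 := φ.hasSum_iff.2 h3
    refine h5.congr_fun fun ρ => ?_
    have e1 : φ ρ = (σ1 : ℂ) - (starRingEnd ℂ) ρ := rfl
    simp only [Function.comp_apply, e1]
    rw [analyticOrderNatAt_xi_reflect hτ, ← mul_sub, add_sub_cancel_right]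
    congr 1
    have e2 : s - ((σ1 : ℂ) - (starRingEnd ℂ) ρ) = (starRingEnd ℂ) (ρ - τ) := by
      rw [hs, map_sub]; ring
    rw [e2, ← Complex.conj_re (1 / (ρ - τ)), map_div₀, map_one]
  have h6 := h4.tsum_eq
  have h7 : ∑' ρ : ℂ, (analyticOrderNatAt S.xi ρ : ℝ) * (1 / (ρ - τ)).re =
      -(logDeriv S.xi τ).re := by linarith
  rw [← h7]
  exact hR.hasSum

end IsFar

end SSF

/-- The integral of `(s - ρ)⁻¹` with respect to `Im s` along the segment from `a - iT` to
`a + iT`, in terms of logarithms. -/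
def verticalLog (a T : ℝ) (ρ : ℂ) : ℂ :=
  -I * (Complex.log ((a : ℂ) + T * I - ρ) - Complex.log ((a : ℂ) + (-T : ℝ) * I - ρ))

theorem verticalLog_re (a T : ℝ) (ρ : ℂ) : (verticalLog a T ρ).re =
    ((a : ℂ) + T * I - ρ).arg - ((a : ℂ) + (-T : ℝ) * I - ρ).arg := by
  rw [verticalLog, neg_mul, neg_re, I_mul_re, sub_im, log_im, log_im]
  ring

theorem verticalLog_im (a T : ℝ) (ρ : ℂ) : (verticalLog a T ρ).im =
    Real.log ‖(a : ℂ) + (-T : ℝ) * I - ρ‖ - Real.log ‖(a : ℂ) + T * I - ρ‖ := by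
  rw [verticalLog, neg_mul, neg_im, I_mul_im, sub_re, log_re, log_re]
  ring

namespace SSF.IsFar

variable {σ0 σ1 : ℝ} {S : SSF σ0 σ1} {A τ : ℝ} (hA : S.IsFar A)
include hA

theorem hasSum_inv_sub_mul_verticalLog (hτA : τ ≤ A) (hτ : S.xi τ ≠ 0) (T : ℝ) :
    HasSum (fun ρ : ℂ => (analyticOrderNatAt S.xi ρ : ℂ) * (1 / (ρ - τ)) *
        verticalLog (A + 1) T ρ)
      ((∫ t in -T..T, logDeriv S.xi ((A + 1 : ℝ) + t * I) / ((A + 1 : ℝ) + t * I - τ)) -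
        logDeriv S.xi τ * verticalLog (A + 1) T τ) := by
  set a : ℝ := A + 1 with ha
  set f := logDeriv S.xi with hf
  have hg := hA.growthBound_xi τ
  have hsum := hg.summable_norm_inv_sq S.hxiDiff hτ
  have hm : ∀ ρ, S.xi ρ ≠ 0 → analyticOrderNatAt S.xi ρ = 0 := fun ρ hρ =>
    analyticOrderNatAt_eq_zero_of_apply_ne_zero hρ
  set Z : Set ℂ := Function.support fun ρ : ℂ =>
    (analyticOrderNatAt S.xi ρ : ℝ) * (‖ρ - τ‖ ^ 2)⁻¹ with hZ
  have : Countable Z := hsum.countable_support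
  have hre : ∀ t : ℝ, ((a : ℂ) + t * I).re = a := by simp
  have hsne : ∀ t : ℝ, S.xi ((a : ℂ) + t * I) ≠ 0 := fun t =>
    hA.xi_ne_zero hτ (by rw [hre]; linarith)
  have hτne : ∀ t : ℝ, (a : ℂ) + t * I - τ ≠ 0 := fun t h => by
    have := congrArg Complex.re h
    rw [add_mul_I_sub_re] at this
    simp at this
    linarith
  have hτρ : ∀ ρ : ℂ, S.xi ρ = 0 → ρ - τ ≠ 0 := fun ρ hρ h => by
    rw [sub_eq_zero.1 h] at hρ; exact hτ hρ
  have hnorm : ∀ (t : ℝ) (ρ : ℂ), S.xi ρ = 0 → 1 ≤ ‖(a : ℂ) + t * I - ρ‖ := fun t ρ hρ => by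
    have h1 := (hA.re_mem_of_xi_eq_zero hτ hρ).2
    have h2 := (le_abs_self _).trans (abs_re_le_norm ((a : ℂ) + t * I - ρ))
    rw [add_mul_I_sub_re] at h2
    linarith
  have hne : ∀ (t : ℝ) (ρ : ℂ), S.xi ρ = 0 → (a : ℂ) + t * I - ρ ≠ 0 := fun t ρ hρ =>
    norm_pos_iff.1 (by linarith [hnorm t ρ hρ])
  set g : ℂ → ℝ → ℂ := fun ρ t =>
    (analyticOrderNatAt S.xi ρ : ℂ) * (1 / (ρ - τ)) * ((a : ℂ) + t * I - ρ)⁻¹ with hgdef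
  have hsupp : ∀ φ : ℂ → ℂ, Function.support
      (fun ρ => (analyticOrderNatAt S.xi ρ : ℂ) * (1 / (ρ - τ)) * φ ρ) ⊆ Z := by
    intro φ ρ hρ
    rw [Function.mem_support] at hρ
    rw [hZ, Function.mem_support]
    have h1 := left_ne_zero_of_mul hρ
    have h2 := left_ne_zero_of_mul h1
    have h3 : ρ - τ ≠ 0 := by simpa using right_ne_zero_of_mul h1
    have h4 := norm_pos_iff.2 h3
    exact mul_ne_zero (by exact_mod_cast h2) (by positivity)
  have hZ0 : ∀ ρ ∈ Z, S.xi ρ = 0 := fun ρ hρ => by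
    by_contra h
    rw [hZ, Function.mem_support, hm ρ h] at hρ
    simp at hρ
  have hpt : ∀ t : ℝ, HasSum (fun ρ => g ρ t)
      (f (a + t * I) / (a + t * I - τ) - f τ * (a + t * I - τ)⁻¹) := by
    intro t
    have h := ((hg.hasSum_logDeriv S.hxiDiff hτ (hsne t)).div_const (a + t * I - τ))
    rw [sub_div, ← hf, div_eq_mul_inv (f τ)] at h
    refine h.congr_fun fun ρ => ?_
    by_cases hρ : S.xi ρ = 0
    · have h1 := hτρ ρ hρ
      have h2 := hne t ρ hρ
      have h3 := hτne t
      simp only [hgdef]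
      field_simp
      ring
    · simp [hgdef, hm ρ hρ]
  have hcont : ∀ ρ : ℂ, S.xi ρ = 0 → Continuous fun t : ℝ => ((a : ℂ) + t * I - ρ)⁻¹ := fun ρ hρ =>
    Continuous.inv₀ (by fun_prop) fun t => hne t ρ hρ
  have hcf : Continuous fun t : ℝ => f (a + t * I) := by
    rw [continuous_iff_continuousAt]
    intro t
    exact ContinuousAt.comp (g := f) (f := fun t : ℝ => (a : ℂ) + t * I)
      (hA.differentiableAt_logDeriv_xi hτ (by rw [hre]; linarith)).continuousAt (by fun_prop)
  have hck : Continuous fun t : ℝ => f (a + t * I) / (a + t * I - τ) :=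
    hcf.div (by fun_prop) hτne
  have hck' : Continuous fun t : ℝ => f τ * ((a : ℂ) + t * I - τ)⁻¹ :=
    continuous_const.mul (Continuous.inv₀ (by fun_prop) hτne)
  set K : ℝ := 1 + (|a| + (|T|) + |τ|) with hK
  have hbd : ∀ (ρ : ℂ), S.xi ρ = 0 → ∀ t : ℝ, |t| ≤ |T| → ‖g ρ t‖ ≤
      K * ((analyticOrderNatAt S.xi ρ : ℝ) * (‖ρ - τ‖ ^ 2)⁻¹) := by
    intro ρ hρ t ht
    have h1 := hnorm t ρ hρ
    have h2 := norm_pos_iff.2 (hτρ ρ hρ)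
    have h3 : ‖ρ - τ‖ ≤ K * ‖(a : ℂ) + t * I - ρ‖ := by
      have e : ρ - τ = (a : ℂ) + t * I - τ - (a + t * I - ρ) := by ring
      have h4 : ‖(a : ℂ) + t * I - τ‖ ≤ |a| + (|T|) + |τ| := by
        refine (norm_sub_le _ _).trans (add_le_add ((norm_add_le _ _).trans ?_) ?_)
        · rw [norm_mul, norm_I, norm_real, norm_real, Real.norm_eq_abs, Real.norm_eq_abs]
          linarith
        · rw [norm_real, Real.norm_eq_abs]
      rw [e]
      refine (norm_sub_le _ _).trans ?_
      have : 0 ≤ |a| + (|T|) + |τ| := by positivity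
      rw [hK]
      nlinarith
    have h5 : ‖(a : ℂ) + t * I - ρ‖⁻¹ ≤ K * ‖ρ - τ‖⁻¹ := by
      rw [← div_eq_mul_inv, inv_le_iff_one_le_mul₀ (by linarith), div_mul_eq_mul_div,
        le_div_iff₀ h2]
      linarith
    simp only [hgdef, norm_mul, norm_inv, norm_div, norm_one, Complex.norm_natCast]
    calc _ ≤ (analyticOrderNatAt S.xi ρ : ℝ) * (1 / ‖ρ - τ‖) * (K * ‖ρ - τ‖⁻¹) := by gcongr
      _ = _ := by rw [one_div, pow_two, mul_inv]; ring
  have hint : HasSum (fun ρ : Z => ∫ t in -T..T, g ρ t)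
      (∫ t in -T..T, (f (a + t * I) / (a + t * I - τ) - f τ * (a + t * I - τ)⁻¹)) := by
    refine intervalIntegral.hasSum_integral_of_dominated_convergence
      (fun (ρ : Z) _ => K * ((analyticOrderNatAt S.xi (ρ : ℂ) : ℝ) * (‖(ρ : ℂ) - τ‖ ^ 2)⁻¹))
      ?_ ?_ ?_ ?_ ?_
    · intro ρ
      exact (continuous_const.mul (hcont ρ (hZ0 ρ ρ.2))).aestronglyMeasurable
    · intro ρ
      refine .of_forall fun t ht => hbd ρ (hZ0 ρ ρ.2) t ?_
      rw [Set.mem_uIoc] at ht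
      rcases ht with h | h
      · exact (abs_le.2 ⟨h.1.le, h.2⟩).trans (le_abs_self T)
      · exact (abs_le.2 ⟨by linarith [h.1], by linarith⟩ : |t| ≤ -T).trans (neg_le_abs T)
    · exact .of_forall fun t _ => (hsum.mul_left K).subtype Z
    · exact intervalIntegrable_const
    · refine .of_forall fun t _ => ?_
      exact (hasSum_subtype_iff_of_support_subset (hsupp fun ρ => ((a : ℂ) + t * I - ρ)⁻¹)).2
        (hpt t)
  rw [intervalIntegral.integral_sub (hck.intervalIntegrable _ _) (hck'.intervalIntegrable _ _),
    intervalIntegral.integral_const_mul, integral_inv_vertical (by simp; linarith) T] at hint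
  rw [← hasSum_subtype_iff_of_support_subset (hsupp (verticalLog a T))]
  refine hint.congr_fun fun ρ => ?_
  simp only [hgdef, Function.comp_apply, intervalIntegral.integral_const_mul]
  rw [integral_inv_vertical (by linarith [(hA.re_mem_of_xi_eq_zero hτ (hZ0 ρ ρ.2)).2]) T]
  rfl

end SSF.IsFar

theorem sqrt_one_add_sq_le_norm {a t : ℝ} {ρ : ℂ} (h : 1 ≤ a - ρ.re) :
    √(1 + (t - ρ.im) ^ 2) ≤ ‖(a : ℂ) + t * I - ρ‖ := by
  refine Real.sqrt_le_iff.2 ⟨norm_nonneg _, ?_⟩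
  rw [Complex.sq_norm, Complex.normSq_apply, add_mul_I_sub_re, add_mul_I_sub_im]
  nlinarith

theorem abs_verticalLog_re_sub_le {a T : ℝ} {ρ : ℂ} (h : 1 ≤ a - ρ.re) (hT : 0 ≤ T) :
    |(verticalLog a T ρ).re - (if |ρ.im| ≤ T then Real.pi else 0)| ≤
      Real.pi / 2 * (a - ρ.re) * ((√(1 + (T - ρ.im) ^ 2))⁻¹ + (√(1 + (-T - ρ.im) ^ 2))⁻¹) := by
  rw [verticalLog_re]
  have key : ∀ t : ℝ, |Real.pi / 2 - (|((a : ℂ) + t * I - ρ).arg|)| ≤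
      Real.pi / 2 * (a - ρ.re) * (√(1 + (t - ρ.im) ^ 2))⁻¹ := by
    intro t
    have h1 := Complex.abs_pi_div_two_sub_abs_arg_le (z := (a : ℂ) + t * I - ρ)
      (by rw [add_mul_I_sub_re]; linarith)
    rw [add_mul_I_sub_re] at h1
    refine h1.trans ?_
    rw [mul_assoc, div_eq_mul_inv (a - ρ.re)]
    have h2 := sqrt_one_add_sq_le_norm (t := t) h
    have h3 : 0 < √(1 + (t - ρ.im) ^ 2) := by positivity
    have h4 : 0 ≤ a - ρ.re := by linarith
    have h5 : ‖(a : ℂ) + t * I - ρ‖⁻¹ ≤ (√(1 + (t - ρ.im) ^ 2))⁻¹ := inv_anti₀ h3 h2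
    gcongr
  have k1 := key T
  have k2 := key (-T)
  have hsgn : ∀ t : ℝ, 0 < ((a : ℂ) + t * I - ρ).re := fun t => by
    rw [add_mul_I_sub_re]; linarith
  have hpos : ∀ t : ℝ, ρ.im ≤ t → |((a : ℂ) + t * I - ρ).arg| = ((a : ℂ) + t * I - ρ).arg :=
    fun t ht => abs_of_nonneg (arg_nonneg_iff.2 (by rw [add_mul_I_sub_im]; linarith))
  have hneg : ∀ t : ℝ, t ≤ ρ.im → |((a : ℂ) + t * I - ρ).arg| = -((a : ℂ) + t * I - ρ).arg := by
    intro t ht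
    rcases ht.lt_or_eq with h | h
    · exact abs_of_neg (arg_neg_iff.2 (by rw [add_mul_I_sub_im]; linarith))
    · have : ((a : ℂ) + t * I - ρ).arg = 0 :=
        arg_eq_zero_iff.2 ⟨(hsgn t).le, by rw [add_mul_I_sub_im, h, sub_self]⟩
      rw [this]; simp
  rw [mul_add]
  rw [abs_le] at k1 k2 ⊢
  split_ifs with hγ
  · obtain ⟨g1, g2⟩ := abs_le.1 hγ
    rw [hpos T g2] at k1
    rw [hneg (-T) g1] at k2
    constructor <;> linarith [k1.1, k1.2, k2.1, k2.2]
  · rcases lt_abs.1 (not_le.1 hγ) with g | g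
    · rw [hneg T g.le] at k1
      rw [hneg (-T) (by linarith)] at k2
      constructor <;> linarith [k1.1, k1.2, k2.1, k2.2]
    · rw [hpos T (by linarith)] at k1
      rw [hpos (-T) (by linarith)] at k2
      constructor <;> linarith [k1.1, k1.2, k2.1, k2.2]

theorem abs_verticalLog_im_le {a T M : ℝ} {ρ : ℂ} (hM : 0 < M)
    (h1 : M ≤ ‖(a : ℂ) + T * I - ρ‖) (h2 : M ≤ ‖(a : ℂ) + (-T : ℝ) * I - ρ‖) :
    |(verticalLog a T ρ).im| ≤ Real.log (1 + 2 * |ρ.im| / M) := by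
  rw [verticalLog_im]
  refine Real.abs_log_sub_log_le hM h2 h1 ?_
  rw [← Complex.norm_conj ((a : ℂ) + (-T : ℝ) * I - ρ)]
  refine (abs_norm_sub_norm_le _ _).trans ?_
  have : (starRingEnd ℂ) ((a : ℂ) + (-T : ℝ) * I - ρ) - ((a : ℂ) + T * I - ρ) =
      ((2 * ρ.im : ℝ) : ℂ) * I := by
    apply Complex.ext <;> simp
    ring
  rw [this, norm_mul, norm_I, mul_one, norm_real, Real.norm_eq_abs, abs_mul]
  simp

theorem tendsto_verticalLog_ofReal {a τ : ℝ} (h : τ + 1 ≤ a) :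
    Tendsto (fun T : ℝ => verticalLog a T τ) atTop (nhds (Real.pi : ℂ)) := by
  have him : ∀ T : ℝ, (verticalLog a T τ).im = 0 := by
    intro T
    rw [verticalLog_im, ← Complex.norm_conj ((a : ℂ) + (-T : ℝ) * I - τ)]
    simp
  have hlim : Tendsto (fun T : ℝ => Real.pi / 2 * (a - τ) *
      ((√(1 + T ^ 2))⁻¹ + (√(1 + T ^ 2))⁻¹)) atTop (nhds 0) := by
    have h1 : Tendsto (fun T : ℝ => (√(1 + T ^ 2))⁻¹) atTop (nhds 0) := by
      refine tendsto_inv_atTop_zero.comp (Real.tendsto_sqrt_atTop.comp ?_)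
      exact tendsto_atTop_add_const_left _ _ (tendsto_pow_atTop two_ne_zero)
    simpa using (h1.add h1).const_mul (Real.pi / 2 * (a - τ))
  have hre : Tendsto (fun T : ℝ => (verticalLog a T τ).re) atTop (nhds Real.pi) := by
    rw [tendsto_iff_norm_sub_tendsto_zero]
    refine squeeze_zero' (.of_forall fun _ => norm_nonneg _) ?_ hlim
    filter_upwards [eventually_ge_atTop 0] with T hT
    have := abs_verticalLog_re_sub_le (a := a) (ρ := (τ : ℂ)) (T := T) (by simp; linarith) hT
    simpa [hT] using this
  have := (Complex.continuous_ofReal.tendsto _).comp hre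
  refine this.congr fun T => ?_
  apply Complex.ext
  · simp
  · simp [him]

theorem inv_sq_mul_le_of_le {q u v : ℝ} (hq : 1 ≤ q) (hu : 0 < u) (hv : 0 < v)
    (h : u ^ 2 < q ^ 8 / 2 → v ≤ 2 / q ^ 8) :
    (u ^ 2)⁻¹ * v ≤ 2 * (q⁻¹ * (u ^ 3)⁻¹ + (q ^ 3)⁻¹ * v ^ 2) := by
  have hq0 : 0 < q := by linarith
  have hu3 : 0 < (u ^ 3)⁻¹ := by positivity
  rcases lt_or_ge (u ^ 2) (q ^ 8 / 2) with h1 | h1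
  · have hu4 : u ≤ q ^ 4 := by
      refine le_of_sq_le_sq ?_ (by positivity)
      have : 0 < q ^ 8 := by positivity
      calc u ^ 2 ≤ q ^ 8 := by linarith
        _ = (q ^ 4) ^ 2 := by ring
    have h2 : u * v ≤ 2 * q⁻¹ := by
      calc u * v ≤ q ^ 4 * (2 / q ^ 8) := mul_le_mul hu4 (h h1) hv.le (by positivity)
        _ = 2 * (q ^ 4)⁻¹ := by field_simp
        _ ≤ 2 * q⁻¹ := by
          gcongr
          exact le_self_pow₀ hq (by norm_num)
    calc (u ^ 2)⁻¹ * v = (u ^ 3)⁻¹ * (u * v) := by field_simp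
      _ ≤ (u ^ 3)⁻¹ * (2 * q⁻¹) := by gcongr
      _ ≤ _ := by
        have : 0 ≤ (q ^ 3)⁻¹ * v ^ 2 := by positivity
        nlinarith
  · have hu4 : q ^ 4 / 2 ≤ u := by
      refine le_of_sq_le_sq ?_ hu.le
      have : 0 < q ^ 8 := by positivity
      calc (q ^ 4 / 2) ^ 2 = q ^ 8 / 4 := by ring
        _ ≤ u ^ 2 := by linarith
    have h2 : (u ^ 2)⁻¹ * v ≤ q ^ 3 * (u ^ 4)⁻¹ + (q ^ 3)⁻¹ * v ^ 2 := by
      have e1 : q ^ 3 * (u ^ 4)⁻¹ + (q ^ 3)⁻¹ * v ^ 2 - 2 * ((u ^ 2)⁻¹ * v) =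
          q ^ 3 * ((u ^ 2)⁻¹ - (q ^ 3)⁻¹ * v) ^ 2 := by
        field_simp; ring
      have e2 : 0 ≤ q ^ 3 * ((u ^ 2)⁻¹ - (q ^ 3)⁻¹ * v) ^ 2 := by positivity
      have e3 : 0 ≤ (u ^ 2)⁻¹ * v := by positivity
      linarith
    have h3 : q ^ 3 * (u ^ 4)⁻¹ ≤ 2 * (q⁻¹ * (u ^ 3)⁻¹) := by
      have h4 : u⁻¹ ≤ (q ^ 4 / 2)⁻¹ := inv_anti₀ (by positivity) hu4
      calc q ^ 3 * (u ^ 4)⁻¹ = q ^ 3 * (u ^ 3)⁻¹ * u⁻¹ := by field_simp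
        _ ≤ q ^ 3 * (u ^ 3)⁻¹ * (q ^ 4 / 2)⁻¹ := by gcongr
        _ = _ := by field_simp
    have h4 : 0 ≤ (q ^ 3)⁻¹ * v ^ 2 := by positivity
    linarith

namespace SSF.IsFar

variable {σ0 σ1 : ℝ} {S : SSF σ0 σ1} {A τ : ℝ} (hA : S.IsFar A)
include hA

theorem norm_re_mul_verticalLog_im_le (hτ : S.xi τ ≠ 0) (T : ℝ) (ρ : ℂ) :
    ‖(analyticOrderNatAt S.xi ρ : ℝ) * (1 / (ρ - τ)).re * (verticalLog (A + 1) T ρ).im‖ ≤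
      (A + |τ|) * (2 * √2) * ((analyticOrderNatAt S.xi ρ : ℝ) * ‖ρ - τ‖ ^ (-(3 / 2) : ℝ)) := by
  by_cases hρ : S.xi ρ = 0
  · have hr0 : 0 < ‖ρ - τ‖ := norm_pos_iff.2 fun h => hτ (by rwa [sub_eq_zero.1 h] at hρ)
    have h1 := (hA.re_mem_of_xi_eq_zero hτ hρ).2
    have hone : ∀ t : ℝ, 1 ≤ ‖((A + 1 : ℝ) : ℂ) + t * I - ρ‖ := fun t => by
      refine le_trans ?_ ((le_abs_self _).trans (abs_re_le_norm _))
      rw [add_mul_I_sub_re]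
      linarith
    have h2 := abs_verticalLog_im_le one_pos (hone T) (hone (-T))
    have him : |ρ.im| ≤ ‖ρ - τ‖ := by
      simpa using abs_im_le_norm (ρ - τ)
    have h3 : |(verticalLog (A + 1) T ρ).im| ≤ 2 * √2 * √‖ρ - τ‖ := by
      refine h2.trans ((Real.log_one_add_le_two_mul_sqrt (by positivity)).trans ?_)
      rw [mul_assoc, ← Real.sqrt_mul (by norm_num), div_one]
      gcongr
    have h4 := hA.abs_re_inv_sub_le (τ := τ) hτ hρ
    have hA0 : 0 ≤ A + |τ| := by linarith [hA.two_le, abs_nonneg τ]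
    rw [norm_mul, norm_mul, Real.norm_natCast, Real.norm_eq_abs, Real.norm_eq_abs]
    have e : ‖ρ - τ‖ ^ (-(3 / 2) : ℝ) = (‖ρ - τ‖ ^ 2)⁻¹ * √‖ρ - τ‖ := by
      rw [Real.sqrt_eq_rpow, ← Real.rpow_natCast, ← Real.rpow_neg hr0.le, ← Real.rpow_add hr0]
      norm_num
    rw [e]
    calc _ ≤ (analyticOrderNatAt S.xi ρ : ℝ) * ((A + |τ|) * (‖ρ - τ‖ ^ 2)⁻¹) *
          (2 * √2 * √‖ρ - τ‖) := by gcongr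
      _ = _ := by ring
  · simp [analyticOrderNatAt_eq_zero_of_apply_ne_zero hρ]

theorem summable_re_mul_verticalLog_im (hτ : S.xi τ ≠ 0) (T : ℝ) :
    Summable fun ρ : ℂ => (analyticOrderNatAt S.xi ρ : ℝ) * (1 / (ρ - τ)).re *
      (verticalLog (A + 1) T ρ).im :=
  .of_norm_bounded (((hA.growthBound_xi τ).summable_rpow S.hxiDiff hτ).mul_left _)
    (hA.norm_re_mul_verticalLog_im_le hτ T)

theorem tendsto_tsum_re_mul_verticalLog_im (hτ : S.xi τ ≠ 0) :
    Tendsto (fun T : ℝ => ∑' ρ : ℂ, (analyticOrderNatAt S.xi ρ : ℝ) * (1 / (ρ - τ)).re *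
      (verticalLog (A + 1) T ρ).im) atTop (nhds 0) := by
  have hsum := ((hA.growthBound_xi τ).summable_rpow S.hxiDiff hτ).mul_left ((A + |τ|) * (2 * √2))
  have h := tendsto_tsum_of_dominated_convergence (𝓕 := atTop)
    (f := fun (T : ℝ) (ρ : ℂ) => (analyticOrderNatAt S.xi ρ : ℝ) * (1 / (ρ - τ)).re *
      (verticalLog (A + 1) T ρ).im) (g := fun _ => 0) hsum ?_ ?_
  · simpa using h
  · intro ρ
    have hlim : Tendsto (fun T : ℝ => Real.log (1 + 2 * |ρ.im| / (T - |ρ.im|))) atTop (nhds 0) := by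
      have h1 : Tendsto (fun T : ℝ => 2 * |ρ.im| / (T - |ρ.im|)) atTop (nhds 0) :=
        Tendsto.const_div_atTop (tendsto_atTop_add_const_right _ _ tendsto_id) _
      have h2 := (h1.const_add 1).log (by norm_num)
      simpa using h2
    have h3 : Tendsto (fun T : ℝ => (verticalLog (A + 1) T ρ).im) atTop (nhds 0) := by
      refine squeeze_zero_norm' ?_ hlim
      filter_upwards [eventually_gt_atTop |ρ.im|] with T hT
      have hab := abs_le.1 (le_refl |ρ.im|)
      refine abs_verticalLog_im_le (by linarith) ?_ ?_
      · refine le_trans ?_ (abs_im_le_norm _)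
        rw [add_mul_I_sub_im]
        exact le_trans (by linarith) (le_abs_self _)
      · refine le_trans ?_ (abs_im_le_norm _)
        rw [add_mul_I_sub_im]
        exact le_trans (by linarith) (neg_le_abs _)
    simpa using h3.const_mul ((analyticOrderNatAt S.xi ρ : ℝ) * (1 / (ρ - τ)).re)
  · exact .of_forall fun T ρ => hA.norm_re_mul_verticalLog_im_le hτ T ρ

end SSF.IsFar

namespace SSF.IsFar

variable {σ0 σ1 : ℝ} {S : SSF σ0 σ1} {A τ : ℝ} (hA : S.IsFar A)
include hA

theorem exists_tsum_inv_norm_mul_le (hτ : S.xi τ ≠ 0) : ∃ C : ℝ, ∀ q T : ℝ, 1 ≤ q → |T| = q ^ 8 →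
    Summable (fun ρ : ℂ => (analyticOrderNatAt S.xi ρ : ℝ) *
      (‖ρ - τ‖⁻¹ * (√(1 + (T - ρ.im) ^ 2))⁻¹)) ∧
    ∑' ρ : ℂ, (analyticOrderNatAt S.xi ρ : ℝ) * (‖ρ - τ‖⁻¹ * (√(1 + (T - ρ.im) ^ 2))⁻¹) ≤
      C * q⁻¹ := by
  obtain ⟨C, hC, hloc⟩ := hA.exists_tsum_local_le hτ
  have hsum := (hA.growthBound_xi τ).summable_rpow S.hxiDiff hτ
  set D := ∑' ρ : ℂ, (analyticOrderNatAt S.xi ρ : ℝ) * ‖ρ - τ‖ ^ (-(3 / 2) : ℝ) with hD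
  refine ⟨2 * (D + 2 * C), fun q T hq hT => ?_⟩
  have hq0 : 0 < q := by linarith
  obtain ⟨hs, hle⟩ := hloc T
  have hbound : ∀ ρ : ℂ, (analyticOrderNatAt S.xi ρ : ℝ) *
      (‖ρ - τ‖⁻¹ * (√(1 + (T - ρ.im) ^ 2))⁻¹) ≤
      2 * q⁻¹ * ((analyticOrderNatAt S.xi ρ : ℝ) * ‖ρ - τ‖ ^ (-(3 / 2) : ℝ)) +
        2 * (q ^ 3)⁻¹ * ((analyticOrderNatAt S.xi ρ : ℝ) * (1 + (T - ρ.im) ^ 2)⁻¹) := by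
    intro ρ
    by_cases hρ : S.xi ρ = 0
    · have hr0 : 0 < ‖ρ - τ‖ := norm_pos_iff.2 fun h => hτ (by rwa [sub_eq_zero.1 h] at hρ)
      have hv : 0 < √(1 + (T - ρ.im) ^ 2) := by positivity
      have hu2 : √‖ρ - τ‖ ^ 2 = ‖ρ - τ‖ := Real.sq_sqrt hr0.le
      have key := inv_sq_mul_le_of_le (v := (√(1 + (T - ρ.im) ^ 2))⁻¹) hq (Real.sqrt_pos.2 hr0)
        (inv_pos.2 hv) (by
          intro h
          rw [hu2] at h
          have him : |ρ.im| ≤ ‖ρ - τ‖ := by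
            simpa using abs_im_le_norm (ρ - τ)
          have h1 : q ^ 8 / 2 ≤ |T - ρ.im| := by
            have := abs_sub_abs_le_abs_sub T ρ.im
            linarith
          have h2 : q ^ 8 / 2 ≤ √(1 + (T - ρ.im) ^ 2) := by
            refine h1.trans (Real.abs_le_sqrt (by linarith))
          rw [← inv_div]
          exact inv_anti₀ (by positivity) h2)
      have e1 : (√‖ρ - τ‖ ^ 3)⁻¹ = ‖ρ - τ‖ ^ (-(3 / 2) : ℝ) := by
        rw [Real.sqrt_eq_rpow, ← Real.rpow_natCast, ← Real.rpow_mul hr0.le, ← Real.rpow_neg hr0.le]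
        norm_num
      have e2 : (√(1 + (T - ρ.im) ^ 2))⁻¹ ^ 2 = (1 + (T - ρ.im) ^ 2)⁻¹ := by
        rw [inv_pow, Real.sq_sqrt (by positivity)]
      rw [hu2, e1, e2] at key
      calc _ ≤ (analyticOrderNatAt S.xi ρ : ℝ) * _ := mul_le_mul_of_nonneg_left key (by positivity)
        _ = _ := by ring
    · simp [analyticOrderNatAt_eq_zero_of_apply_ne_zero hρ]
  have hmaj := (hsum.mul_left (2 * q⁻¹)).add (hs.mul_left (2 * (q ^ 3)⁻¹))
  have hS := Summable.of_nonneg_of_le (fun ρ => by positivity) hbound hmaj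
  refine ⟨hS, (hS.tsum_le_tsum hbound hmaj).trans ?_⟩
  rw [(hsum.mul_left _).tsum_add (hs.mul_left _), tsum_mul_left, tsum_mul_left, ← hD]
  have h1 : (1 + |T|) ^ (1 / 4 : ℝ) ≤ 2 * q ^ 2 := by
    have h8 : (1 : ℝ) ≤ q ^ 8 := one_le_pow₀ hq
    calc (1 + |T|) ^ (1 / 4 : ℝ) ≤ ((2 * q ^ 2) ^ 4 : ℝ) ^ (1 / 4 : ℝ) := by
          refine Real.rpow_le_rpow (by positivity) ?_ (by norm_num)
          rw [hT, mul_pow, ← pow_mul]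
          norm_num
          linarith
      _ = 2 * q ^ 2 := by
          rw [← Real.rpow_natCast, ← Real.rpow_mul (by positivity)]
          norm_num
  have h2 : ∑' ρ : ℂ, (analyticOrderNatAt S.xi ρ : ℝ) * (1 + (T - ρ.im) ^ 2)⁻¹ ≤
      C * (2 * q ^ 2) := hle.trans (by gcongr)
  calc _ ≤ 2 * q⁻¹ * D + 2 * (q ^ 3)⁻¹ * (C * (2 * q ^ 2)) := by gcongr
    _ = _ := by field_simp

theorem tendsto_tsum_indicator_im_inv_sub (hτA : τ ≤ A) (hτ : S.xi τ ≠ 0) :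
    Tendsto (fun T : ℝ => ∑' ρ : ℂ, (analyticOrderNatAt S.xi ρ : ℝ) * (1 / (ρ - τ)).im *
      (if |ρ.im| ≤ T then 1 else 0)) atTop (nhds (-(logDeriv S.xi τ).im)) := by
  obtain ⟨C, hC⟩ := hA.exists_tsum_inv_norm_mul_le hτ
  set b := logDeriv S.xi τ with hb
  set H : ℝ := 2 * A + 1 - σ1 with hH
  have hlimJ : Tendsto (fun T : ℝ =>
      ((∫ t in -T..T, logDeriv S.xi ((A + 1 : ℝ) + t * I) / ((A + 1 : ℝ) + t * I - τ)) -
        b * verticalLog (A + 1) T τ).im) atTop (nhds (-(Real.pi * b.im))) := by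
    have h1 := hA.tendsto_im_integral hτA hτ
    have h2 := (Complex.continuous_im.tendsto _).comp
      ((tendsto_verticalLog_ofReal (a := A + 1) (τ := τ) (by linarith)).const_mul b)
    have h3 := h1.sub h2
    rw [zero_sub, Complex.im_mul_ofReal, mul_comm] at h3
    exact h3
  have hlimre := hlimJ.sub (hA.tendsto_tsum_re_mul_verticalLog_im hτ)
  rw [sub_zero] at hlimre
  have hre : ∀ ρ : ℂ, S.xi ρ = 0 → 1 ≤ (A + 1) - ρ.re ∧ (A + 1) - ρ.re ≤ H := fun ρ hρ => by
    have := hA.re_mem_of_xi_eq_zero hτ hρ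
    constructor <;> linarith [this.1, this.2]
  -- the error made when replacing the argument variation by its limit
  set err : ℝ → ℂ → ℝ := fun T ρ => (analyticOrderNatAt S.xi ρ : ℝ) * (1 / (ρ - τ)).im *
    ((verticalLog (A + 1) T ρ).re - (if |ρ.im| ≤ T then Real.pi else 0)) with herr
  have herrb : ∀ q : ℝ, 1 ≤ q → Summable (err (q ^ 8)) ∧
      ‖∑' ρ, err (q ^ 8) ρ‖ ≤ Real.pi / 2 * H * (2 * C) * q⁻¹ := by
    intro q hq
    have hq8 : 0 ≤ q ^ 8 := by positivity
    obtain ⟨s1, l1⟩ := hC q (q ^ 8) hq (abs_of_nonneg hq8)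
    obtain ⟨s2, l2⟩ := hC q (-q ^ 8) hq (by rw [abs_neg, abs_of_nonneg hq8])
    have hbd : ∀ ρ : ℂ, ‖err (q ^ 8) ρ‖ ≤ Real.pi / 2 * H * ((analyticOrderNatAt S.xi ρ : ℝ) *
      (‖ρ - τ‖⁻¹ * (√(1 + (q ^ 8 - ρ.im) ^ 2))⁻¹) + (analyticOrderNatAt S.xi ρ : ℝ) *
      (‖ρ - τ‖⁻¹ * (√(1 + (-q ^ 8 - ρ.im) ^ 2))⁻¹)) := by
      intro ρ
      by_cases hρ : S.xi ρ = 0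
      · have h1 := abs_verticalLog_re_sub_le (T := q ^ 8) (hre ρ hρ).1 hq8
        have h2 : |(1 / (ρ - τ)).im| ≤ ‖ρ - τ‖⁻¹ := by
          rw [one_div, ← norm_inv]; exact abs_im_le_norm _
        rw [herr]
        rw [norm_mul, norm_mul, Real.norm_natCast, Real.norm_eq_abs, Real.norm_eq_abs]
        have h3 := (hre ρ hρ).2
        have h4 : |(verticalLog (A + 1) (q ^ 8) ρ).re - (if |ρ.im| ≤ q ^ 8 then Real.pi else 0)| ≤
            Real.pi / 2 * H *
              ((√(1 + (q ^ 8 - ρ.im) ^ 2))⁻¹ + (√(1 + (-q ^ 8 - ρ.im) ^ 2))⁻¹) := by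
          refine h1.trans ?_
          have := Real.pi_pos
          gcongr
        calc _ ≤ (analyticOrderNatAt S.xi ρ : ℝ) * ‖ρ - τ‖⁻¹ * (Real.pi / 2 * H *
              ((√(1 + (q ^ 8 - ρ.im) ^ 2))⁻¹ + (√(1 + (-q ^ 8 - ρ.im) ^ 2))⁻¹)) :=
              mul_le_mul (mul_le_mul_of_nonneg_left h2 (by positivity)) h4 (abs_nonneg _)
                (by positivity)
          _ = _ := by ring
      · simp [herr, analyticOrderNatAt_eq_zero_of_apply_ne_zero hρ]
    have hmaj := (s1.add s2).mul_left (Real.pi / 2 * H)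
    refine ⟨Summable.of_norm_bounded hmaj hbd, (tsum_of_norm_bounded hmaj.hasSum hbd).trans ?_⟩
    rw [tsum_mul_left, s1.tsum_add s2]
    have hH0 : 0 ≤ H := by have := S.hσ1pos; have := hA.hσ1; linarith
    have := Real.pi_pos
    calc _ ≤ Real.pi / 2 * H * (C * q⁻¹ + C * q⁻¹) := by gcongr
      _ = _ := by ring
  have hq : ∀ T : ℝ, 1 ≤ T → 1 ≤ T ^ (1 / 8 : ℝ) ∧ (T ^ (1 / 8 : ℝ)) ^ 8 = T := by
    intro T hT
    refine ⟨Real.one_le_rpow hT (by norm_num), ?_⟩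
    rw [← Real.rpow_natCast, ← Real.rpow_mul (by linarith)]
    norm_num
  have hlimerr : Tendsto (fun T : ℝ => ∑' ρ, err T ρ) atTop (nhds 0) := by
    have hlim : Tendsto (fun T : ℝ => Real.pi / 2 * H * (2 * C) * (T ^ (1 / 8 : ℝ))⁻¹) atTop
        (nhds 0) := by
      have := (tendsto_inv_atTop_zero.comp (tendsto_rpow_atTop (y := (1 / 8 : ℝ))
        (by norm_num))).const_mul (Real.pi / 2 * H * (2 * C))
      simpa using this
    refine squeeze_zero_norm' ?_ hlim
    filter_upwards [eventually_ge_atTop 1] with T hT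
    obtain ⟨h1, h2⟩ := hq T hT
    have := (herrb _ h1).2
    rwa [h2] at this
  have hfin := (hlimre.sub hlimerr).const_mul (Real.pi⁻¹)
  have hpi := Real.pi_ne_zero
  have e : Real.pi⁻¹ * (-(Real.pi * b.im) - 0) = -b.im := by field_simp; ring
  rw [e] at hfin
  refine hfin.congr' ?_
  filter_upwards [eventually_ge_atTop 1] with T hT
  obtain ⟨h1, h2⟩ := hq T hT
  have hsumerr := (herrb _ h1).1
  rw [h2] at hsumerr
  have hJ := Complex.hasSum_im (hA.hasSum_inv_sub_mul_verticalLog hτA hτ T)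
  have hκ : Summable fun ρ : ℂ => (analyticOrderNatAt S.xi ρ : ℝ) * (1 / (ρ - τ)).re *
      (verticalLog (A + 1) T ρ).im :=
    hA.summable_re_mul_verticalLog_im hτ T
  have h3 := ((hJ.sub hκ.hasSum).sub hsumerr.hasSum).mul_left Real.pi⁻¹
  rw [← h3.tsum_eq]
  refine tsum_congr fun ρ => ?_
  rw [mul_assoc, ← Complex.ofReal_natCast, Complex.im_ofReal_mul, mul_im]
  simp only [herr]
  split_ifs <;> field_simp <;> ring

end SSF.IsFar

theorem hasFPowerSeriesAt_ofScalars_of_hasSum {f : ℂ → ℂ} {d : ℕ → ℂ} {z₀ : ℂ}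
    (h : ∀ᶠ z in nhds z₀, HasSum (fun m : ℕ => d m * (z - z₀) ^ m) (f z)) :
    HasFPowerSeriesAt f (FormalMultilinearSeries.ofScalars ℂ d) z₀ := by
  rw [hasFPowerSeriesAt_iff']
  filter_upwards [h] with z hz
  refine hz.congr_fun fun m => ?_
  simp [FormalMultilinearSeries.coeff_ofScalars, mul_comm]

theorem coeff_eq_of_eventually_hasSum {f : ℂ → ℂ} {d d' : ℕ → ℂ} {z₀ : ℂ}
    (h : ∀ᶠ z in nhds z₀, HasSum (fun m : ℕ => d m * (z - z₀) ^ m) (f z))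
    (h' : ∀ᶠ z in nhds z₀, HasSum (fun m : ℕ => d' m * (z - z₀) ^ m) (f z)) : d = d' := by
  have e := (hasFPowerSeriesAt_ofScalars_of_hasSum h).eq_formalMultilinearSeries
    (hasFPowerSeriesAt_ofScalars_of_hasSum h')
  funext m
  have := congrArg (fun p => p.coeff m) e
  simpa [FormalMultilinearSeries.coeff_ofScalars] using this

theorem zeroOrder_eq_analyticOrderNatAt {f : ℂ → ℂ} {c : ℂ} (hf : Differentiable ℂ f)
    (hc : f c ≠ 0) (ρ : ℂ) : zeroOrder f ρ = analyticOrderNatAt f ρ := by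
  have h := (Nat.cast_analyticOrderNatAt
    (analyticOrderAt_ne_top_of_apply_ne_zero hf hc ρ)).symm
  obtain ⟨h1, h2⟩ := 
    (analyticOrderAt_eq_nat_iff_iteratedDeriv_eq_zero (hf.analyticAt ρ)).1 h
  refine le_antisymm (Nat.sInf_le h2) (le_csInf ⟨_, h2⟩ fun k hk => ?_)
  by_contra hlt
  exact hk (h1 k (not_le.1 hlt))

theorem hasSum_one_sub_pow_add_mul {t y : ℂ} (hy : ‖y‖ < 1) (hty : ‖(1 + t) * y‖ < 1) :
    HasSum (fun k : ℕ => (1 - (1 + t) ^ (k + 1) + (k + 1) * t) * y ^ k)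
      (1 / (1 - y) - (1 + t) / (1 - (1 + t) * y) + t / (1 - y) ^ 2) := by
  have h1 := hasSum_geometric_of_norm_lt_one hy
  have h2 := (hasSum_geometric_of_norm_lt_one hty).mul_left (1 + t)
  have h3 := ((hasSum_coe_mul_geometric_of_norm_lt_one hy).add h1).mul_left t
  have h4 := (h1.sub h2).add h3
  have hy1 : 1 - y ≠ 0 := fun h => by
    rw [← sub_eq_zero.1 h] at hy; simp at hy
  convert! h4 using 1
  · funext k
    rw [mul_pow]; ring
  · have h5 : t / (1 - y) ^ 2 = t * (y / (1 - y) ^ 2 + (1 - y)⁻¹) := by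
      field_simp; ring
    rw [h5, div_eq_mul_inv (1 + t), one_div]

theorem sq_mul_partialFraction_eq {τ x P Q m : ℂ} (hQ : Q ≠ 0) (hP : P ≠ 0) (hx : x ≠ 0)
    (h : P = (1 + τ * x) * Q - τ * x) : (τ / Q) ^ 2 * (m * (1 / (-P / (x * Q)) + x)) =
      τ * m * (1 / Q - (1 + τ * x) / P + τ * x / Q ^ 2) := by
  have h1 : 1 / (-P / (x * Q)) = -(x * Q) / P := by
    rw [one_div_div, neg_div, div_neg]
  have h2 : 1 / Q - (1 + τ * x) / P = -(τ * x) / (Q * P) := by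
    rw [div_sub_div _ _ hQ hP]
    congr 1
    rw [h]; ring
  rw [h1, h2]
  field_simp

theorem norm_one_sub_pow_add_mul_le {t : ℂ} {K : ℝ} (hK : 1 + ‖t‖ ≤ K) (n : ℕ) :
    ‖1 - (1 + t) ^ n + n * t‖ ≤ (2 * K) ^ n * ‖t‖ ^ 2 := by
  have ht := norm_nonneg t
  have hK0 : 0 ≤ K := by linarith
  induction n with
  | zero => simp
  | succ n ih =>
    have e : 1 - (1 + t) ^ (n + 1) + ((n + 1 : ℕ) : ℂ) * t =
        (1 - (1 + t) ^ n + n * t) * (1 + t) - n * t ^ 2 := by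
      push_cast; ring
    have h1 : ‖1 + t‖ ≤ K := (norm_add_le _ _).trans (by rwa [norm_one])
    have h2 : (n : ℝ) ≤ K * (2 * K) ^ n := by
      have h3 : (n : ℝ) ≤ 2 ^ n := by exact_mod_cast Nat.lt_two_pow_self.le
      have h4 : (2 : ℝ) ^ n ≤ (2 * K) ^ n := pow_le_pow_left₀ (by norm_num) (by linarith) n
      have h5 : 0 ≤ (2 * K) ^ n := by positivity
      nlinarith
    rw [e]
    calc _ ≤ ‖1 - (1 + t) ^ n + n * t‖ * ‖1 + t‖ + n * ‖t‖ ^ 2 := by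
          refine (norm_sub_le _ _).trans ?_
          rw [norm_mul, norm_mul, norm_pow, Complex.norm_natCast]
      _ ≤ (2 * K) ^ n * ‖t‖ ^ 2 * K + K * (2 * K) ^ n * ‖t‖ ^ 2 := by gcongr
      _ = _ := by ring

/-- The function `h(z) = (1 - z)⁻² (f'/f)(1/(1 - z))` for `z = 1 - 1/τ + w`, expanded as a double
series over the zeros of `f` and the powers of `w`. -/
theorem GrowthBound.eventually_hasSum_taylor {f : ℂ → ℂ} {τ : ℂ} (hg : GrowthBound f τ)
    (hf : Differentiable ℂ f) (hfτ : f τ ≠ 0) (hτ : τ ≠ 0) :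
    (∀ n : ℕ, Summable fun ρ : ℂ => (analyticOrderNatAt f ρ : ℂ) *
      (1 - (ρ / (ρ - τ)) ^ n + n * (τ * (1 / (ρ - τ))))) ∧
    ∀ᶠ z in nhds (1 - 1 / τ), HasSum (fun k : ℕ => (τ ^ (k + 1) *
        ((∑' ρ : ℂ, (analyticOrderNatAt f ρ : ℂ) *
          (1 - (ρ / (ρ - τ)) ^ (k + 1) + ((k + 1 : ℕ) : ℂ) * (τ * (1 / (ρ - τ))))) +
          ((k + 1 : ℕ) : ℂ) * τ * logDeriv f τ)) * (z - (1 - 1 / τ)) ^ k)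
      (((1 - z) ^ 2)⁻¹ * logDeriv f (1 / (1 - z))) := by
  obtain ⟨W, hW, hWb⟩ := exists_one_add_norm_sub_le hf.continuous hfτ τ
  set m : ℂ → ℕ := analyticOrderNatAt f with hm
  have hm0 : ∀ ρ, f ρ ≠ 0 → m ρ = 0 := fun ρ hρ => analyticOrderNatAt_eq_zero_of_apply_ne_zero hρ
  have hne : ∀ ρ, f ρ = 0 → ρ - τ ≠ 0 := fun ρ hρ h => hfτ (by rwa [sub_eq_zero.1 h] at hρ)
  set K : ℝ := 1 + ‖τ‖ * W with hK
  have hK1 : 1 ≤ K := by have : 0 ≤ ‖τ‖ * W := by positivity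
                         linarith
  have hx : ∀ ρ, f ρ = 0 → 1 + ‖τ * (1 / (ρ - τ))‖ ≤ K := fun ρ hρ => by
    have h1 := norm_pos_iff.2 (hne ρ hρ)
    have h2 : 1 / ‖ρ - τ‖ ≤ W := by
      rw [div_le_iff₀ h1]; linarith [hWb ρ hρ]
    rw [norm_mul, norm_div, norm_one, hK]
    gcongr
  have hκ : ∀ ρ, f ρ = 0 → ρ / (ρ - τ) = 1 + τ * (1 / (ρ - τ)) := fun ρ hρ => by
    have := hne ρ hρ
    field_simp; ring
  set u : ℕ → ℂ → ℂ := fun n ρ => (m ρ : ℂ) *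
      (1 - (ρ / (ρ - τ)) ^ n + n * (τ * (1 / (ρ - τ)))) with hu
  have hub : ∀ n ρ, ‖u n ρ‖ ≤ (2 * K) ^ n * ‖τ‖ ^ 2 * ((m ρ : ℝ) * (‖ρ - τ‖ ^ 2)⁻¹) := by
    intro n ρ
    by_cases hρ : f ρ = 0
    · have h := norm_one_sub_pow_add_mul_le (hx ρ hρ) n
      simp only [hu]
      rw [hκ ρ hρ, norm_mul, Complex.norm_natCast]
      calc _ ≤ (m ρ : ℝ) * ((2 * K) ^ n * ‖τ * (1 / (ρ - τ))‖ ^ 2) := by gcongr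
        _ = _ := by rw [norm_mul, norm_div, norm_one, one_div, mul_pow ‖τ‖, inv_pow]; ring
    · simp [hu, hm0 ρ hρ]
  have hsum := hg.summable_norm_inv_sq hf hfτ
  refine ⟨fun n => (hsum.mul_left _).of_norm_bounded (hub n), ?_⟩
  -- near `1 - 1/τ` everything converges geometrically
  set z₀ : ℂ := 1 - 1 / τ with hz₀
  have hev1 : ∀ᶠ z in nhds z₀, ‖τ * (z - z₀)‖ < 1 / (2 * K) := by
    have hc : ContinuousAt (fun z : ℂ => ‖τ * (z - z₀)‖) z₀ := by fun_prop
    refine hc.eventually_lt continuousAt_const ?_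
    simp; positivity
  have hev2 : ∀ᶠ z in nhds z₀, f (1 / (1 - z)) ≠ 0 := by
    have h1 : 1 - z₀ = 1 / τ := by rw [hz₀]; ring
    have hc : ContinuousAt (fun z : ℂ => f (1 / (1 - z))) z₀ := by
      refine ContinuousAt.comp (g := f) (f := fun z : ℂ => 1 / (1 - z)) hf.continuous.continuousAt ?_
      refine continuousAt_const.div (by fun_prop) ?_
      rw [h1]; exact one_div_ne_zero hτ
    refine hc.eventually_ne ?_
    rw [h1, one_div_one_div]; exact hfτ
  filter_upwards [hev1, hev2] with z hz1 hz2
  set y : ℂ := τ * (z - z₀) with hy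
  have hyK : 2 * K * ‖y‖ < 1 := by
    rw [lt_div_iff₀ (by positivity)] at hz1; linarith
  have hy1 : ‖y‖ < 1 := by nlinarith [norm_nonneg y]
  have hy0 : 1 - y ≠ 0 := fun h => by
    rw [← sub_eq_zero.1 h] at hy1; simp at hy1
  have hz : 1 - z = (1 - y) / τ := by
    rw [hy, hz₀]; field_simp; ring
  set s : ℂ := 1 / (1 - z) with hs
  have hsy : s = τ / (1 - y) := by rw [hs, hz, one_div_div]
  have hs2 : ((1 - z) ^ 2)⁻¹ = s ^ 2 := by rw [hs]; simp
  have hterm : ∀ ρ, HasSum (fun k : ℕ => τ * (u (k + 1) ρ * y ^ k))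
      (s ^ 2 * ((m ρ : ℂ) * (1 / (s - ρ) + 1 / (ρ - τ)))) := by
    intro ρ
    by_cases hρ : f ρ = 0
    · set x : ℂ := 1 / (ρ - τ) with hxdef
      have hρτ := hne ρ hρ
      have hx0 : x ≠ 0 := one_div_ne_zero hρτ
      have hρx : ρ = τ + 1 / x := by rw [hxdef, one_div_one_div]; ring
      have hκy : ‖(1 + τ * x) * y‖ < 1 := by
        have h1 : ‖1 + τ * x‖ ≤ K := (norm_add_le _ _).trans (by rw [norm_one]; exact hx ρ hρ)
        rw [norm_mul]
        nlinarith [norm_nonneg y]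
      have hκy0 : 1 - (1 + τ * x) * y ≠ 0 := fun h => by
        rw [← sub_eq_zero.1 h] at hκy; simp at hκy
      have h := (hasSum_one_sub_pow_add_mul hy1 hκy).mul_left (τ * (m ρ : ℂ))
      convert! h using 1
      · funext k
        simp only [hu]
        rw [hκ ρ hρ]
        push_cast
        ring
      · have hsρ : s - ρ = -(1 - (1 + τ * x) * y) / (x * (1 - y)) := by
          rw [hsy, hρx]; field_simp; ring
        rw [hsρ, hsy]
        exact sq_mul_partialFraction_eq hy0 hκy0 hx0 (by ring)
    · simp [hu, hm0 ρ hρ]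
  have hprod : Summable fun p : ℂ × ℕ => τ * (u (p.2 + 1) p.1 * y ^ p.2) := by
    have hgeo : Summable fun k : ℕ => ‖τ‖ * ((2 * K) * ‖τ‖ ^ 2) * (2 * K * ‖y‖) ^ k :=
      (summable_geometric_of_lt_one (by positivity) hyK).mul_left _
    have hmaj := hsum.mul_of_nonneg hgeo (fun ρ => by positivity) (fun k => by positivity)
    refine hmaj.of_norm_bounded fun p => ?_
    rw [norm_mul, norm_mul, norm_pow]
    calc _ ≤ ‖τ‖ * ((2 * K) ^ (p.2 + 1) * ‖τ‖ ^ 2 * ((m p.1 : ℝ) * (‖p.1 - τ‖ ^ 2)⁻¹) *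
          ‖y‖ ^ p.2) := by gcongr; exact hub _ _
      _ = _ := by rw [mul_pow (2 * K) ‖y‖]; ring
  have hV := (hg.hasSum_logDeriv hf hfτ hz2).mul_left (s ^ 2)
  have htot : HasSum (fun p : ℂ × ℕ => τ * (u (p.2 + 1) p.1 * y ^ p.2))
      (s ^ 2 * (logDeriv f s - logDeriv f τ)) := by
    have := hprod.hasSum.prod_fiberwise hterm
    rw [hV.unique this]
    exact hprod.hasSum
  have hswap := (Equiv.prodComm ℕ ℂ).hasSum_iff.2 htot
  have hcol : ∀ k : ℕ, HasSum (fun ρ : ℂ => τ * (u (k + 1) ρ * y ^ k))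
      (τ * ((∑' ρ, u (k + 1) ρ) * y ^ k)) := fun k =>
    ((((hsum.mul_left _).of_norm_bounded (hub (k + 1))).hasSum.mul_right _).mul_left _)
  have h1 := hswap.prod_fiberwise hcol
  have h2 := ((hasSum_coe_mul_geometric_of_norm_lt_one hy1).add
    (hasSum_geometric_of_norm_lt_one hy1)).mul_left (τ ^ 2 * logDeriv f τ)
  convert! h1.add h2 using 1
  · funext k
    change τ ^ (k + 1) * ((∑' ρ, u (k + 1) ρ) + ((k + 1 : ℕ) : ℂ) * τ * logDeriv f τ) *
      (z - z₀) ^ k = _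
    rw [hy, mul_pow]
    push_cast
    ring
  · rw [hs2, hsy]
    field_simp
    ring

theorem tendsto_tsum_mul_indicator_im {E : Type*} [NormedRing E] [CompleteSpace E] {t : ℂ → E}
    (ht : Summable fun ρ => ‖t ρ‖) :
    Tendsto (fun T : ℝ => ∑' ρ, t ρ * (if |ρ.im| ≤ T then 1 else 0)) atTop (nhds (∑' ρ, t ρ)) := by
  refine tendsto_tsum_of_dominated_convergence ht (fun ρ => ?_) (.of_forall fun T ρ => ?_)
  · refine tendsto_const_nhds.congr' ?_
    filter_upwards [eventually_ge_atTop |ρ.im|] with T hT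
    rw [if_pos hT, mul_one]
  · split_ifs <;> simp

namespace SSF

variable {σ0 σ1 : ℝ} {S : SSF σ0 σ1} {A τ : ℝ}

theorem IsFar.finite_zeros (hA : S.IsFar A) {c : ℂ} (hc : S.xi c ≠ 0) (T : ℝ) :
    {ρ : ℂ | S.xi ρ = 0 ∧ |ρ.im| ≤ T}.Finite := by
  have hK : IsCompact (Set.Icc (σ1 - A) A ×ℂ Set.Icc (-T) T) := isCompact_Icc.reProdIm isCompact_Icc
  refine (finite_zeros_inter_isCompact S.hxiDiff hc hK).subset fun ρ hρ => ⟨hρ.1, ?_⟩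
  exact ⟨hA.re_mem_of_xi_eq_zero hc hρ.1, abs_le.1 hρ.2⟩

theorem IsFar.summable_mul_indicator_im (hA : S.IsFar A) {c : ℂ} (hc : S.xi c ≠ 0) (w : ℂ → ℂ)
    (T : ℝ) : Summable fun ρ : ℂ =>
      (analyticOrderNatAt S.xi ρ : ℂ) * w ρ * (if |ρ.im| ≤ T then 1 else 0) := by
  refine summable_of_hasFiniteSupport ((hA.finite_zeros hc T).subset fun ρ hρ => ?_)
  rw [Function.mem_support] at hρ
  constructor
  · by_contra h
    simp [analyticOrderNatAt_eq_zero_of_apply_ne_zero h] at hρ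
  · by_contra h
    simp [h] at hρ

theorem tsum_zeros_eq {c : ℂ} (hc : S.xi c ≠ 0) (w : ℂ → ℂ) (T : ℝ) :
    ∑' ρ : {ρ : ℂ // S.xi ρ = 0 ∧ |ρ.im| ≤ T}, (zeroOrder S.xi ρ : ℂ) * w ρ =
      ∑' ρ : ℂ, (analyticOrderNatAt S.xi ρ : ℂ) * w ρ * (if |ρ.im| ≤ T then 1 else 0) := by
  have h := tsum_subtype {ρ : ℂ | S.xi ρ = 0 ∧ |ρ.im| ≤ T}
    (fun ρ => (zeroOrder S.xi ρ : ℂ) * w ρ)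
  refine h.trans (tsum_congr fun ρ => ?_)
  rw [Set.indicator_apply, zeroOrder_eq_analyticOrderNatAt S.hxiDiff hc]
  by_cases hρ : S.xi ρ = 0
  · simp [hρ]
  · simp [hρ, analyticOrderNatAt_eq_zero_of_apply_ne_zero hρ]

theorem IsFar.tendsto_tsum_inv_sub (hA : S.IsFar A) (hτA : τ ≤ A) (hτ : S.xi τ ≠ 0) :
    Tendsto (fun T : ℝ => ∑' ρ : ℂ, (analyticOrderNatAt S.xi ρ : ℂ) * (1 / (ρ - τ)) *
      (if |ρ.im| ≤ T then 1 else 0)) atTop (nhds (-logDeriv S.xi τ)) := by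
  have hre := hA.hasSum_re_inv_sub hτ
  have h1 := tendsto_tsum_mul_indicator_im hre.summable.norm
  rw [hre.tsum_eq] at h1
  have h2 := hA.tendsto_tsum_indicator_im_inv_sub hτA hτ
  have h3 := ((Complex.continuous_ofReal.tendsto _).comp h1).add
    (((Complex.continuous_ofReal.tendsto _).comp h2).mul_const I)
  have e : (((-(logDeriv S.xi τ).re : ℝ) : ℂ) + ((-(logDeriv S.xi τ).im : ℝ) : ℂ) * I) =
      -logDeriv S.xi τ := by
    apply Complex.ext <;> simp
  rw [e] at h3
  refine h3.congr fun T => ?_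
  have hs := hA.summable_mul_indicator_im hτ (fun ρ => 1 / (ρ - τ)) T
  have hterm : ∀ ρ : ℂ, (analyticOrderNatAt S.xi ρ : ℂ) * (1 / (ρ - τ)) *
      (if |ρ.im| ≤ T then 1 else 0) = (((analyticOrderNatAt S.xi ρ : ℝ) *
      (if |ρ.im| ≤ T then 1 else 0) : ℝ) : ℂ) * (1 / (ρ - τ)) := fun ρ => by
    split_ifs <;> push_cast <;> ring
  rw [← Complex.re_add_im (∑' ρ : ℂ, _ * _ * _), Complex.re_tsum hs, Complex.im_tsum hs]
  simp only [Function.comp_apply, hterm, Complex.re_ofReal_mul, Complex.im_ofReal_mul]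
  simp only [mul_right_comm]

theorem IsFar.tendsto_tsum_tauLi (hA : S.IsFar A) (hτA : τ ≤ A) (hτ : S.xi τ ≠ 0) {n : ℕ}
    (hn : Summable fun ρ : ℂ => (analyticOrderNatAt S.xi ρ : ℂ) *
      (1 - (ρ / (ρ - τ)) ^ n + n * (τ * (1 / (ρ - τ))))) :
    Tendsto (fun T : ℝ => ∑' ρ : ℂ, (analyticOrderNatAt S.xi ρ : ℂ) * (1 - (ρ / (ρ - τ)) ^ n) *
        (if |ρ.im| ≤ T then 1 else 0)) atTop
      (nhds ((∑' ρ : ℂ, (analyticOrderNatAt S.xi ρ : ℂ) *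
        (1 - (ρ / (ρ - τ)) ^ n + n * (τ * (1 / (ρ - τ))))) + n * τ * logDeriv S.xi τ)) := by
  have h1 := tendsto_tsum_mul_indicator_im hn.norm
  have h2 := (hA.tendsto_tsum_inv_sub hτA hτ).const_mul (n * τ : ℂ)
  have h3 := h1.sub h2
  rw [mul_neg, sub_neg_eq_add] at h3
  refine h3.congr fun T => ?_
  rw [← tsum_mul_left, ← (hA.summable_mul_indicator_im hτ _ T).tsum_sub
    ((hA.summable_mul_indicator_im hτ _ T).mul_left _)]
  exact tsum_congr fun ρ => by ring

end SSF

/-- For `F ∈ S^♯♭(σ₀,σ₁)` and `τ ∈ [σ₁, 2σ₀]` with `0, τ ∉ Z(F)`, set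
`z₀ = 1 − 1/τ` and `h(z) = (1−z)⁻² · (ξ_F′/ξ_F)(1/(1−z))`. Then `h` is analytic at `z₀`, and
if `h(z) = ∑_{m≥0} d_F(m,z₀)(z−z₀)^m` is its Taylor expansion at `z₀`, then
`λ_F(n,τ) = τ^{−n}·d_F(n−1,z₀)` for every positive integer `n`. -/
theorem tauLi_eq_taylor_coeff (σ0 σ1 : ℝ) (S : SSF σ0 σ1) (τ : ℝ)
    (hτ1 : σ1 ≤ τ) (hτ2 : τ ≤ 2 * σ0)
    (h0 : S.xi 0 ≠ 0) (hτZ : S.xi (τ : ℂ) ≠ 0) :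
    AnalyticAt ℂ
      (fun z : ℂ => ((1 - z) ^ 2)⁻¹ * (deriv S.xi (1 / (1 - z)) / S.xi (1 / (1 - z))))
      (1 - 1 / (τ : ℂ)) ∧
    ∀ d : ℕ → ℂ,
      (∀ᶠ z in nhds (1 - 1 / (τ : ℂ)),
        HasSum (fun m : ℕ => d m * (z - (1 - 1 / (τ : ℂ))) ^ m)
          (((1 - z) ^ 2)⁻¹ * (deriv S.xi (1 / (1 - z)) / S.xi (1 / (1 - z))))) →
      ∀ n : ℕ, 0 < n →
        Filter.Tendsto (fun T : ℝ =>
            ∑' ρ : {ρ : ℂ // S.xi ρ = 0 ∧ |ρ.im| ≤ T},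
              (zeroOrder S.xi ρ : ℂ) * (1 - ((ρ : ℂ) / ((ρ : ℂ) - τ)) ^ n))
          Filter.atTop (nhds (((τ : ℂ) ^ n)⁻¹ * d (n - 1))) := by
  have hτpos : (τ : ℂ) ≠ 0 := by
    have : 0 < τ := S.hσ1pos.trans_le hτ1
    exact_mod_cast this.ne'
  obtain ⟨A, hτA, hA⟩ := S.exists_isFar τ
  obtain ⟨hsum, hser⟩ :=
    (hA.growthBound_xi τ).eventually_hasSum_taylor S.hxiDiff hτZ hτpos
  simp only [logDeriv_apply] at hser
  refine ⟨(hasFPowerSeriesAt_ofScalars_of_hasSum hser).analyticAt, fun d hd n hn => ?_⟩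
  obtain ⟨k, rfl⟩ := Nat.exists_eq_add_one_of_ne_zero hn.ne'
  rw [coeff_eq_of_eventually_hasSum hd hser]
  have hlim := hA.tendsto_tsum_tauLi hτA hτZ (hsum (k + 1))
  rw [add_tsub_cancel_right, inv_mul_cancel_left₀ (pow_ne_zero _ hτpos), ← logDeriv_apply]
  exact hlim.congr fun T => (SSF.tsum_zeros_eq hτZ _ T).symm

end
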